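/- Let 0 < s < 1. For every ε > 0 there is a constant C_ε, depending only on s and ε (and the constants C_k in the assumptions on φ) and not on N or T, such that for every N ≥ 1, every T > 0, and every function u : ℝ × ℝ² → ℂ, smooth and Schwartz in the space variable for each t ∈ [0,T], one has ‖ I_N(|u|²u) − |I_N u|² I_N u ‖_{L¹_{[0,T]}L²_x} + ‖ ∇_x ( I_N(|u|²u) − |I_N u|² I_N u ) ‖_{L¹_{[0,T]}L²_x} ≤ C_ε N^{−1+ε} Z_I([0,T])³. -/

import Mathlib

open MeasureTheory Real Complex
open scoped FourierTransform ENNReal ContDiff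

noncomputable section

/-- The `j`-th partial derivative of a function on `EuclideanSpace ℝ (Fin n)`. -/
def pd {n : ℕ} {F : Type*} [NormedAddCommGroup F] [NormedSpace ℝ F]
    (j : Fin n) (f : EuclideanSpace ℝ (Fin n) → F) (x : EuclideanSpace ℝ (Fin n)) : F :=
  fderiv ℝ f x (EuclideanSpace.single j 1)

/-- The Laplacian. -/
def lap {n : ℕ} {F : Type*} [NormedAddCommGroup F] [NormedSpace ℝ F]
    (f : EuclideanSpace ℝ (Fin n) → F) (x : EuclideanSpace ℝ (Fin n)) : F :=
  ∑ j, pd j (pd j f) x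

/-- `f` coincides with a (complex-valued) Schwartz function. -/
def IsSchwartz {n : ℕ} (f : EuclideanSpace ℝ (Fin n) → ℂ) : Prop :=
  ∃ g : SchwartzMap (EuclideanSpace ℝ (Fin n)) ℂ, ⇑g = f

/-- `f` coincides with a (real-valued) Schwartz function. -/
def IsSchwartzR {n : ℕ} (f : EuclideanSpace ℝ (Fin n) → ℝ) : Prop :=
  ∃ g : SchwartzMap (EuclideanSpace ℝ (Fin n)) ℝ, ⇑g = f

/-- A (smooth, spatially Schwartz) solution of the defocusing cubic NLS
`i ∂ₜ u + Δ u = |u|² u` on `[0,T] × ℝⁿ`. -/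
def IsNLSSolution (n : ℕ) (T : ℝ) (u : ℝ → EuclideanSpace ℝ (Fin n) → ℂ) : Prop :=
  ContDiff ℝ ∞ (Function.uncurry u) ∧
  (∀ t ∈ Set.Icc (0:ℝ) T, IsSchwartz (u t)) ∧
  (∀ t ∈ Set.Icc (0:ℝ) T, ∀ x, Complex.I * deriv (fun s => u s x) t + lap (u t) x
      = (‖u t x‖ : ℂ)^2 * u t x)

/-- Inhomogeneous Sobolev norm via the Fourier transform. -/
def HsNorm {n : ℕ} (σ : ℝ) (f : EuclideanSpace ℝ (Fin n) → ℂ) : ℝ :=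
  (∫ ξ, (1 + ‖ξ‖) ^ (2 * σ) * ‖𝓕 f ξ‖ ^ 2) ^ ((1:ℝ)/2)

/-- Homogeneous Sobolev norm via the Fourier transform. -/
def HdotNorm {n : ℕ} (σ : ℝ) (f : EuclideanSpace ℝ (Fin n) → ℂ) : ℝ :=
  (∫ ξ, ‖ξ‖ ^ (2 * σ) * ‖𝓕 f ξ‖ ^ 2) ^ ((1:ℝ)/2)

/-- The Fourier multiplier operator with (real) symbol `m`. -/
def fourierMult {n : ℕ} (m : EuclideanSpace ℝ (Fin n) → ℝ) (f : EuclideanSpace ℝ (Fin n) → ℂ) :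
    EuclideanSpace ℝ (Fin n) → ℂ :=
  𝓕⁻ (fun ξ => (m ξ : ℂ) * 𝓕 f ξ)

/-- The standing hypotheses on the radial profile `φ` of the symbol of the smoothing
operator `I = I_N`, with derivative-bound constants `Ck` (independent of `N`). -/
structure IMultiplier (s N : ℝ) (Ck : ℕ → ℝ) (φ : ℝ → ℝ) : Prop where
  contDiff : ContDiffOn ℝ ∞ φ (Set.Ioi 0)
  pos : ∀ r > (0:ℝ), 0 < φ r
  le_one : ∀ r > (0:ℝ), φ r ≤ 1
  anti : AntitoneOn φ (Set.Ioi 0)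
  eq_one : ∀ r : ℝ, 0 < r → r ≤ N → φ r = 1
  eq_pow : ∀ r : ℝ, 2 * N ≤ r → φ r = (r / N) ^ (s - 1)
  mono_mul : MonotoneOn (fun r => r * φ r) (Set.Ioi 0)
  deriv_bound : ∀ k : ℕ, 1 ≤ k → ∀ r > (0:ℝ), |iteratedDeriv k φ r| ≤ Ck k * φ r * r ^ (-(k:ℝ))

/-- The smoothing operator `I = I_N`, a Fourier multiplier with symbol `φ (|ξ|)`. -/
def Iop {n : ℕ} (φ : ℝ → ℝ) (f : EuclideanSpace ℝ (Fin n) → ℂ) : EuclideanSpace ℝ (Fin n) → ℂ :=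
  fourierMult (fun ξ => φ ‖ξ‖) f

/-- The operator `⟨D⟩ I_N`, a Fourier multiplier with symbol `(1 + |ξ|) φ (|ξ|)`. -/
def DIop {n : ℕ} (φ : ℝ → ℝ) (f : EuclideanSpace ℝ (Fin n) → ℂ) : EuclideanSpace ℝ (Fin n) → ℂ :=
  fourierMult (fun ξ => (1 + ‖ξ‖) * φ ‖ξ‖) f

/-- Mixed space-time norm `‖v‖_{L^q_{[0,T]} L^r_x}` (with values in `ℝ≥0∞`). -/
def mixNorm {α : Type*} [MeasureSpace α] {F : Type*} [NormedAddCommGroup F]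
    (T : ℝ) (q r : ℝ≥0∞) (v : ℝ → α → F) : ℝ≥0∞ :=
  eLpNorm (fun t => (eLpNorm (v t) r volume).toReal) q (volume.restrict (Set.Ioc 0 T))

/-- An admissible pair in `ℝ²`: `1/q + 1/r = 1/2` and `2 < q ≤ ∞`. -/
def Admissible (q r : ℝ≥0∞) : Prop := 1/q + 1/r = 1/2 ∧ 2 < q

/-- The `L²` norm. -/
def L2Norm {n : ℕ} (f : EuclideanSpace ℝ (Fin n) → ℂ) : ℝ :=
  (∫ x, ‖f x‖ ^ 2) ^ ((1:ℝ)/2)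

/-- The `L²` norm of the (spatial) gradient. -/
def gradL2Norm {n : ℕ} (f : EuclideanSpace ℝ (Fin n) → ℂ) : ℝ :=
  (∫ x, ∑ j, ‖pd j f x‖ ^ 2) ^ ((1:ℝ)/2)

/-- Space-time `L⁴_{[0,T]} L⁴_x` norm (real-valued). -/
def L4L4Norm {n : ℕ} (T : ℝ) (v : ℝ → EuclideanSpace ℝ (Fin n) → ℂ) : ℝ :=
  (∫ t in Set.Ioc (0:ℝ) T, ∫ x, ‖v t x‖ ^ 4) ^ ((1:ℝ)/4)

/-- The modified energy `E(v) = ½∫|∇v|² + ¼∫|v|⁴`. -/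
def energy {n : ℕ} (v : EuclideanSpace ℝ (Fin n) → ℂ) : ℝ :=
  (1/2) * (∫ x, ∑ j, ‖pd j v x‖ ^ 2) + (1/4) * ∫ x, ‖v x‖ ^ 4

/-- The Morawetz action `M_a(t) = 2 ∫ ∇a · Im (ū ∇u) dx`. -/
def morAction {n : ℕ} (a : EuclideanSpace ℝ (Fin n) → ℝ)
    (u : ℝ → EuclideanSpace ℝ (Fin n) → ℂ) (t : ℝ) : ℝ :=
  2 * ∫ x, ∑ j, pd j a x * ((starRingEnd ℂ) (u t x) * pd j (u t) x).im

/-- All derivatives of `a` grow at most polynomially. -/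
def PolyGrowth {n : ℕ} (a : EuclideanSpace ℝ (Fin n) → ℝ) : Prop :=
  ∀ k : ℕ, ∃ C d : ℝ, ∀ x, ‖iteratedFDeriv ℝ k a x‖ ≤ C * (1 + ‖x‖) ^ d

/-- The cubic nonlinearity `|u|²u`. -/
def cubicN {n : ℕ} (u : ℝ → EuclideanSpace ℝ (Fin n) → ℂ) (t : ℝ)
    (x : EuclideanSpace ℝ (Fin n)) : ℂ :=
  ((‖u t x‖ ^ 2 : ℝ) : ℂ) * u t x

/-- The commutator `W = I_N(|u|²u) - |I_N u|² I_N u`. -/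
def Wcomm {n : ℕ} (φ : ℝ → ℝ) (u : ℝ → EuclideanSpace ℝ (Fin n) → ℂ) (t : ℝ)
    (x : EuclideanSpace ℝ (Fin n)) : ℂ :=
  Iop φ (cubicN u t) x - ((‖Iop φ (u t) x‖ ^ 2 : ℝ) : ℂ) * Iop φ (u t) x

/-- The bad part `Ñ_bad` of the nonlinearity on `ℝ² × ℝ²`. -/
def Nbad (φ : ℝ → ℝ) (u : ℝ → EuclideanSpace ℝ (Fin 2) → ℂ) (t : ℝ)
    (p : EuclideanSpace ℝ (Fin 2) × EuclideanSpace ℝ (Fin 2)) : ℂ :=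
  Wcomm φ u t p.1 * Iop φ (u t) p.2 + Wcomm φ u t p.2 * Iop φ (u t) p.1

/-- The tensor product `I_N u (t,x₁) · I_N u (t,x₂)`. -/
def tensIu (φ : ℝ → ℝ) (u : ℝ → EuclideanSpace ℝ (Fin 2) → ℂ) (t : ℝ)
    (p : EuclideanSpace ℝ (Fin 2) × EuclideanSpace ℝ (Fin 2)) : ℂ :=
  Iop φ (u t) p.1 * Iop φ (u t) p.2

/-- The component of the momentum bracket `{F, G}_p` in the direction `v`. -/
def bracketDir (F G : EuclideanSpace ℝ (Fin 2) × EuclideanSpace ℝ (Fin 2) → ℂ)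
    (p v : EuclideanSpace ℝ (Fin 2) × EuclideanSpace ℝ (Fin 2)) : ℝ :=
  (F p * (starRingEnd ℂ) (fderiv ℝ G p v) - G p * (starRingEnd ℂ) (fderiv ℝ F p v)).re

/-- The error density `∇a · { Ñ_bad , I_N u ⊗ I_N u }_p (x₁, x₂)`. -/
def errDensity (a : EuclideanSpace ℝ (Fin 2) × EuclideanSpace ℝ (Fin 2) → ℝ)
    (φ : ℝ → ℝ) (u : ℝ → EuclideanSpace ℝ (Fin 2) → ℂ) (t : ℝ)
    (p : EuclideanSpace ℝ (Fin 2) × EuclideanSpace ℝ (Fin 2)) : ℝ :=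
  (∑ j : Fin 2, fderiv ℝ a p (EuclideanSpace.single j 1, 0) *
      bracketDir (Nbad φ u t) (tensIu φ u t) p (EuclideanSpace.single j 1, 0))
  + ∑ j : Fin 2, fderiv ℝ a p (0, EuclideanSpace.single j 1) *
      bracketDir (Nbad φ u t) (tensIu φ u t) p (0, EuclideanSpace.single j 1)

/-- The Strichartz-type norm `Z_I([0,T])`: the sup over admissible pairs of the mixed
norms of `⟨D⟩ I_N u`. -/
def ZInorm (T : ℝ) (φ : ℝ → ℝ) (u : ℝ → EuclideanSpace ℝ (Fin 2) → ℂ) : ℝ≥0∞ :=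
  ⨆ q, ⨆ r, ⨆ (_ : Admissible q r), mixNorm T q r (fun t => DIop φ (u t))

/-- The Euclidean plane. -/
abbrev Plane := EuclideanSpace ℝ (Fin 2)

/-- Continuous symbols of polynomial growth. -/
def symbols : Subalgebra ℂ (Plane → ℂ) where
  carrier := {b | Continuous b ∧ ∃ C : ℝ, ∃ k : ℕ, ∀ ξ, ‖b ξ‖ ≤ C * (1 + ‖ξ‖) ^ k}
  mul_mem' := by
    rintro a b ⟨ha, C, k, hC⟩ ⟨hb, C', k', hC'⟩
    refine ⟨ha.mul hb, C * C', k + k', fun ξ => ?_⟩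
    calc ‖a ξ * b ξ‖ = ‖a ξ‖ * ‖b ξ‖ := norm_mul _ _
      _ ≤ (C * (1 + ‖ξ‖) ^ k) * (C' * (1 + ‖ξ‖) ^ k') :=
          mul_le_mul (hC ξ) (hC' ξ) (norm_nonneg _) ((norm_nonneg _).trans (hC ξ))
      _ = _ := by ring
  add_mem' := by
    rintro a b ⟨ha, C, k, hC⟩ ⟨hb, C', k', hC'⟩
    refine ⟨ha.add hb, |C| + |C'|, max k k', fun ξ => ?_⟩
    have h1 : (1 : ℝ) ≤ 1 + ‖ξ‖ := by linarith [norm_nonneg ξ]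
    calc ‖a ξ + b ξ‖ ≤ ‖a ξ‖ + ‖b ξ‖ := norm_add_le _ _
      _ ≤ C * (1 + ‖ξ‖) ^ k + C' * (1 + ‖ξ‖) ^ k' := add_le_add (hC ξ) (hC' ξ)
      _ ≤ |C| * (1 + ‖ξ‖) ^ max k k' + |C'| * (1 + ‖ξ‖) ^ max k k' := by
          gcongr
          · exact le_abs_self C
          · exact le_max_left _ _
          · exact le_abs_self C'
          · exact le_max_right _ _
      _ = _ := by ring
  algebraMap_mem' := fun r => ⟨continuous_const, ‖r‖, 0, fun ξ => by simp [Pi.algebraMap_apply]⟩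

/-- Continuous rapidly decreasing functions on the frequency plane. -/
def spectra : Submodule ℂ (Plane → ℂ) where
  carrier := {F | Continuous F ∧ ∀ k : ℕ, ∃ C : ℝ, ∀ ξ, (1 + ‖ξ‖) ^ k * ‖F ξ‖ ≤ C}
  add_mem' := by
    rintro F G ⟨hF, hF'⟩ ⟨hG, hG'⟩
    refine ⟨hF.add hG, fun k => ?_⟩
    obtain ⟨C, hC⟩ := hF' k
    obtain ⟨C', hC'⟩ := hG' k
    refine ⟨C + C', fun ξ => ?_⟩
    calc (1 + ‖ξ‖) ^ k * ‖F ξ + G ξ‖ ≤ (1 + ‖ξ‖) ^ k * (‖F ξ‖ + ‖G ξ‖) := by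
          gcongr; exact norm_add_le _ _
      _ ≤ _ := by rw [mul_add]; exact add_le_add (hC ξ) (hC' ξ)
  zero_mem' := ⟨continuous_const, fun k => ⟨0, fun ξ => by simp⟩⟩
  smul_mem' := by
    rintro c F ⟨hF, hF'⟩
    refine ⟨hF.const_smul c, fun k => ?_⟩
    obtain ⟨C, hC⟩ := hF' k
    refine ⟨‖c‖ * C, fun ξ => ?_⟩
    rw [Pi.smul_apply, norm_smul, mul_left_comm]
    exact mul_le_mul_of_nonneg_left (hC ξ) (norm_nonneg c)

/-- The type of continuous symbols of polynomial growth. -/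
abbrev Symb : Type := symbols

/-- The type of continuous rapidly decreasing functions on the frequency plane. -/
abbrev Spec : Type := spectra

lemma integrable_one_add_norm_inv_pow : Integrable (fun ξ : Plane => ((1 + ‖ξ‖) ^ 3)⁻¹) := by
  have := integrable_one_add_norm (E := Plane) (μ := volume) (r := 3) (by simp; norm_num)
  refine this.congr (Filter.Eventually.of_forall fun ξ => ?_)
  simp only
  rw [Real.rpow_neg (by positivity)]
  norm_cast

namespace Spec

lemma continuous (F : Spec) : Continuous (F : Plane → ℂ) := F.2.1

lemma decay (F : Spec) (k : ℕ) : ∃ C : ℝ, 0 ≤ C ∧ ∀ ξ, ‖F.1 ξ‖ ≤ C * ((1 + ‖ξ‖) ^ k)⁻¹ := by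
  obtain ⟨C, hC⟩ := F.2.2 k
  refine ⟨C, le_trans (by positivity) (hC 0), fun ξ => ?_⟩
  rw [← div_eq_mul_inv, le_div_iff₀ (by positivity), mul_comm]
  exact hC ξ

lemma integrable_of_decay {F : Plane → ℂ} (hF : AEStronglyMeasurable F) {C : ℝ}
    (h : ∀ ξ, ‖F ξ‖ ≤ C * ((1 + ‖ξ‖) ^ 3)⁻¹) : Integrable F :=
  (integrable_one_add_norm_inv_pow.const_mul C).mono' hF (Filter.Eventually.of_forall h)

lemma integrable (F : Spec) : Integrable (F : Plane → ℂ) := by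
  obtain ⟨C, -, hC⟩ := F.decay 3
  exact integrable_of_decay F.continuous.aestronglyMeasurable hC

lemma bounded (F : Spec) : ∃ C : ℝ, 0 ≤ C ∧ ∀ ξ, ‖F.1 ξ‖ ≤ C := by
  obtain ⟨C, h0, hC⟩ := F.decay 0
  exact ⟨C, h0, fun ξ => by simpa using hC ξ⟩

/-- The action of a Fourier multiplier on the frequency side. -/
def mult (b : Symb) (F : Spec) : Spec :=
  ⟨fun ξ => b.1 ξ * F.1 ξ, b.2.1.mul F.2.1, by
    intro k
    obtain ⟨C, n, hC⟩ := b.2.2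
    obtain ⟨C', hC'⟩ := F.2.2 (k + n)
    refine ⟨|C| * C', fun ξ => ?_⟩
    calc (1 + ‖ξ‖) ^ k * ‖b.1 ξ * F.1 ξ‖ = (1 + ‖ξ‖) ^ k * (‖b.1 ξ‖ * ‖F.1 ξ‖) := by
          rw [norm_mul]
      _ ≤ (1 + ‖ξ‖) ^ k * ((|C| * (1 + ‖ξ‖) ^ n) * ‖F.1 ξ‖) := by
          gcongr
          refine (hC ξ).trans ?_
          gcongr
          exact le_abs_self C
      _ = |C| * ((1 + ‖ξ‖) ^ (k + n) * ‖F.1 ξ‖) := by ring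
      _ ≤ _ := by
          gcongr
          exact hC' ξ⟩

@[simp] lemma mult_apply (b : Symb) (F : Spec) (ξ : Plane) :
    (mult b F).1 ξ = b.1 ξ * F.1 ξ := rfl

lemma mult_add (b : Symb) (F G : Spec) : mult b (F + G) = mult b F + mult b G :=
  Subtype.ext (funext fun _ => mul_add _ _ _)

lemma mult_sub (b : Symb) (F G : Spec) : mult b (F - G) = mult b F - mult b G :=
  Subtype.ext (funext fun _ => mul_sub _ _ _)

lemma sub_mult (b c : Symb) (F : Spec) : mult (b - c) F = mult b F - mult c F :=
  Subtype.ext (funext fun _ => sub_mul _ _ _)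

lemma add_mult (b c : Symb) (F : Spec) : mult (b + c) F = mult b F + mult c F :=
  Subtype.ext (funext fun _ => add_mul _ _ _)

lemma mult_mult (b c : Symb) (F : Spec) : mult b (mult c F) = mult (b * c) F :=
  Subtype.ext (funext fun _ => (mul_assoc _ _ _).symm)

lemma one_mult (F : Spec) : mult 1 F = F :=
  Subtype.ext (funext fun _ => one_mul _)

open Convolution ContinuousLinearMap in
/-- Convolution on the frequency side. -/
instance : Mul Spec where
  mul F G := ⟨F.1 ⋆[mul ℂ ℂ] G.1, by
      obtain ⟨C, -, hC⟩ := G.bounded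
      exact BddAbove.continuous_convolution_right_of_integrable _
        ⟨C, by rintro _ ⟨ξ, rfl⟩; exact hC ξ⟩ F.integrable G.continuous, by
      intro k
      obtain ⟨C, hC0, hC⟩ := F.decay (k + 3)
      obtain ⟨C', hC'0, hC'⟩ := G.decay k
      refine ⟨(∫ η : Plane, ((1 + ‖η‖) ^ 3)⁻¹) * (C * C'), fun ξ => ?_⟩
      rw [convolution_mul, ← integral_mul_const]
      calc (1 + ‖ξ‖) ^ k * ‖∫ η, F.1 η * G.1 (ξ - η)‖
          = ‖∫ η, ((1 + ‖ξ‖) ^ k : ℂ) * (F.1 η * G.1 (ξ - η))‖ := by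
            rw [integral_const_mul, norm_mul, norm_pow]
            norm_cast
            rw [Real.norm_of_nonneg (by positivity)]
        _ ≤ _ := by
            refine norm_integral_le_of_norm_le
              (integrable_one_add_norm_inv_pow.mul_const _)
              (Filter.Eventually.of_forall fun η => ?_)
            have h1 : (1 + ‖ξ‖) ≤ (1 + ‖η‖) * (1 + ‖ξ - η‖) := by
              have := norm_add_le η (ξ - η)
              rw [add_sub_cancel] at this
              nlinarith [norm_nonneg η, norm_nonneg (ξ - η)]
            have h2 : ‖((1 + ‖ξ‖) ^ k : ℂ)‖ = (1 + ‖ξ‖) ^ k := by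
              rw [norm_pow]
              norm_cast
              rw [Real.norm_of_nonneg (by positivity)]
            rw [norm_mul, norm_mul, h2]
            calc (1 + ‖ξ‖) ^ k * (‖F.1 η‖ * ‖G.1 (ξ - η)‖)
                ≤ ((1 + ‖η‖) * (1 + ‖ξ - η‖)) ^ k * ((C * ((1 + ‖η‖) ^ (k + 3))⁻¹)
                    * (C' * ((1 + ‖ξ - η‖) ^ k)⁻¹)) := by
                  gcongr
                  · exact hC η
                  · exact hC' _
              _ = _ := by
                  rw [mul_pow, pow_add]
                  have : 1 + ‖η‖ ≠ 0 := by positivity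
                  have : 1 + ‖ξ - η‖ ≠ 0 := by positivity
                  field_simp⟩

lemma mul_apply (F G : Spec) (ξ : Plane) : (F * G).1 ξ = ∫ η, F.1 η * G.1 (ξ - η) :=
  convolution_mul

lemma exists_of_mul_apply_ne_zero {F G : Spec} {ξ : Plane} (h : (F * G).1 ξ ≠ 0) :
    ∃ η, F.1 η ≠ 0 ∧ G.1 (ξ - η) ≠ 0 := by
  by_contra! H
  apply h
  rw [mul_apply]
  refine integral_eq_zero_of_ae (Filter.Eventually.of_forall fun η => ?_)
  by_cases hη : F.1 η = 0
  · simp [hη]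
  · simp [H η hη]

/-- The physical-space function with frequency representation `F`. -/
def phys (F : Spec) : Plane → ℂ := 𝓕⁻ (F : Plane → ℂ)

lemma phys_eq (F : Spec) (x : Plane) : phys F x = ∫ ξ, 𝐞 (inner ℝ ξ x) • F.1 ξ :=
  Real.fourierInv_eq _ _

lemma phys_eq_fourier_neg (F : Spec) (x : Plane) : phys F x = 𝓕 F.1 (-x) :=
  Real.fourierInv_eq_fourier_neg _ _

lemma integrable_char_smul {F : Plane → ℂ} (hF : Integrable F) (x : Plane) :
    Integrable (fun ξ => 𝐞 (inner ℝ ξ x) • F ξ) := by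
  have := (Real.fourierIntegral_convergent_iff (-x)).2 hF
  simpa using this

lemma phys_add (F G : Spec) (x : Plane) : phys (F + G) x = phys F x + phys G x := by
  simp only [phys_eq]
  rw [← integral_add (integrable_char_smul F.integrable x) (integrable_char_smul G.integrable x)]
  refine integral_congr_ae (Filter.Eventually.of_forall fun ξ => ?_)
  exact smul_add _ _ _

lemma phys_sub (F G : Spec) (x : Plane) : phys (F - G) x = phys F x - phys G x := by
  simp only [phys_eq]
  rw [← integral_sub (integrable_char_smul F.integrable x) (integrable_char_smul G.integrable x)]
  refine integral_congr_ae (Filter.Eventually.of_forall fun ξ => ?_)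
  exact smul_sub _ _ _

lemma phys_mul (F G : Spec) (x : Plane) : phys (F * G) x = phys F x * phys G x := by
  simp only [phys_eq_fourier_neg]
  exact Real.fourier_mul_convolution_eq F.integrable G.integrable (-x)

lemma continuous_phys (F : Spec) : Continuous (phys F) := by
  have h : phys F = fun x => 𝓕 F.1 (-x) := funext fun x => phys_eq_fourier_neg F x
  rw [h]
  exact (VectorFourier.fourierIntegral_continuous Real.continuous_fourierChar
    (by exact continuous_inner) F.integrable).comp continuous_neg

lemma fourier_phys (F : Spec) (h : Integrable (phys F)) : 𝓕 (phys F) = F.1 :=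
  F.continuous.fourier_fourierInv_eq F.integrable (by
    have : 𝓕 F.1 = fun x => phys F (-x) := funext fun x => by rw [phys_eq_fourier_neg, neg_neg]
    rw [this]
    exact h.comp_neg)

lemma ext_phys {F G : Spec} (h : ∀ x, phys F x = phys G x) : F = G := by
  have h0 : phys (F - G) = 0 := funext fun x => by rw [phys_sub, h x, sub_self]; rfl
  have h1 := fourier_phys (F - G) (by rw [h0]; exact integrable_zero _ _ _)
  rw [h0] at h1
  have h2 : ∀ ξ, F.1 ξ - G.1 ξ = 0 := fun ξ => by
    have := congrFun h1 ξ
    rw [Real.fourier_eq] at this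
    simpa using this.symm
  exact Subtype.ext (funext fun ξ => sub_eq_zero.1 (h2 ξ))

/-- The frequency representation of the complex conjugate. -/
def conj (F : Spec) : Spec :=
  ⟨fun ξ => starRingEnd ℂ (F.1 (-ξ)), Complex.continuous_conj.comp (F.2.1.comp continuous_neg), by
    intro k
    obtain ⟨C, hC⟩ := F.2.2 k
    exact ⟨C, fun ξ => by simpa using hC (-ξ)⟩⟩

lemma phys_conj (F : Spec) (x : Plane) : phys (conj F) x = starRingEnd ℂ (phys F x) := by
  rw [phys_eq, phys_eq, ← integral_conj, ← integral_neg_eq_self]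
  refine integral_congr_ae (Filter.Eventually.of_forall fun ξ => ?_)
  simp [conj, Circle.smul_def]

end Spec

instance fact_two_le_two : Fact ((2 : ℝ≥0∞) ≤ 2) := ⟨le_rfl⟩
instance fact_two_le_three : Fact ((2 : ℝ≥0∞) ≤ 3) := ⟨by norm_num⟩
instance fact_two_le_six : Fact ((2 : ℝ≥0∞) ≤ 6) := ⟨by norm_num⟩

instance holderTriple_three_six_two : ENNReal.HolderTriple 3 6 2 := ⟨by
  rw [← ENNReal.toReal_eq_toReal_iff' (by finiteness) (by finiteness),
    ENNReal.toReal_add (by finiteness) (by finiteness)]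
  simp
  norm_num⟩

instance holderTriple_six_six_three : ENNReal.HolderTriple 6 6 3 := ⟨by
  rw [← ENNReal.toReal_eq_toReal_iff' (by finiteness) (by finiteness),
    ENNReal.toReal_add (by finiteness) (by finiteness)]
  simp
  norm_num⟩

/-- A bounded square integrable function belongs to every `L^p` with `2 ≤ p`. -/
lemma MeasureTheory.MemLp.of_two_of_bound {α E : Type*} [MeasurableSpace α] {μ : Measure α}
    [NormedAddCommGroup E] {f : α → E} (hf : MemLp f 2 μ) {C : ℝ} (hC : ∀ x, ‖f x‖ ≤ C)
    {p : ℝ≥0∞} (hp : 2 ≤ p) : MemLp f p μ := by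
  rcases eq_or_ne p ∞ with rfl | hp'
  · exact memLp_top_of_bound hf.1 C (Filter.Eventually.of_forall hC)
  have hp0 : p ≠ 0 := (lt_of_lt_of_le (by norm_num) hp).ne'
  have hp2 : (2 : ℝ) ≤ p.toReal := by
    simpa using ENNReal.toReal_mono hp' hp
  refine ⟨hf.1, (eLpNorm_lt_top_iff_lintegral_rpow_enorm_lt_top hp0 hp').2 ?_⟩
  have h2 := (eLpNorm_lt_top_iff_lintegral_rpow_enorm_lt_top (by norm_num) (by norm_num)).1 hf.2
  have hle : ∀ x, ‖f x‖ₑ ^ p.toReal ≤ (ENNReal.ofReal C) ^ (p.toReal - 2) * ‖f x‖ₑ ^ (2 : ℝ) := by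
    intro x
    have h1 : ‖f x‖ₑ ≤ ENNReal.ofReal C := by
      rw [← ofReal_norm]
      exact ENNReal.ofReal_le_ofReal (hC x)
    calc ‖f x‖ₑ ^ p.toReal = ‖f x‖ₑ ^ (p.toReal - 2 + 2) := by ring_nf
      _ = ‖f x‖ₑ ^ (p.toReal - 2) * ‖f x‖ₑ ^ (2 : ℝ) :=
        ENNReal.rpow_add_of_nonneg _ _ (by linarith) (by norm_num)
      _ ≤ _ := by
        gcongr
  calc ∫⁻ x, ‖f x‖ₑ ^ p.toReal ∂μ
      ≤ ∫⁻ x, (ENNReal.ofReal C) ^ (p.toReal - 2) * ‖f x‖ₑ ^ (2 : ℝ) ∂μ := lintegral_mono hle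
    _ = (ENNReal.ofReal C) ^ (p.toReal - 2) * ∫⁻ x, ‖f x‖ₑ ^ (2 : ℝ) ∂μ :=
        lintegral_const_mul' _ _ (ENNReal.rpow_ne_top_of_nonneg (by linarith) (by simp))
    _ < ⊤ := ENNReal.mul_lt_top
        (ENNReal.rpow_lt_top_of_nonneg (by linarith) (by simp)) (by simpa using h2)

namespace Spec

lemma memLp_two (F : Spec) : MemLp F.1 2 := by
  obtain ⟨C, -, hC⟩ := F.bounded
  refine (memLp_two_iff_integrable_sq_norm F.continuous.aestronglyMeasurable).2 ?_
  refine (F.integrable.norm.const_mul C).mono'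
    (F.continuous.norm.pow 2).aestronglyMeasurable (Filter.Eventually.of_forall fun ξ => ?_)
  rw [Real.norm_of_nonneg (by positivity), sq]
  exact mul_le_mul_of_nonneg_right (hC ξ) (norm_nonneg _)

lemma integral_smul_phys (S : SchwartzMap Plane ℂ) (F : Spec) :
    ∫ x, S x • phys F x = ∫ ξ, (𝓕⁻ S : SchwartzMap Plane ℂ) ξ • F.1 ξ := by
  have h := VectorFourier.integral_fourierIntegral_smul_eq_flip (L := innerₗ Plane)
    (f := fun x => S (-x)) (g := F.1) (μ := volume) (ν := volume) Real.continuous_fourierChar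
    continuous_inner S.integrable.comp_neg F.integrable
  have h1 : ∀ ξ, (𝓕⁻ S : SchwartzMap Plane ℂ) ξ
      = VectorFourier.fourierIntegral 𝐞 volume (innerₗ Plane) (fun x => S (-x)) ξ := by
    intro ξ
    rw [SchwartzMap.fourierInv_coe]
    exact congrFun (Real.fourierInv_eq_fourier_comp_neg _) ξ
  simp_rw [h1, h]
  rw [← integral_neg_eq_self]
  refine integral_congr_ae (Filter.Eventually.of_forall fun x => ?_)
  simp only [phys_eq_fourier_neg, neg_neg]
  congr 1
  simp [Real.fourier_eq, VectorFourier.fourierIntegral, real_inner_comm]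

lemma phys_ae_eq (F : Spec) : phys F =ᵐ[volume]
    (𝓕⁻ F.memLp_two.toLp : Lp ℂ 2 (volume : Measure Plane)) := by
  refine ae_eq_of_integral_contDiff_smul_eq F.continuous_phys.locallyIntegrable
    ((Lp.memLp _).locallyIntegrable (by norm_num)) fun g hg hgc => ?_
  have hg' : ContDiff ℝ ∞ (fun x => (g x : ℂ)) := Complex.ofRealCLM.contDiff.comp hg
  have hgc' : HasCompactSupport (fun x => (g x : ℂ)) :=
    hgc.comp_left (g := fun t : ℝ => (t : ℂ)) (by simp)
  have h1 := DFunLike.congr_fun (Lp.fourierInv_toTemperedDistribution_eq F.memLp_two.toLp)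
    (hgc'.toSchwartzMap hg')
  rw [TemperedDistribution.fourierInv_apply, Lp.toTemperedDistribution_apply,
    Lp.toTemperedDistribution_apply] at h1
  have h2 := integral_smul_phys (hgc'.toSchwartzMap hg') F
  have h3 : ∫ ξ, (𝓕⁻ (hgc'.toSchwartzMap hg') : SchwartzMap Plane ℂ) ξ • F.1 ξ
      = ∫ ξ, (𝓕⁻ (hgc'.toSchwartzMap hg') : SchwartzMap Plane ℂ) ξ • (F.memLp_two.toLp) ξ := by
    refine integral_congr_ae ?_
    filter_upwards [F.memLp_two.coeFn_toLp] with ξ hξ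
    rw [hξ]
  rw [h3, h1] at h2
  simpa using h2

/-- Plancherel's theorem. -/
lemma eLpNorm_phys_two (F : Spec) : eLpNorm (phys F) 2 = eLpNorm F.1 2 := by
  rw [eLpNorm_congr_ae F.phys_ae_eq, ← Lp.enorm_def, ← Lp.enorm_toLp (hf := F.memLp_two),
    ← ofReal_norm, ← ofReal_norm, ← Lp.norm_fourier_eq, FourierTransform.fourier_fourierInv_eq]

lemma norm_phys_le (F : Spec) (x : Plane) : ‖phys F x‖ ≤ ∫ ξ, ‖F.1 ξ‖ := by
  rw [phys_eq]
  refine (norm_integral_le_integral_norm _).trans_eq ?_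
  simp

lemma memLp_phys (F : Spec) (p : ℝ≥0∞) [hp : Fact (2 ≤ p)] : MemLp (phys F) p :=
  MemLp.of_two_of_bound ⟨F.continuous_phys.aestronglyMeasurable, by
    rw [eLpNorm_phys_two]; exact F.memLp_two.2⟩ F.norm_phys_le hp.out

/-- The `L^p` norm of the physical-space function with frequency representation `F`. -/
def nrm (p : ℝ≥0∞) (F : Spec) : ℝ := (eLpNorm (phys F) p).toReal

lemma nrm_nonneg (p : ℝ≥0∞) (F : Spec) : 0 ≤ nrm p F := ENNReal.toReal_nonneg

lemma ofReal_nrm (p : ℝ≥0∞) [Fact (2 ≤ p)] (F : Spec) :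
    ENNReal.ofReal (nrm p F) = eLpNorm (phys F) p :=
  ENNReal.ofReal_toReal (F.memLp_phys p).2.ne

lemma nrm_le_iff {p : ℝ≥0∞} [Fact (2 ≤ p)] {F : Spec} {B : ℝ} (hB : 0 ≤ B) :
    nrm p F ≤ B ↔ eLpNorm (phys F) p ≤ ENNReal.ofReal B := by
  rw [← ofReal_nrm, ENNReal.ofReal_le_ofReal_iff hB]

lemma nrm_add_le (p : ℝ≥0∞) [hp : Fact (2 ≤ p)] (F G : Spec) :
    nrm p (F + G) ≤ nrm p F + nrm p G := by
  rw [nrm_le_iff (add_nonneg (nrm_nonneg _ _) (nrm_nonneg _ _)),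
    ENNReal.ofReal_add (nrm_nonneg _ _) (nrm_nonneg _ _), ofReal_nrm, ofReal_nrm]
  have : phys (F + G) = phys F + phys G := funext fun x => phys_add F G x
  rw [this]
  exact eLpNorm_add_le F.continuous_phys.aestronglyMeasurable G.continuous_phys.aestronglyMeasurable
    (le_trans (by norm_num) hp.out)

lemma nrm_sub_le (p : ℝ≥0∞) [hp : Fact (2 ≤ p)] (F G : Spec) :
    nrm p (F - G) ≤ nrm p F + nrm p G := by
  rw [nrm_le_iff (add_nonneg (nrm_nonneg _ _) (nrm_nonneg _ _)),
    ENNReal.ofReal_add (nrm_nonneg _ _) (nrm_nonneg _ _), ofReal_nrm, ofReal_nrm]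
  have : phys (F - G) = phys F - phys G := funext fun x => phys_sub F G x
  rw [this]
  exact eLpNorm_sub_le F.continuous_phys.aestronglyMeasurable G.continuous_phys.aestronglyMeasurable
    (le_trans (by norm_num) hp.out)

lemma nrm_zero (p : ℝ≥0∞) : nrm p 0 = 0 := by
  have : phys 0 = 0 := funext fun x => by simp [phys_eq]
  simp [nrm, this]

lemma nrm_mul_le (p q r : ℝ≥0∞) [Fact (2 ≤ p)] [Fact (2 ≤ q)] [Fact (2 ≤ r)]
    [ENNReal.HolderTriple p q r] (F G : Spec) : nrm r (F * G) ≤ nrm p F * nrm q G := by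
  rw [nrm_le_iff (mul_nonneg (nrm_nonneg _ _) (nrm_nonneg _ _)),
    ENNReal.ofReal_mul (nrm_nonneg _ _), ofReal_nrm, ofReal_nrm]
  have : phys (F * G) = phys F • phys G := funext fun x => phys_mul F G x
  rw [this]
  exact eLpNorm_smul_le_mul_eLpNorm G.continuous_phys.aestronglyMeasurable
    F.continuous_phys.aestronglyMeasurable

lemma nrm_conj (p : ℝ≥0∞) (F : Spec) : nrm p (conj F) = nrm p F := by
  unfold nrm
  congr 1
  refine eLpNorm_congr_norm_ae (Filter.Eventually.of_forall fun x => ?_)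
  rw [phys_conj, RCLike.norm_conj]

lemma nrm_two_mono {F G : Spec} (h : ∀ ξ, ‖F.1 ξ‖ ≤ ‖G.1 ξ‖) : nrm 2 F ≤ nrm 2 G := by
  rw [nrm_le_iff (nrm_nonneg _ _), ofReal_nrm, eLpNorm_phys_two, eLpNorm_phys_two]
  exact eLpNorm_mono h

lemma nrm_two_mult_le {b : Symb} {F : Spec} {B : ℝ} (hB : 0 ≤ B)
    (h : ∀ ξ, F.1 ξ ≠ 0 → ‖b.1 ξ‖ ≤ B) : nrm 2 (mult b F) ≤ B * nrm 2 F := by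
  rw [nrm_le_iff (mul_nonneg hB (nrm_nonneg _ _)), ENNReal.ofReal_mul hB, ofReal_nrm,
    eLpNorm_phys_two, eLpNorm_phys_two]
  refine eLpNorm_le_mul_eLpNorm_of_ae_le_mul (Filter.Eventually.of_forall fun ξ => ?_) 2
  rw [mult_apply, norm_mul]
  by_cases hξ : F.1 ξ = 0
  · simp [hξ]
  · exact mul_le_mul_of_nonneg_right (h ξ hξ) (norm_nonneg _)

end Spec

/-- Minkowski's integral inequality for superpositions of functions of bounded `L^p` norm. -/
lemma eLpNorm_le_lintegral_mul_of_le {α β E E' : Type*} [MeasurableSpace α] [MeasurableSpace β]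
    {μ : Measure α} {ν : Measure β} [SFinite μ] [SFinite ν] [NormedAddCommGroup E]
    [NormedAddCommGroup E'] {p : ℝ≥0∞} (hp : 1 < p) (hp' : p ≠ ⊤) {f : α → E'} {κ : β → ℝ≥0∞}
    {g : β → α → E} (hκ : Measurable κ) (hg : Measurable fun z : α × β => ‖g z.2 z.1‖ₑ)
    {S : ℝ≥0∞} (hf : ∀ x, ‖f x‖ₑ ≤ ∫⁻ y, κ y * ‖g y x‖ₑ ∂ν) (hS : ∀ y, eLpNorm (g y) p μ ≤ S) :
    eLpNorm f p μ ≤ (∫⁻ y, κ y ∂ν) * S := by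
  have hp0 : p ≠ 0 := (zero_lt_one.trans hp).ne'
  set P := p.toReal with hP
  have hP1 : 1 < P := by
    simpa using (ENNReal.toReal_lt_toReal (by simp) hp').2 hp
  have hP0 : 0 < P := by linarith
  set Q := P.conjExponent with hQ
  have hPQ : Q.HolderConjugate P := (Real.HolderConjugate.conjExponent hP1).symm
  have hQ0 : 0 < Q := hPQ.pos
  have hsum : P / Q + 1 = P := by
    have := hPQ.inv_add_inv_eq_one
    field_simp at this ⊢
    linarith
  have hgx : ∀ x, Measurable fun y => ‖g y x‖ₑ := fun x => hg.comp measurable_prodMk_left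
  have key : ∀ x, ‖f x‖ₑ ^ P ≤ (∫⁻ y, κ y ∂ν) ^ (P / Q) * ∫⁻ y, κ y * ‖g y x‖ₑ ^ P ∂ν := by
    intro x
    have h1 : ∫⁻ y, κ y * ‖g y x‖ₑ ∂ν
        ≤ (∫⁻ y, κ y ∂ν) ^ (1 / Q) * (∫⁻ y, κ y * ‖g y x‖ₑ ^ P ∂ν) ^ (1 / P) := by
      have h := ENNReal.lintegral_mul_le_Lp_mul_Lq ν hPQ (f := fun y => κ y ^ (1 / Q))
        (g := fun y => κ y ^ (1 / P) * ‖g y x‖ₑ) (hκ.pow_const _).aemeasurable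
        ((hκ.pow_const _).mul (hgx x)).aemeasurable
      have e1 : ∀ y, κ y ^ (1 / Q) * (κ y ^ (1 / P) * ‖g y x‖ₑ) = κ y * ‖g y x‖ₑ := by
        intro y
        rw [← mul_assoc, ← ENNReal.rpow_add_of_nonneg _ _ (by positivity) (by positivity)]
        have : 1 / Q + 1 / P = 1 := by simpa using hPQ.inv_add_inv_eq_one
        rw [this, ENNReal.rpow_one]
      have e2 : ∀ y, (κ y ^ (1 / Q)) ^ Q = κ y := by
        intro y
        rw [← ENNReal.rpow_mul, one_div_mul_cancel hQ0.ne', ENNReal.rpow_one]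
      have e3 : ∀ y, (κ y ^ (1 / P) * ‖g y x‖ₑ) ^ P = κ y * ‖g y x‖ₑ ^ P := by
        intro y
        rw [ENNReal.mul_rpow_of_nonneg _ _ hP0.le, ← ENNReal.rpow_mul,
          one_div_mul_cancel hP0.ne', ENNReal.rpow_one]
      simpa only [Pi.mul_apply, e1, e2, e3] using h
    calc ‖f x‖ₑ ^ P
        ≤ ((∫⁻ y, κ y ∂ν) ^ (1 / Q) * (∫⁻ y, κ y * ‖g y x‖ₑ ^ P ∂ν) ^ (1 / P)) ^ P :=
          ENNReal.rpow_le_rpow ((hf x).trans h1) hP0.le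
      _ = _ := by
          rw [ENNReal.mul_rpow_of_nonneg _ _ hP0.le, ← ENNReal.rpow_mul, ← ENNReal.rpow_mul,
            one_div_mul_cancel hP0.ne', ENNReal.rpow_one]
          congr 2
          ring
  rcases eq_or_ne (∫⁻ y, κ y ∂ν) 0 with h0 | h0
  · have hz : ∀ x, f x = 0 := by
      intro x
      have := key x
      rw [h0, ENNReal.zero_rpow_of_pos (by positivity), zero_mul, nonpos_iff_eq_zero,
        ENNReal.rpow_eq_zero_iff_of_pos hP0] at this
      simpa using this
    have : f = 0 := funext hz
    simp [this]
  have hm : Measurable fun z : α × β => κ z.2 * ‖g z.2 z.1‖ₑ ^ P :=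
    (hκ.comp measurable_snd).mul (hg.pow_const _)
  have hSP : ∀ y, ∫⁻ x, ‖g y x‖ₑ ^ P ∂μ ≤ S ^ P := by
    intro y
    have := hS y
    rw [eLpNorm_eq_lintegral_rpow_enorm_toReal hp0 hp'] at this
    have h2 := ENNReal.rpow_le_rpow this hP0.le
    rwa [← ENNReal.rpow_mul, one_div_mul_cancel hP0.ne', ENNReal.rpow_one] at h2
  have hgy : ∀ y, Measurable fun x => ‖g y x‖ₑ := fun y => hg.comp measurable_prodMk_right
  rw [eLpNorm_eq_lintegral_rpow_enorm_toReal hp0 hp']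
  calc (∫⁻ x, ‖f x‖ₑ ^ P ∂μ) ^ (1 / P)
      ≤ (∫⁻ x, (∫⁻ y, κ y ∂ν) ^ (P / Q) * ∫⁻ y, κ y * ‖g y x‖ₑ ^ P ∂ν ∂μ) ^ (1 / P) := by
        gcongr with x
        exact key x
    _ = ((∫⁻ y, κ y ∂ν) ^ (P / Q) * ∫⁻ y, κ y * ∫⁻ x, ‖g y x‖ₑ ^ P ∂μ ∂ν) ^ (1 / P) := by
        rw [lintegral_const_mul _ hm.lintegral_prod_right',
          lintegral_lintegral_swap hm.aemeasurable]
        congr 2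
        exact lintegral_congr fun y => lintegral_const_mul (κ y) ((hgy y).pow_const P)
    _ ≤ ((∫⁻ y, κ y ∂ν) ^ (P / Q) * ∫⁻ y, κ y * S ^ P ∂ν) ^ (1 / P) := by
        gcongr with y
        exact hSP y
    _ = ((∫⁻ y, κ y ∂ν) ^ P * S ^ P) ^ (1 / P) := by
        rw [lintegral_mul_const _ hκ, ← mul_assoc]
        congr 2
        conv_rhs => rw [← hsum, ENNReal.rpow_add_of_nonneg _ _ (by positivity) zero_le_one,
          ENNReal.rpow_one]
    _ = (∫⁻ y, κ y ∂ν) * S := by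
        rw [← ENNReal.mul_rpow_of_nonneg _ _ hP0.le, ← ENNReal.rpow_mul,
          mul_one_div_cancel hP0.ne', ENNReal.rpow_one]

namespace Spec

/-- The symbol of the translation `f ↦ f (· - y)`. -/
def shift (y : Plane) : Symb :=
  ⟨fun ξ => (𝐞 (-inner ℝ ξ y) : ℂ), by fun_prop, 1, 0, fun ξ => by simp [Circle.norm_coe]⟩

lemma char_inner_sub (ξ x y : Plane) :
    (𝐞 (inner ℝ ξ (x - y)) : ℂ) = (𝐞 (-inner ℝ ξ y) : ℂ) * (𝐞 (inner ℝ ξ x) : ℂ) := by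
  rw [inner_sub_right, sub_eq_neg_add, AddChar.map_add_eq_mul, Circle.coe_mul]

lemma phys_mult_shift (y : Plane) (F : Spec) (x : Plane) :
    phys (mult (shift y) F) x = phys F (x - y) := by
  rw [phys_eq, phys_eq]
  refine integral_congr_ae (Filter.Eventually.of_forall fun ξ => ?_)
  simp only [shift, mult_apply, Circle.smul_def, smul_eq_mul, char_inner_sub]
  ring

lemma nrm_mult_shift (p : ℝ≥0∞) (y : Plane) (F : Spec) : nrm p (mult (shift y) F) = nrm p F := by
  unfold nrm
  have : phys (mult (shift y) F) = phys F ∘ fun x => x - y :=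
    funext fun x => phys_mult_shift y F x
  rw [this, eLpNorm_comp_measurePreserving F.continuous_phys.aestronglyMeasurable
    (measurePreserving_sub_right volume y)]

/-- The symbol `b` is the Fourier transform of the integrable kernel `k`. -/
structure IsKernel (b : Symb) (k : Plane → ℂ) : Prop where
  integrable : Integrable k
  meas : Measurable k
  fourier_eq : 𝓕 k = b.1

lemma IsKernel.phys_mult {b : Symb} {k : Plane → ℂ} (h : IsKernel b k) (F : Spec) (x : Plane) :
    phys (mult b F) x = ∫ y, k y * phys F (x - y) := by
  have H := VectorFourier.integral_fourierIntegral_smul_eq_flip (L := innerₗ Plane)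
    (f := k) (g := fun ξ => 𝐞 (inner ℝ ξ x) • F.1 ξ) (μ := volume) (ν := volume)
    Real.continuous_fourierChar continuous_inner h.integrable (integrable_char_smul F.integrable x)
  have h1 : ∀ ξ, VectorFourier.fourierIntegral 𝐞 volume (innerₗ Plane) k ξ = b.1 ξ := by
    intro ξ
    rw [← h.fourier_eq]
    rfl
  simp_rw [h1] at H
  rw [phys_eq]
  refine Eq.trans (integral_congr_ae (Filter.Eventually.of_forall fun ξ => ?_))
    (H.trans (integral_congr_ae (Filter.Eventually.of_forall fun y => ?_)))
  · simp only [mult_apply, Circle.smul_def, smul_eq_mul]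
    ring
  · simp only [smul_eq_mul]
    congr 1
    rw [phys_eq]
    refine integral_congr_ae (Filter.Eventually.of_forall fun ξ => ?_)
    simp only [Circle.smul_def, char_inner_sub, smul_eq_mul]
    simp [real_inner_comm]
    ring

/-- `b` acts boundedly on `L⁶` with norm at most `B`. -/
def MultBd (b : Symb) (B : ℝ) : Prop := 0 ≤ B ∧ ∀ F : Spec, nrm 6 (mult b F) ≤ B * nrm 6 F

lemma IsKernel.multBd {b : Symb} {k : Plane → ℂ} (h : IsKernel b k) {B : ℝ}
    (hB : ∫ y, ‖k y‖ ≤ B) : MultBd b B := by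
  have hB0 : 0 ≤ B := le_trans (integral_nonneg fun _ => norm_nonneg _) hB
  refine ⟨hB0, fun F => ?_⟩
  rw [nrm_le_iff (mul_nonneg hB0 (nrm_nonneg _ _)), ENNReal.ofReal_mul hB0, ofReal_nrm]
  have hk : ∫⁻ y, ‖k y‖ₑ ≤ ENNReal.ofReal B := by
    rw [← ofReal_integral_norm_eq_lintegral_enorm h.integrable]
    exact ENNReal.ofReal_le_ofReal hB
  refine (eLpNorm_le_lintegral_mul_of_le (ν := volume) (κ := fun y => ‖k y‖ₑ)
    (g := fun y x => phys F (x - y)) (S := eLpNorm (phys F) 6)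
    (by norm_num) (by norm_num) h.meas.enorm ?_ (fun x => ?_) (fun y => ?_)).trans ?_
  · exact (F.continuous_phys.comp (continuous_fst.sub continuous_snd)).measurable.enorm
  · rw [h.phys_mult]
    refine (enorm_integral_le_lintegral_enorm _).trans_eq ?_
    simp only [enorm_mul]
  · rw [show (fun x => phys F (x - y)) = phys F ∘ fun x => x - y from rfl,
      eLpNorm_comp_measurePreserving F.continuous_phys.aestronglyMeasurable
      (measurePreserving_sub_right volume y)]
  · gcongr

/-- `phys G` is `L`-Lipschitz in `L^p`. -/
def Lip (p : ℝ≥0∞) (G : Spec) (L : ℝ) : Prop :=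
  ∀ y, nrm p (mult (shift y - 1) G) ≤ L * ‖y‖

lemma phys_mult_shift_sub_one (y : Plane) (F : Spec) (x : Plane) :
    phys (mult (shift y - 1) F) x = phys F (x - y) - phys F x := by
  rw [sub_mult, one_mult, phys_sub, phys_mult_shift]

/-- The commutator of a multiplier with a multiplication operator gains a derivative. -/
lemma IsKernel.nrm_commutator_le {b : Symb} {k : Plane → ℂ} (h : IsKernel b k)
    (hi : Integrable fun y => ‖y‖ * ‖k y‖) {M : ℝ} (hM : ∫ y, ‖y‖ * ‖k y‖ ≤ M)
    {G : Spec} {L : ℝ} (hL0 : 0 ≤ L) (hL : Lip 3 G L) (H : Spec) :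
    nrm 2 (mult b (G * H) - G * mult b H) ≤ M * (L * nrm 6 H) := by
  have hM0 : 0 ≤ M := le_trans (integral_nonneg fun _ => by positivity) hM
  have hLH : 0 ≤ L * nrm 6 H := mul_nonneg hL0 (nrm_nonneg _ _)
  rw [nrm_le_iff (mul_nonneg hM0 hLH), ENNReal.ofReal_mul hM0]
  have hk : ∫⁻ y, ‖y‖ₑ * ‖k y‖ₑ ≤ ENNReal.ofReal M := by
    refine le_trans (le_of_eq ?_) (ENNReal.ofReal_le_ofReal hM)
    rw [ofReal_integral_eq_lintegral_ofReal hi (Filter.Eventually.of_forall fun _ => by positivity)]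
    refine lintegral_congr fun y => ?_
    rw [ENNReal.ofReal_mul (norm_nonneg _), ofReal_norm, ofReal_norm]
  have hrep : ∀ x, phys (mult b (G * H) - G * mult b H) x
      = ∫ y, k y * ((phys G (x - y) - phys G x) * phys H (x - y)) := by
    intro x
    have i1 : Integrable fun y => k y * phys (G * H) (x - y) :=
      h.integrable.mul_bdd (c := ∫ ξ, ‖(G * H).1 ξ‖)
        ((G * H).continuous_phys.comp (continuous_const.sub continuous_id)).aestronglyMeasurable
        (Filter.Eventually.of_forall fun y => norm_phys_le _ _)
    have i2 : Integrable fun y => k y * phys H (x - y) :=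
      h.integrable.mul_bdd (c := ∫ ξ, ‖H.1 ξ‖)
        (H.continuous_phys.comp (continuous_const.sub continuous_id)).aestronglyMeasurable
        (Filter.Eventually.of_forall fun y => norm_phys_le _ _)
    rw [phys_sub, phys_mul, h.phys_mult, h.phys_mult, ← integral_const_mul,
      ← integral_sub i1 (i2.const_mul _)]
    refine integral_congr_ae (Filter.Eventually.of_forall fun y => ?_)
    simp only [phys_mul]
    ring
  refine (eLpNorm_le_lintegral_mul_of_le (ν := volume) (κ := fun y => ‖y‖ₑ * ‖k y‖ₑ)
    (g := fun y x => ((‖y‖⁻¹ : ℝ) : ℂ) * ((phys G (x - y) - phys G x) * phys H (x - y)))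
    (S := ENNReal.ofReal (L * nrm 6 H))
    (by norm_num) (by norm_num) (measurable_enorm.mul h.meas.enorm) ?_ (fun x => ?_)
    (fun y => ?_)).trans ?_
  · refine Measurable.enorm (Measurable.mul ?_ (Continuous.measurable ?_))
    · exact Complex.measurable_ofReal.comp (measurable_snd.norm.inv)
    · have c1 : Continuous fun z : Plane × Plane => z.1 - z.2 := continuous_fst.sub continuous_snd
      exact ((G.continuous_phys.comp c1).sub (G.continuous_phys.comp continuous_fst)).mul
        (H.continuous_phys.comp c1)
  · rw [hrep]
    refine (enorm_integral_le_lintegral_enorm _).trans_eq (lintegral_congr fun y => ?_)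
    rcases eq_or_ne y 0 with rfl | hy
    · simp
    · have e : ‖y‖ₑ * ‖((‖y‖⁻¹ : ℝ) : ℂ)‖ₑ = 1 := by
        rw [← ofReal_norm, ← ofReal_norm, ← ENNReal.ofReal_mul (norm_nonneg _)]
        simp [hy]
      rw [enorm_mul, enorm_mul (((‖y‖⁻¹ : ℝ) : ℂ))]
      calc _ = (1 : ℝ≥0∞) * (‖k y‖ₑ * ‖(phys G (x - y) - phys G x) * phys H (x - y)‖ₑ) :=
            (one_mul _).symm
        _ = _ := by rw [← e]; ring
  · have e : (fun x => (phys G (x - y) - phys G x) * phys H (x - y))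
        = phys (mult (shift y - 1) G * mult (shift y) H) := by
      funext x
      rw [phys_mul, phys_mult_shift_sub_one, phys_mult_shift]
    have h1 : nrm 2 (mult (shift y - 1) G * mult (shift y) H) ≤ (L * ‖y‖) * nrm 6 H := by
      refine (nrm_mul_le 3 6 2 _ _).trans ?_
      rw [nrm_mult_shift]
      exact mul_le_mul_of_nonneg_right (hL y) (nrm_nonneg _ _)
    have h2 : (fun x => ((‖y‖⁻¹ : ℝ) : ℂ) * ((phys G (x - y) - phys G x) * phys H (x - y)))
        = ((‖y‖⁻¹ : ℝ) : ℂ) • phys (mult (shift y - 1) G * mult (shift y) H) := by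
      rw [← e]; rfl
    rw [h2, eLpNorm_const_smul, ← ofReal_nrm, ← ofReal_norm, ← ENNReal.ofReal_mul (norm_nonneg _)]
    refine ENNReal.ofReal_le_ofReal ?_
    rcases eq_or_ne y 0 with rfl | hy
    · simpa using hLH
    · have hy' : 0 < ‖y‖ := norm_pos_iff.2 hy
      rw [Complex.norm_real, Real.norm_of_nonneg (by positivity)]
      calc ‖y‖⁻¹ * _ ≤ ‖y‖⁻¹ * ((L * ‖y‖) * nrm 6 H) := by gcongr
        _ = L * nrm 6 H := by field_simp
  · gcongr

end Spec

namespace Spec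

section MultiplierAlgebra

lemma MultBd.mono {b : Symb} {B B' : ℝ} (h : MultBd b B) (hB : B ≤ B') : MultBd b B' :=
  ⟨h.1.trans hB, fun F => (h.2 F).trans (mul_le_mul_of_nonneg_right hB (nrm_nonneg _ _))⟩

lemma MultBd.one : MultBd 1 1 := ⟨zero_le_one, fun F => by rw [one_mult, one_mul]⟩

lemma MultBd.zero : MultBd 0 0 := ⟨le_rfl, fun F => by
  have : mult 0 F = 0 := Subtype.ext (funext fun ξ => zero_mul _)
  rw [this, nrm_zero, zero_mul]⟩

lemma MultBd.mul {b c : Symb} {B C : ℝ} (hb : MultBd b B) (hc : MultBd c C) :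
    MultBd (b * c) (B * C) := by
  refine ⟨mul_nonneg hb.1 hc.1, fun F => ?_⟩
  rw [← mult_mult, mul_assoc]
  exact (hb.2 _).trans (mul_le_mul_of_nonneg_left (hc.2 F) hb.1)

lemma MultBd.add {b c : Symb} {B C : ℝ} (hb : MultBd b B) (hc : MultBd c C) :
    MultBd (b + c) (B + C) := by
  refine ⟨add_nonneg hb.1 hc.1, fun F => ?_⟩
  rw [add_mult, add_mul]
  exact (nrm_add_le _ _ _).trans (add_le_add (hb.2 F) (hc.2 F))

lemma MultBd.sub {b c : Symb} {B C : ℝ} (hb : MultBd b B) (hc : MultBd c C) :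
    MultBd (b - c) (B + C) := by
  refine ⟨add_nonneg hb.1 hc.1, fun F => ?_⟩
  rw [sub_mult, add_mul]
  exact (nrm_sub_le _ _ _).trans (add_le_add (hb.2 F) (hc.2 F))

lemma MultBd.sum {b : ℕ → Symb} {B : ℕ → ℝ} (n : ℕ) (h : ∀ i, i < n → MultBd (b i) (B i)) :
    MultBd (∑ i ∈ Finset.range n, b i) (∑ i ∈ Finset.range n, B i) := by
  induction n with
  | zero => simpa using MultBd.zero
  | succ n ih =>
    rw [Finset.sum_range_succ, Finset.sum_range_succ]
    exact (ih fun i hi => h i (hi.trans n.lt_succ_self)).add (h n n.lt_succ_self)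

lemma MultBd.shift (y : Plane) : MultBd (shift y) 1 :=
  ⟨zero_le_one, fun F => by rw [nrm_mult_shift, one_mul]⟩

lemma tendsto_phys_mult {b : ℕ → Symb} {c : Symb} (C : ℝ) (hC : ∀ n ξ, ‖(b n).1 ξ‖ ≤ C)
    (h : ∀ ξ, Filter.Tendsto (fun n => (b n).1 ξ) Filter.atTop (nhds (c.1 ξ))) (F : Spec)
    (x : Plane) :
    Filter.Tendsto (fun n => phys (mult (b n) F) x) Filter.atTop (nhds (phys (mult c F) x)) := by
  simp only [phys_eq]
  refine tendsto_integral_of_dominated_convergence (fun ξ => C * ‖F.1 ξ‖) (fun n => ?_)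
    (F.integrable.norm.const_mul C) (fun n => Filter.Eventually.of_forall fun ξ => ?_)
    (Filter.Eventually.of_forall fun ξ => ?_)
  · exact (integrable_char_smul (mult (b n) F).integrable x).aestronglyMeasurable
  · rw [Circle.norm_smul, mult_apply, norm_mul]
    exact mul_le_mul_of_nonneg_right (hC n ξ) (norm_nonneg _)
  · simp only [mult_apply, Circle.smul_def]
    exact ((h ξ).mul_const _).const_smul _

/-- Bounds for multipliers pass to pointwise limits of the symbols. -/
lemma MultBd.of_tendsto {b : ℕ → Symb} {c : Symb} {B : ℝ} (hB : ∀ n, MultBd (b n) B) (C : ℝ)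
    (hC : ∀ n ξ, ‖(b n).1 ξ‖ ≤ C)
    (h : ∀ ξ, Filter.Tendsto (fun n => (b n).1 ξ) Filter.atTop (nhds (c.1 ξ))) : MultBd c B := by
  have hB0 := (hB 0).1
  refine ⟨hB0, fun F => ?_⟩
  rw [nrm_le_iff (mul_nonneg hB0 (nrm_nonneg _ _))]
  refine (Lp.eLpNorm_lim_le_liminf_eLpNorm
    (fun n => (mult (b n) F).continuous_phys.aestronglyMeasurable) _
    (Filter.Eventually.of_forall fun x => tendsto_phys_mult C hC h F x)).trans ?_
  refine Filter.liminf_le_of_frequently_le' (Filter.Frequently.of_forall fun n => ?_)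
  rw [← nrm_le_iff (mul_nonneg hB0 (nrm_nonneg _ _))]
  exact (hB n).2 F

/-- `b` maps `L⁶` to `L⁶`-Lipschitz functions, with constant at most `L`. -/
def MultLip (b : Symb) (L : ℝ) : Prop := 0 ≤ L ∧ ∀ y, MultBd ((Spec.shift y - 1) * b) (L * ‖y‖)

lemma MultLip.lip {b : Symb} {L : ℝ} (h : MultLip b L) (F : Spec) :
    Lip 6 (mult b F) (L * nrm 6 F) := fun y => by
  rw [mult_mult]
  exact ((h.2 y).2 F).trans_eq (by ring)

lemma MultLip.mono {b : Symb} {L L' : ℝ} (h : MultLip b L) (hL : L ≤ L') : MultLip b L' :=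
  ⟨h.1.trans hL, fun y => (h.2 y).mono (mul_le_mul_of_nonneg_right hL (norm_nonneg _))⟩

lemma MultLip.mul {b c : Symb} {L C : ℝ} (h : MultLip b L) (hc : MultBd c C) :
    MultLip (b * c) (L * C) :=
  ⟨mul_nonneg h.1 hc.1, fun y => by
    rw [← mul_assoc, mul_right_comm L C]
    exact (h.2 y).mul hc⟩

lemma MultLip.sub {b c : Symb} {L C : ℝ} (h : MultLip b L) (hc : MultLip c C) :
    MultLip (b - c) (L + C) :=
  ⟨add_nonneg h.1 hc.1, fun y => by
    rw [mul_sub, add_mul]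
    exact (h.2 y).sub (hc.2 y)⟩

lemma MultLip.sum {b : ℕ → Symb} {B : ℕ → ℝ} (n : ℕ) (h : ∀ i, i < n → MultLip (b i) (B i)) :
    MultLip (∑ i ∈ Finset.range n, b i) (∑ i ∈ Finset.range n, B i) := by
  refine ⟨Finset.sum_nonneg fun i hi => (h i (Finset.mem_range.1 hi)).1, fun y => ?_⟩
  rw [Finset.mul_sum, Finset.sum_mul]
  exact MultBd.sum n fun i hi => (h i hi).2 y

lemma MultLip.of_tendsto {b : ℕ → Symb} {c : Symb} {L : ℝ} (hL : ∀ n, MultLip (b n) L) (C : ℝ)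
    (hC : ∀ n ξ, ‖(b n).1 ξ‖ ≤ C)
    (h : ∀ ξ, Filter.Tendsto (fun n => (b n).1 ξ) Filter.atTop (nhds (c.1 ξ))) : MultLip c L := by
  refine ⟨(hL 0).1, fun y => MultBd.of_tendsto (fun n => (hL n).2 y) (2 * C) (fun n ξ => ?_)
    (fun ξ => (h ξ).const_mul _)⟩
  have h2 : ‖(Spec.shift y - 1).1 ξ‖ ≤ 2 := by
    refine (norm_sub_le _ _).trans_eq ?_
    simp [Spec.shift, Circle.norm_coe]
    norm_num
  refine (norm_mul_le _ _).trans ?_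
  exact mul_le_mul h2 (hC n ξ) (norm_nonneg _) (by norm_num)

lemma Lip.mono {p : ℝ≥0∞} {G : Spec} {L L' : ℝ} (h : Lip p G L) (hL : L ≤ L') : Lip p G L' :=
  fun y => (h y).trans (mul_le_mul_of_nonneg_right hL (norm_nonneg _))

lemma Lip.mul {F G : Spec} {L M A B : ℝ} (hF : Lip 6 F L) (hG : Lip 6 G M)
    (hL : 0 ≤ L) (hFA : nrm 6 F ≤ A) (hGB : nrm 6 G ≤ B) :
    Lip 3 (F * G) (L * B + A * M) := fun y => by
  have e : mult (Spec.shift y - 1) (F * G) = mult (Spec.shift y - 1) F * mult (Spec.shift y) G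
      + F * mult (Spec.shift y - 1) G := by
    refine ext_phys fun x => ?_
    simp only [phys_add, phys_mul, phys_mult_shift_sub_one, phys_mult_shift]
    ring
  rw [e]
  refine (nrm_add_le _ _ _).trans ?_
  have h1 := nrm_mul_le 6 6 3 (mult (Spec.shift y - 1) F) (mult (Spec.shift y) G)
  have h2 := nrm_mul_le 6 6 3 F (mult (Spec.shift y - 1) G)
  rw [nrm_mult_shift] at h1
  have h3 : nrm 6 (mult (Spec.shift y - 1) F) * nrm 6 G ≤ (L * ‖y‖) * B :=
    mul_le_mul (hF y) hGB (nrm_nonneg _ _) (mul_nonneg hL (norm_nonneg _))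
  have h4 : nrm 6 F * nrm 6 (mult (Spec.shift y - 1) G) ≤ A * (M * ‖y‖) :=
    mul_le_mul hFA (hG y) (nrm_nonneg _ _) ((nrm_nonneg _ _).trans hFA)
  linarith

end MultiplierAlgebra

section Kernels

/-- The symbol `b` has a kernel with mass at most `A` and first moment at most `M`. -/
def KerBd (b : Symb) (A M : ℝ) : Prop :=
  ∃ k, IsKernel b k ∧ Integrable (fun y => ‖y‖ * ‖k y‖) ∧ ∫ y, ‖k y‖ ≤ A ∧ ∫ y, ‖y‖ * ‖k y‖ ≤ M

lemma fourier_scaled (k : Plane → ℂ) {l : ℝ} (hl : 0 < l) (ξ : Plane) :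
    𝓕 (fun y => ((l ^ 2 : ℝ) : ℂ) * k (l • y)) ξ = 𝓕 k (l⁻¹ • ξ) := by
  rw [Real.fourier_eq, Real.fourier_eq]
  have := Measure.integral_comp_smul (volume : Measure Plane)
    (fun v => 𝐞 (-inner ℝ v (l⁻¹ • ξ)) • k v) l
  have hfr : Module.finrank ℝ Plane = 2 := by simp
  rw [hfr, abs_of_pos (by positivity)] at this
  have h2 : ∫ v, 𝐞 (-inner ℝ v (l⁻¹ • ξ)) • k v
      = ((l ^ 2 : ℝ) : ℂ) * ∫ v, 𝐞 (-inner ℝ (l • v) (l⁻¹ • ξ)) • k (l • v) := by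
    rw [this, Complex.real_smul, ← mul_assoc, ← Complex.ofReal_mul, mul_inv_cancel₀ (by positivity)]
    simp
  rw [h2, ← integral_const_mul]
  refine integral_congr_ae (Filter.Eventually.of_forall fun v => ?_)
  have : inner ℝ (l • v) (l⁻¹ • ξ) = inner ℝ v ξ := by
    rw [real_inner_smul_left, real_inner_smul_right]
    field_simp
  simp only [this, Circle.smul_def, smul_eq_mul]
  ring

lemma integral_scaled (f : Plane → ℝ) {l : ℝ} (hl : 0 < l) :
    ∫ y, l ^ 2 * f (l • y) = ∫ y, f y := by
  rw [integral_const_mul, Measure.integral_comp_smul]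
  have hfr : Module.finrank ℝ Plane = 2 := by simp
  rw [hfr, abs_of_pos (by positivity), smul_eq_mul, ← mul_assoc, mul_inv_cancel₀ (by positivity),
    one_mul]

lemma kerBd_of_scaled {b : Symb} {k : Plane → ℂ} (hk : Continuous k) {C : ℝ}
    (hC : ∀ y, ‖k y‖ ≤ C * ((1 + ‖y‖) ^ 4)⁻¹) {l : ℝ} (hl : 0 < l)
    (hb : ∀ ξ, b.1 ξ = 𝓕 k (l⁻¹ • ξ)) :
    KerBd b (C * ∫ y : Plane, ((1 + ‖y‖) ^ 3)⁻¹) (C * (∫ y : Plane, ((1 + ‖y‖) ^ 3)⁻¹) / l) := by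
  have hC0 : 0 ≤ C := by
    have := (norm_nonneg _).trans (hC 0)
    simpa using this
  have b1 : ∀ y, ‖k y‖ ≤ C * ((1 + ‖y‖) ^ 3)⁻¹ := fun y => by
    refine (hC y).trans ?_
    gcongr
    · linarith [norm_nonneg y]
    · norm_num
  have b2 : ∀ y, ‖y‖ * ‖k y‖ ≤ C * ((1 + ‖y‖) ^ 3)⁻¹ := fun y => by
    calc ‖y‖ * ‖k y‖ ≤ (1 + ‖y‖) * (C * ((1 + ‖y‖) ^ 4)⁻¹) := by
          gcongr
          · linarith
          · exact hC y
      _ = _ := by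
          have : 1 + ‖y‖ ≠ 0 := by positivity
          field_simp
  have i1 : Integrable k := integrable_of_decay hk.aestronglyMeasurable b1
  have i2 : Integrable fun y => ‖y‖ * ‖k y‖ :=
    (integrable_one_add_norm_inv_pow.const_mul C).mono'
      (continuous_norm.mul hk.norm).aestronglyMeasurable
      (Filter.Eventually.of_forall fun y => by
        rw [Real.norm_of_nonneg (by positivity)]; exact b2 y)
  have n1 : ∀ y, ‖((l ^ 2 : ℝ) : ℂ) * k (l • y)‖ = l ^ 2 * ‖k (l • y)‖ := fun y => by
    rw [norm_mul, Complex.norm_real, Real.norm_of_nonneg (by positivity)]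
  have n2 : ∀ y, ‖y‖ * ‖((l ^ 2 : ℝ) : ℂ) * k (l • y)‖
      = l ^ 2 * ((‖l • y‖ * ‖k (l • y)‖) / l) := fun y => by
    rw [n1, norm_smul, Real.norm_of_nonneg hl.le]
    field_simp
  refine ⟨fun y => ((l ^ 2 : ℝ) : ℂ) * k (l • y), ⟨(i1.comp_smul hl.ne').const_mul _,
    (continuous_const.mul (hk.comp (continuous_const_smul l))).measurable,
    funext fun ξ => (fourier_scaled k hl ξ).trans (hb ξ).symm⟩, ?_, ?_, ?_⟩
  · simp_rw [n2]
    exact ((i2.comp_smul hl.ne').div_const l).const_mul _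
  · simp_rw [n1]
    rw [integral_scaled (fun y => ‖k y‖) hl, ← integral_const_mul]
    exact integral_mono i1.norm (integrable_one_add_norm_inv_pow.const_mul C) b1
  · simp_rw [n2]
    rw [integral_scaled (fun y => ‖y‖ * ‖k y‖ / l) hl, integral_div, ← integral_const_mul]
    exact div_le_div_of_nonneg_right
      (integral_mono i2 (integrable_one_add_norm_inv_pow.const_mul C) b2) hl.le

lemma norm_fourierInv_le_of_support {b : Plane → ℂ} {B R : ℝ} (hb : ContDiff ℝ 4 b)
    (hs : ∀ η, R < ‖η‖ → b η = 0) (hB : ∀ j ≤ 4, ∀ η, ‖iteratedFDeriv ℝ j b η‖ ≤ B) (y : Plane) :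
    ‖𝓕⁻ b y‖ ≤ 1296 * volume.real (Metric.closedBall (0 : Plane) R) * B * ((1 + ‖y‖) ^ 4)⁻¹ := by
  set V := volume.real (Metric.closedBall (0 : Plane) R) with hV
  have hB0 : 0 ≤ B := (norm_nonneg _).trans (hB 0 (by norm_num) 0)
  have hV0 : 0 ≤ V := measureReal_nonneg
  have hsupp : ∀ j, tsupport (iteratedFDeriv ℝ j b) ⊆ Metric.closedBall (0 : Plane) R := fun j => by
    refine (tsupport_iteratedFDeriv_subset j).trans (closure_minimal ?_ Metric.isClosed_closedBall)
    intro η hη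
    by_contra hcon
    exact hη (hs η (by simpa using hcon))
  have hcs : ∀ j, HasCompactSupport (iteratedFDeriv ℝ j b) := fun j =>
    HasCompactSupport.of_support_subset_isCompact (isCompact_closedBall 0 R)
      (subset_closure.trans (hsupp j))
  have hcont : ∀ j : ℕ, j ≤ 4 → Continuous (iteratedFDeriv ℝ j b) := fun j hj =>
    hb.continuous_iteratedFDeriv (by exact_mod_cast hj)
  have hbi : ∀ j : ℕ, j ≤ 4 → ∫ v, ‖iteratedFDeriv ℝ j b v‖ ≤ B * V := fun j hj => by
    have h1 : ∫ v, ‖iteratedFDeriv ℝ j b v‖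
        = ∫ v in Metric.closedBall (0 : Plane) R, ‖iteratedFDeriv ℝ j b v‖ := by
      refine (setIntegral_eq_integral_of_forall_compl_eq_zero fun v hv => ?_).symm
      rw [image_eq_zero_of_notMem_tsupport fun h => hv (hsupp j h), norm_zero]
    have h2 := norm_setIntegral_le_of_norm_le_const (μ := volume)
      (s := Metric.closedBall (0 : Plane) R) (f := fun v => ‖iteratedFDeriv ℝ j b v‖) (C := B)
      measure_closedBall_lt_top (fun v _ => by rw [norm_norm]; exact hB j hj v)
    rw [h1]
    exact (Real.le_norm_self _).trans h2
  have hI : ∀ (k n : ℕ), (k : ℕ∞) ≤ 0 → (n : ℕ∞) ≤ 4 →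
      Integrable (fun v => ‖v‖ ^ k * ‖iteratedFDeriv ℝ n b v‖) := fun k n _ hn => by
    have hn' : n ≤ 4 := by exact_mod_cast hn
    refine Continuous.integrable_of_hasCompactSupport
      ((continuous_norm.pow k).mul (hcont n hn').norm) ?_
    exact (hcs n).norm.mul_left
  have key : ∀ n : ℕ, n ≤ 4 → ∀ w, ‖w‖ ^ n * ‖𝓕 b w‖ ≤ 80 * (B * V) := fun n hn w => by
    have h := Real.pow_mul_norm_iteratedFDeriv_fourier_le (K := 0) (N := 4)
      (by exact_mod_cast hb) hI
      (k := 0) (n := n) le_rfl (by exact_mod_cast hn) w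
    simp only [norm_iteratedFDeriv_zero, pow_zero, one_mul] at h
    refine h.trans ?_
    have h3 : ∑ p ∈ Finset.range (0 + 1) ×ˢ Finset.range (n + 1),
        ∫ (v : Plane), ‖v‖ ^ p.1 * ‖iteratedFDeriv ℝ p.2 b v‖ ≤ 5 * (B * V) := by
      rw [Finset.sum_product]
      simp only [zero_add, Finset.range_one, Finset.sum_singleton, pow_zero, one_mul]
      refine (Finset.sum_le_card_nsmul _ _ (B * V) fun j hj => hbi j ?_).trans ?_
      · have := Finset.mem_range.1 hj
        omega
      · rw [Finset.card_range, nsmul_eq_mul]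
        gcongr
        exact_mod_cast (by omega : n + 1 ≤ 5)
    have h4 : (2 * ((0 : ℕ) : ℝ) + 2) ^ n ≤ 16 := by
      have : (2 * ((0 : ℕ) : ℝ) + 2) = 2 := by norm_num
      rw [this]
      calc (2 : ℝ) ^ n ≤ 2 ^ 4 := pow_le_pow_right₀ (by norm_num) hn
        _ = 16 := by norm_num
    calc _ ≤ 16 * (5 * (B * V)) := by
          gcongr
      _ = _ := by ring
  have e : 𝓕⁻ b y = 𝓕 b (-y) := Real.fourierInv_eq_fourier_neg _ _
  have k0 := key 0 (by norm_num) (-y)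
  have k4 := key 4 le_rfl (-y)
  rw [← e, norm_neg] at k4
  rw [← e, pow_zero, one_mul] at k0
  rw [← div_eq_mul_inv, le_div_iff₀ (by positivity)]
  have hp : (1 + ‖y‖) ^ 4 ≤ 8 * (1 + ‖y‖ ^ 4) := by
    nlinarith [sq_nonneg (1 - ‖y‖), sq_nonneg (1 - ‖y‖ ^ 2), sq_nonneg (1 + ‖y‖),
      mul_nonneg (sq_nonneg (1 - ‖y‖)) (sq_nonneg (1 + ‖y‖)), norm_nonneg y,
      mul_nonneg (norm_nonneg y) (sq_nonneg (1 - ‖y‖))]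
  calc ‖𝓕⁻ b y‖ * (1 + ‖y‖) ^ 4 ≤ ‖𝓕⁻ b y‖ * (8 * (1 + ‖y‖ ^ 4)) := by gcongr
    _ = 8 * (‖𝓕⁻ b y‖ + ‖y‖ ^ 4 * ‖𝓕⁻ b y‖) := by ring
    _ ≤ 8 * (80 * (B * V) + 80 * (B * V)) := by gcongr
    _ ≤ 1296 * V * B := by nlinarith [mul_nonneg hB0 hV0]

/-- A smooth symbol supported in a ball of radius comparable to `l` and varying at scale `l` has a
kernel of bounded mass, concentrated at scale `1 / l`. -/
lemma exists_kerBd_of_contDiff (R : ℝ) : ∃ C : ℝ, 0 ≤ C ∧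
    ∀ (b0 : Plane → ℂ) (B : ℝ), ContDiff ℝ 4 b0 →
    (∀ η, R < ‖η‖ → b0 η = 0) → (∀ j ≤ 4, ∀ η, ‖iteratedFDeriv ℝ j b0 η‖ ≤ B) →
    ∀ (b : Symb) (l : ℝ), 0 < l → (∀ ξ, b.1 ξ = b0 (l⁻¹ • ξ)) → KerBd b (C * B) (C * B / l) := by
  refine ⟨1296 * volume.real (Metric.closedBall (0 : Plane) R)
    * ∫ y : Plane, ((1 + ‖y‖) ^ 3)⁻¹, ?_, ?_⟩
  · exact mul_nonneg (mul_nonneg (by norm_num) measureReal_nonneg)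
      (integral_nonneg fun _ => by positivity)
  intro b0 B hb hs hB b l hl hbl
  have hdec := norm_fourierInv_le_of_support hb hs hB
  have hbi : Integrable b0 := by
    refine hb.continuous.integrable_of_hasCompactSupport
      (HasCompactSupport.of_support_subset_isCompact (isCompact_closedBall 0 R) fun η hη => ?_)
    by_contra hcon
    exact hη (hs η (by simpa using hcon))
  have hcont : Continuous (𝓕⁻ b0) := by
    have h : 𝓕⁻ b0 = fun x => 𝓕 b0 (-x) := funext fun x => Real.fourierInv_eq_fourier_neg _ _
    rw [h]
    exact (VectorFourier.fourierIntegral_continuous Real.continuous_fourierChar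
      (by exact continuous_inner) hbi).comp continuous_neg
  have hB0 : 0 ≤ B := (norm_nonneg _).trans (hB 0 (by norm_num) 0)
  have hfi : Integrable (𝓕⁻ b0) := by
    refine integrable_of_decay
      (C := 1296 * volume.real (Metric.closedBall (0 : Plane) R) * B) hcont.aestronglyMeasurable
      fun y => (hdec y).trans ?_
    have h1 : 1 ≤ 1 + ‖y‖ := by linarith [norm_nonneg y]
    exact mul_le_mul_of_nonneg_left
      (inv_anti₀ (by positivity) (pow_le_pow_right₀ h1 (by norm_num)))
      (mul_nonneg (mul_nonneg (by norm_num) measureReal_nonneg) hB0)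
  have hinv : 𝓕 (𝓕⁻ b0) = b0 := hb.continuous.fourier_fourierInv_eq hbi (by
    have : 𝓕 b0 = fun x => 𝓕⁻ b0 (-x) :=
      funext fun x => by rw [Real.fourierInv_eq_fourier_neg, neg_neg]
    rw [this]
    exact hfi.comp_neg)
  have := kerBd_of_scaled (b := b) hcont hdec hl (fun ξ => by rw [hinv, hbl])
  convert this using 1 <;> ring

lemma KerBd.multBd {b : Symb} {A M : ℝ} (h : KerBd b A M) : MultBd b A := by
  obtain ⟨k, hk, -, hA, -⟩ := h
  exact hk.multBd hA

lemma KerBd.nrm_commutator_le {b : Symb} {A M : ℝ} (h : KerBd b A M)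
    {G : Spec} {L : ℝ} (hL0 : 0 ≤ L) (hL : Lip 3 G L) (H : Spec) :
    nrm 2 (mult b (G * H) - G * mult b H) ≤ M * (L * nrm 6 H) := by
  obtain ⟨k, hk, hi, -, hM⟩ := h
  exact hk.nrm_commutator_le hi hM hL0 hL H

end Kernels

end Spec

namespace Spec

section Annuli

/-- `g` is smooth on `(0, ∞)`, with derivatives up to order four bounded by `B` on `[1/16, 16]`. -/
def AnnBd (g : ℝ → ℝ) (B : ℝ) : Prop :=
  ContDiffOn ℝ ∞ g (Set.Ioi 0) ∧
    ∀ k ≤ 4, ∀ ρ ∈ Set.Icc (1 / 16 : ℝ) 16, ‖iteratedFDerivWithin ℝ k g (Set.Ioi 0) ρ‖ ≤ B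

lemma exists_bound_iteratedFDerivWithin {E : Type*} [NormedAddCommGroup E] [NormedSpace ℝ E]
    {f : E → ℝ} {s K : Set E} (hs : IsOpen s) (hf : ContDiffOn ℝ ∞ f s) (hK : IsCompact K)
    (hKs : K ⊆ s) : ∃ B, 1 ≤ B ∧ ∀ k ≤ 4, ∀ x ∈ K, ‖iteratedFDerivWithin ℝ k f s x‖ ≤ B := by
  have h : ∀ k : ℕ, ∃ B, ∀ x ∈ K, ‖iteratedFDerivWithin ℝ k f s x‖ ≤ B := fun k =>
    hK.exists_bound_of_continuousOn
      ((hf.continuousOn_iteratedFDerivWithin (by exact_mod_cast le_top) hs.uniqueDiffOn).mono hKs)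
  choose B hB using h
  refine ⟨1 + ∑ k ∈ Finset.range 5, |B k|, ?_, fun k hk x hx => ?_⟩
  · have : 0 ≤ ∑ k ∈ Finset.range 5, |B k| := Finset.sum_nonneg fun _ _ => abs_nonneg _
    linarith
  · have := Finset.single_le_sum (f := fun k => |B k|) (fun _ _ => abs_nonneg _)
      (Finset.mem_range.2 (by omega : k < 5))
    linarith [hB k x hx, le_abs_self (B k)]

lemma exists_annBd {g : ℝ → ℝ} (hg : ContDiffOn ℝ ∞ g (Set.Ioi 0)) : ∃ B, 1 ≤ B ∧ AnnBd g B := by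
  obtain ⟨B, h1, hB⟩ := exists_bound_iteratedFDerivWithin isOpen_Ioi hg
    (isCompact_Icc (a := (1 / 16 : ℝ)) (b := 16))
    fun x hx => lt_of_lt_of_le (by norm_num) hx.1
  exact ⟨B, h1, hg, hB⟩

lemma AnnBd.nonneg {g : ℝ → ℝ} {B : ℝ} (h : AnnBd g B) : 0 ≤ B :=
  (norm_nonneg _).trans (h.2 0 (by norm_num) 1 (by norm_num))

lemma AnnBd.mono {g : ℝ → ℝ} {B B' : ℝ} (h : AnnBd g B) (hB : B ≤ B') : AnnBd g B' :=
  ⟨h.1, fun k hk ρ hρ => (h.2 k hk ρ hρ).trans hB⟩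

lemma AnnBd.mul {f g : ℝ → ℝ} {A B : ℝ} (hf : AnnBd f A) (hg : AnnBd g B) :
    AnnBd (fun ρ => f ρ * g ρ) (16 * A * B) := by
  refine ⟨hf.1.mul hg.1, fun k hk ρ hρ => ?_⟩
  have hρ0 : ρ ∈ Set.Ioi (0 : ℝ) := lt_of_lt_of_le (by norm_num) hρ.1
  refine (norm_iteratedFDerivWithin_mul_le hf.1 hg.1 isOpen_Ioi.uniqueDiffOn hρ0
    (by exact_mod_cast le_top)).trans ?_
  have h1 : ∀ i ∈ Finset.range (k + 1), (k.choose i : ℝ)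
      * ‖iteratedFDerivWithin ℝ i f (Set.Ioi 0) ρ‖
      * ‖iteratedFDerivWithin ℝ (k - i) g (Set.Ioi 0) ρ‖ ≤ k.choose i * (A * B) := fun i hi => by
    rw [mul_assoc]
    have hi' : i ≤ k := Nat.lt_succ_iff.1 (Finset.mem_range.1 hi)
    exact mul_le_mul_of_nonneg_left (mul_le_mul (hf.2 i (hi'.trans hk) ρ hρ)
      (hg.2 (k - i) ((k.sub_le i).trans hk) ρ hρ) (norm_nonneg _) hf.nonneg) (Nat.cast_nonneg _)
  refine (Finset.sum_le_sum h1).trans ?_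
  rw [← Finset.sum_mul, ← Nat.cast_sum, Nat.sum_range_choose, mul_assoc]
  refine mul_le_mul_of_nonneg_right ?_ (mul_nonneg hf.nonneg hg.nonneg)
  have : 2 ^ k ≤ 2 ^ 4 := Nat.pow_le_pow_right (by norm_num) hk
  exact_mod_cast this

lemma AnnBd.inv {g : ℝ → ℝ} {B : ℝ} (hg : AnnBd g B) (hB : 1 ≤ B) (hpos : ∀ ρ > 0, 0 < g ρ)
    (h1 : ∀ ρ ∈ Set.Icc (1 / 16 : ℝ) 16, 1 ≤ g ρ) : AnnBd (fun ρ => (g ρ)⁻¹) (576 * B ^ 4) := by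
  have hinv : ContDiffOn ℝ ∞ (Inv.inv : ℝ → ℝ) (Set.Ioi 0) := fun x hx =>
    (contDiffAt_inv ℝ (ne_of_gt hx)).contDiffWithinAt
  refine ⟨hg.1.inv fun x hx => (hpos x hx).ne', fun k hk ρ hρ => ?_⟩
  have hρ0 : ρ ∈ Set.Ioi (0 : ℝ) := lt_of_lt_of_le (by norm_num) hρ.1
  have h := norm_iteratedFDerivWithin_comp_le (n := k) hinv hg.1 (by exact_mod_cast le_top)
    isOpen_Ioi.uniqueDiffOn isOpen_Ioi.uniqueDiffOn (fun x hx => hpos x hx) hρ0 (C := 24) (D := B)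
    (fun i hi => by
      rw [norm_iteratedFDerivWithin_eq_norm_iteratedDerivWithin,
        iteratedDerivWithin_of_isOpen_eq_iterate isOpen_Ioi (hpos ρ hρ0), iter_deriv_inv]
      rw [norm_mul, norm_mul, norm_pow, norm_neg, norm_one, one_pow, one_mul, norm_zpow,
        Real.norm_of_nonneg (hpos ρ hρ0).le, Real.norm_of_nonneg (Nat.cast_nonneg _)]
      have a1 : ((i.factorial : ℕ) : ℝ) ≤ 24 := by
        exact_mod_cast (Nat.factorial_le (hi.trans hk)).trans_eq (by rfl : Nat.factorial 4 = 24)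
      have a2 : (g ρ) ^ (-1 - (i : ℤ)) ≤ 1 := zpow_le_one_of_nonpos₀ (h1 ρ hρ) (by omega)
      calc _ ≤ (24 : ℝ) * 1 := mul_le_mul a1 a2 (zpow_nonneg (hpos ρ hρ0).le _) (by norm_num)
        _ = 24 := by norm_num)
    (fun i hi1 hik => (hg.2 i (hik.trans hk) ρ hρ).trans (le_self_pow₀ hB (by omega)))
  refine h.trans ?_
  have a1 : ((k.factorial : ℕ) : ℝ) ≤ 24 := by
    exact_mod_cast (Nat.factorial_le hk).trans_eq (by rfl : Nat.factorial 4 = 24)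
  have a2 : B ^ k ≤ B ^ 4 := pow_le_pow_right₀ hB hk
  calc (k.factorial : ℝ) * 24 * B ^ k ≤ 24 * 24 * B ^ 4 := by gcongr
    _ = _ := by ring

lemma AnnBd.const (c : ℝ) : AnnBd (fun _ => c) |c| := by
  refine ⟨contDiffOn_const, fun k _ ρ hρ => ?_⟩
  have hρ0 : ρ ∈ Set.Ioi (0 : ℝ) := lt_of_lt_of_le (by norm_num) hρ.1
  rw [iteratedFDerivWithin_of_isOpen k isOpen_Ioi hρ0]
  rcases k with _ | k
  · simp
  · rw [iteratedFDeriv_const_of_ne (by simp)]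
    simp

lemma iteratedDeriv_comp_mul_left (k : ℕ) (f : ℝ → ℝ) (c : ℝ) :
    iteratedDeriv k (fun x => f (c * x)) = fun x => c ^ k * iteratedDeriv k f (c * x) := by
  induction k with
  | zero => simp
  | succ k ih =>
    funext x
    rw [iteratedDeriv_succ, ih, deriv_const_mul_field, deriv_comp_mul_left, iteratedDeriv_succ,
      smul_eq_mul]
    ring

/-- A smooth radial cutoff to an annulus of size `l`, times a function varying at scale `l`. -/
lemma exists_kerBd_annulus {Ψ : ℝ → ℝ} (hΨ : ContDiffOn ℝ ∞ Ψ (Set.Ioi 0))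
    (hs : ∀ ρ, ρ ≤ 1 / 8 ∨ 16 ≤ ρ → Ψ ρ = 0) :
    ∃ C : ℝ, 0 ≤ C ∧ ∀ (g : ℝ → ℝ) (B : ℝ), AnnBd g B → ∀ (b : Symb) (l : ℝ), 0 < l →
      (∀ ξ, b.1 ξ = ((Ψ (‖ξ‖ / l) * g (‖ξ‖ / l) : ℝ) : ℂ)) → KerBd b (C * B) (C * B / l) := by
  obtain ⟨BΨ, hBΨ1, hBΨ⟩ := exists_annBd hΨ
  have hnorm : ContDiffOn ℝ ∞ (norm : Plane → ℝ) {0}ᶜ := fun x hx =>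
    (contDiffAt_norm ℝ hx).contDiffWithinAt
  have hK : IsCompact (Metric.closedBall (0 : Plane) 16 ∩ {η | 1 / 16 ≤ ‖η‖}) :=
    (isCompact_closedBall _ _).inter_right (isClosed_le continuous_const continuous_norm)
  obtain ⟨D, hD1, hD⟩ := exists_bound_iteratedFDerivWithin isOpen_compl_singleton hnorm hK
    (fun η hη => by
      intro h0
      have h1 : (1 / 16 : ℝ) ≤ ‖η‖ := hη.2
      rw [Set.mem_singleton_iff.1 h0, norm_zero] at h1
      norm_num at h1)
  obtain ⟨C, hC0, hC⟩ := exists_kerBd_of_contDiff 16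
  refine ⟨C * (24 * (16 * BΨ) * D ^ 4), by positivity, fun g B hg b l hl hb => ?_⟩
  set θ : ℝ → ℝ := fun ρ => Ψ ρ * g ρ with hθ
  have hθB : AnnBd θ (16 * BΨ * B) := hBΨ.mul hg
  have hθ0 : ∀ ρ, ρ ≤ 1 / 8 ∨ 16 ≤ ρ → θ ρ = 0 := fun ρ h => by simp [hθ, hs ρ h]
  have hmaps : Set.MapsTo (norm : Plane → ℝ) {0}ᶜ (Set.Ioi 0) := fun x hx => norm_pos_iff.2 hx
  have hcomp : ContDiffOn ℝ ∞ (θ ∘ norm) ({0}ᶜ : Set Plane) := hθB.1.comp hnorm hmaps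
  set b0 : Plane → ℂ := fun η => ((θ ‖η‖ : ℝ) : ℂ) with hb0
  have hb0e : b0 = Complex.ofRealLI ∘ (θ ∘ norm) := rfl
  have hnear : ∀ η : Plane, ‖η‖ < 1 / 8 ∨ 16 < ‖η‖ → b0 =ᶠ[nhds η] fun _ => 0 := fun η hη => by
    have ho : IsOpen {x : Plane | ‖x‖ < 1 / 8 ∨ 16 < ‖x‖} :=
      (isOpen_lt continuous_norm continuous_const).union
        (isOpen_lt continuous_const continuous_norm)
    filter_upwards [ho.mem_nhds hη] with x hx
    simp [hb0, hθ0 ‖x‖ (hx.imp le_of_lt le_of_lt)]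
  have hsm : ContDiff ℝ ∞ b0 := contDiff_iff_contDiffAt.2 fun η => by
    by_cases h0 : η = 0
    · exact contDiffAt_const.congr_of_eventuallyEq (hnear η (by left; rw [h0]; norm_num))
    · exact (Complex.ofRealLI.contDiff.contDiffAt).comp η
        (hcomp.contDiffAt (isOpen_compl_singleton.mem_nhds h0))
  have key := hC b0 (24 * (16 * BΨ * B) * D ^ 4) (contDiff_infty.1 hsm 4)
    (fun η hη => by simp [hb0, hθ0 ‖η‖ (Or.inr hη.le)]) ?_ b l hl (fun ξ => ?_)
  · convert key using 1 <;> ring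
  · intro j hj η
    have hB0 := hg.nonneg
    by_cases hη : ‖η‖ < 1 / 8 ∨ 16 < ‖η‖
    · rw [((hnear η hη).iteratedFDeriv ℝ j).eq_of_nhds]
      have : iteratedFDeriv ℝ j (fun _ : Plane => (0 : ℂ)) η = 0 := by
        rw [show (fun _ : Plane => (0 : ℂ)) = 0 from rfl, iteratedFDeriv_zero]
        rfl
      rw [this, norm_zero]
      positivity
    · push Not at hη
      have h0 : η ∈ ({0}ᶜ : Set Plane) := by
        intro h0
        rw [Set.mem_singleton_iff.1 h0, norm_zero] at hη
        norm_num at hη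
      rw [← iteratedFDerivWithin_of_isOpen j isOpen_compl_singleton h0, hb0e,
        LinearIsometry.norm_iteratedFDerivWithin_comp_left Complex.ofRealLI
          (hcomp.contDiffWithinAt h0) isOpen_compl_singleton.uniqueDiffOn h0
          (by exact_mod_cast le_top)]
      have hηm : ‖η‖ ∈ Set.Icc (1 / 16 : ℝ) 16 := ⟨by linarith [hη.1], by linarith [hη.2]⟩
      refine (norm_iteratedFDerivWithin_comp_le hθB.1 hnorm (n := j) (by exact_mod_cast le_top)
        isOpen_Ioi.uniqueDiffOn isOpen_compl_singleton.uniqueDiffOn hmaps h0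
        (C := 16 * BΨ * B) (D := D)
        (fun i hi => hθB.2 i (hi.trans hj) _ hηm)
        (fun i hi1 hij => (hD i (hij.trans hj) η ⟨by simpa using hηm.2, hηm.1⟩).trans
          (le_self_pow₀ hD1 (by omega)))).trans ?_
      have a1 : ((j.factorial : ℕ) : ℝ) ≤ 24 := by
        exact_mod_cast (Nat.factorial_le hj).trans_eq (by rfl : Nat.factorial 4 = 24)
      have a2 : D ^ j ≤ D ^ 4 := pow_le_pow_right₀ hD1 hj
      gcongr
  · have e : ‖l⁻¹ • ξ‖ = ‖ξ‖ / l := by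
      rw [norm_smul, Real.norm_of_nonneg (inv_nonneg.2 hl.le), div_eq_inv_mul]
    simp only [hb, hb0, e, hθ]

end Annuli

end Spec

namespace Spec

section Cutoffs

/-- A smooth cutoff, equal to `1` on `[0, 1]` and to `0` on `[2, ∞)`. -/
def cutoff (r : ℝ) : ℝ := Real.smoothTransition (2 - r)

lemma cutoff_eq_one {r : ℝ} (h : r ≤ 1) : cutoff r = 1 :=
  Real.smoothTransition.one_of_one_le (by linarith)

lemma cutoff_eq_zero {r : ℝ} (h : 2 ≤ r) : cutoff r = 0 :=
  Real.smoothTransition.zero_of_nonpos (by linarith)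

lemma cutoff_nonneg (r : ℝ) : 0 ≤ cutoff r := Real.smoothTransition.nonneg _

lemma cutoff_le_one (r : ℝ) : cutoff r ≤ 1 := Real.smoothTransition.le_one _

lemma contDiff_cutoff : ContDiff ℝ ∞ cutoff :=
  Real.smoothTransition.contDiff.comp (contDiff_const.sub contDiff_id)

lemma norm_cutoff_le (r : ℝ) : ‖((cutoff r : ℝ) : ℂ)‖ ≤ 1 := by
  rw [Complex.norm_real, Real.norm_of_nonneg (cutoff_nonneg r)]
  exact cutoff_le_one r

/-- The low-frequency cutoff at scale `l`. -/
def chi (l : ℝ) : Symb :=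
  ⟨fun ξ => ((cutoff (‖ξ‖ / l) : ℝ) : ℂ),
    Complex.continuous_ofReal.comp (contDiff_cutoff.continuous.comp (continuous_norm.div_const l)),
    1, 0, fun ξ => by simpa using norm_cutoff_le _⟩

lemma chi_apply (l : ℝ) (ξ : Plane) : (chi l).1 ξ = ((cutoff (‖ξ‖ / l) : ℝ) : ℂ) := rfl

lemma chi_eq_one {l : ℝ} (hl : 0 < l) {ξ : Plane} (h : ‖ξ‖ ≤ l) : (chi l).1 ξ = 1 := by
  rw [chi_apply, cutoff_eq_one ((div_le_one hl).2 h), Complex.ofReal_one]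

lemma chi_eq_zero {l : ℝ} (hl : 0 < l) {ξ : Plane} (h : 2 * l ≤ ‖ξ‖) : (chi l).1 ξ = 0 := by
  rw [chi_apply, cutoff_eq_zero ((le_div_iff₀ hl).2 h), Complex.ofReal_zero]

lemma norm_chi_le (l : ℝ) (ξ : Plane) : ‖(chi l).1 ξ‖ ≤ 1 := norm_cutoff_le _

/-- The low-frequency cutoff at scale one, as a Schwartz function. -/
lemma exists_schwartz_cutoff :
    ∃ S : SchwartzMap Plane ℂ, ∀ η, S η = ((cutoff ‖η‖ : ℝ) : ℂ) := by
  have hz : ∀ η : Plane, 2 < ‖η‖ → ((cutoff ‖η‖ : ℝ) : ℂ) = 0 := fun η h => by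
    rw [cutoff_eq_zero h.le, Complex.ofReal_zero]
  have hs : HasCompactSupport fun η : Plane => ((cutoff ‖η‖ : ℝ) : ℂ) :=
    HasCompactSupport.of_support_subset_isCompact (isCompact_closedBall 0 2) fun η hη => by
      by_contra hcon
      exact hη (hz η (by simpa using hcon))
  have hsm : ContDiff ℝ ∞ fun η : Plane => ((cutoff ‖η‖ : ℝ) : ℂ) := by
    refine contDiff_iff_contDiffAt.2 fun η => ?_
    by_cases h0 : η = 0
    · refine (contDiffAt_const (c := (1 : ℂ))).congr_of_eventuallyEq ?_
      have ho : IsOpen {x : Plane | ‖x‖ < 1} := isOpen_lt continuous_norm continuous_const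
      filter_upwards [ho.mem_nhds (by simp [h0])] with x hx
      rw [cutoff_eq_one (le_of_lt hx), Complex.ofReal_one]
    · exact (Complex.ofRealCLM.contDiff.comp contDiff_cutoff).contDiffAt.comp η
        (contDiffAt_norm ℝ h0)
  exact ⟨hs.toSchwartzMap hsm, fun η => rfl⟩

lemma exists_schwartz_decay {F : Type*} [NormedAddCommGroup F] [NormedSpace ℝ F]
    (S : SchwartzMap Plane F) : ∃ C, 0 ≤ C ∧ ∀ x, ‖S x‖ ≤ C * ((1 + ‖x‖) ^ 4)⁻¹ := by
  refine ⟨2 ^ 4 * (Finset.Iic (4, 0)).sup (fun m => SchwartzMap.seminorm ℝ m.1 m.2) S,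
    mul_nonneg (by positivity) (apply_nonneg _ S), fun x => ?_⟩
  · have h := SchwartzMap.one_add_le_sup_seminorm_apply (𝕜 := ℝ) (m := (4, 0)) (k := 4) (n := 0)
      le_rfl le_rfl S x
    rw [norm_iteratedFDeriv_zero, mul_comm] at h
    rwa [← div_eq_mul_inv, le_div_iff₀ (by positivity)]

lemma fourier_sub_translate (k : SchwartzMap Plane ℂ) (z η : Plane) :
    𝓕 (fun x => k (x - z) - k x) η = ((𝐞 (-inner ℝ η z) : ℂ) - 1) * 𝓕 (k : Plane → ℂ) η := by
  have h1 : 𝓕 (fun x => k (x - z)) η = (𝐞 (-inner ℝ η z) : ℂ) * 𝓕 (k : Plane → ℂ) η := by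
    have := congrFun (VectorFourier.fourierIntegral_comp_add_right (𝐞) (volume : Measure Plane)
      (innerₗ Plane) (k : Plane → ℂ) (-z)) η
    simp only [innerₗ_apply_apply, inner_neg_left] at this
    rw [Circle.smul_def, smul_eq_mul] at this
    rw [real_inner_comm]
    exact this
  rw [sub_mul, one_mul, ← h1, Real.fourier_eq, Real.fourier_eq, Real.fourier_eq, ← integral_sub]
  · simp_rw [smul_sub]
  · exact (Real.fourierIntegral_convergent_iff η).2 (k.integrable.comp_sub_right z)
  · exact (Real.fourierIntegral_convergent_iff η).2 k.integrable

lemma norm_sub_translate_le {k : SchwartzMap Plane ℂ} {C : ℝ} (hC0 : 0 ≤ C)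
    (hC : ∀ x, ‖fderiv ℝ k x‖ ≤ C * ((1 + ‖x‖) ^ 4)⁻¹) {z : Plane} (hz : ‖z‖ ≤ 1) (x : Plane) :
    ‖k (x - z) - k x‖ ≤ 16 * C * ‖z‖ * ((1 + ‖x‖) ^ 4)⁻¹ := by
  have hx0 := norm_nonneg x
  have h := (convex_closedBall x 1).norm_image_sub_le_of_norm_fderiv_le (𝕜 := ℝ) (f := k)
    (C := 16 * C * ((1 + ‖x‖) ^ 4)⁻¹) (fun y _ => k.differentiableAt) (fun y hy => ?_)
    (Metric.mem_closedBall_self zero_le_one) (y := x - z) (by simpa [dist_eq_norm] using hz)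
  · refine h.trans_eq ?_
    rw [sub_sub_cancel_left, norm_neg]
    ring
  · refine (hC y).trans ?_
    have h1 : 1 + ‖x‖ ≤ 2 * (1 + ‖y‖) := by
      have h2 : ‖x - y‖ ≤ 1 := by
        rw [Metric.mem_closedBall, dist_comm, dist_eq_norm] at hy
        exact hy
      have h3 := norm_add_le (x - y) y
      rw [sub_add_cancel] at h3
      linarith [norm_nonneg y]
    have h4 : (1 + ‖x‖) ^ 4 ≤ 16 * (1 + ‖y‖) ^ 4 := by
      calc (1 + ‖x‖) ^ 4 ≤ (2 * (1 + ‖y‖)) ^ 4 := by gcongr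
        _ = _ := by ring
    rw [mul_right_comm, mul_comm (16 * _) C]
    refine mul_le_mul_of_nonneg_left ?_ hC0
    rw [inv_eq_one_div, div_le_iff₀ (by positivity), mul_assoc, inv_mul_eq_div, ← mul_div_assoc,
      le_div_iff₀ (by positivity), one_mul]
    exact h4

/-- Low-frequency cutoffs are bounded, and satisfy Bernstein's inequality. -/
lemma exists_chi_bounds : ∃ C : ℝ, 1 ≤ C ∧ ∀ l : ℝ, 0 < l →
    MultBd (chi l) C ∧ MultLip (chi l) (C * l) := by
  obtain ⟨S, hS⟩ := exists_schwartz_cutoff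
  set k : SchwartzMap Plane ℂ := 𝓕⁻ S with hk
  have hFk : ∀ η, 𝓕 (k : Plane → ℂ) η = ((cutoff ‖η‖ : ℝ) : ℂ) := fun η => by
    rw [← SchwartzMap.fourier_coe, hk, FourierTransform.fourier_fourierInv_eq, hS]
  obtain ⟨A, hA0, hA⟩ := exists_schwartz_decay k
  obtain ⟨D, hD0, hD⟩ := exists_schwartz_decay (SchwartzMap.fderivCLM ℝ Plane ℂ k)
  have hsc : ∀ {l : ℝ}, 0 < l → ∀ ξ : Plane, ‖l⁻¹ • ξ‖ = ‖ξ‖ / l := fun {l} hl ξ => by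
    rw [norm_smul, Real.norm_of_nonneg (inv_nonneg.2 hl.le), div_eq_inv_mul]
  set J := ∫ y : Plane, ((1 + ‖y‖) ^ 3)⁻¹ with hJ
  have hJ0 : 0 ≤ J := integral_nonneg fun _ => by positivity
  have hbd : ∀ l : ℝ, 0 < l → MultBd (chi l) (A * J) := fun l hl =>
    (kerBd_of_scaled k.continuous hA hl fun ξ => by
      rw [hFk, hsc hl]
      rfl).multBd
  refine ⟨1 + 2 * (A * J) + 16 * D * J, ?_, fun l hl => ⟨(hbd l hl).mono ?_, ?_, fun y => ?_⟩⟩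
  · have : 0 ≤ A * J := by positivity
    have : 0 ≤ 16 * D * J := by positivity
    linarith
  · have : 0 ≤ A * J := by positivity
    have : 0 ≤ 16 * D * J := by positivity
    linarith
  · positivity
  · have p1 : 0 ≤ A * J := by positivity
    have p2 : 0 ≤ 16 * D * J := by positivity
    rcases le_total (‖l • y‖) 1 with h | h
    · have h1 := kerBd_of_scaled (b := (Spec.shift y - 1) * chi l)
        (k := fun x => k (x - l • y) - k x)
        ((k.continuous.comp (continuous_id.sub continuous_const)).sub k.continuous)
        (norm_sub_translate_le hD0 hD h) hl (fun ξ => by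
          rw [fourier_sub_translate, hFk, hsc hl]
          have e : inner ℝ (l⁻¹ • ξ) (l • y) = inner ℝ ξ y := by
            rw [real_inner_smul_left, real_inner_smul_right]
            field_simp
          rw [e]
          rfl)
      refine h1.multBd.mono ?_
      rw [norm_smul, Real.norm_of_nonneg hl.le]
      calc 16 * D * (l * ‖y‖) * J = (16 * D * J) * (l * ‖y‖) := by ring
        _ ≤ (1 + 2 * (A * J) + 16 * D * J) * (l * ‖y‖) := by
            gcongr
            linarith
        _ = _ := by ring
    · refine (((MultBd.shift y).sub MultBd.one).mul (hbd l hl)).mono ?_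
      rw [norm_smul, Real.norm_of_nonneg hl.le] at h
      calc (1 + 1) * (A * J) = 2 * (A * J) * 1 := by ring
        _ ≤ (1 + 2 * (A * J) + 16 * D * J) * (l * ‖y‖) := by
            gcongr
            linarith
        _ = _ := by ring

end Cutoffs

end Spec

namespace Spec

/-- The properties of the radial profile of the smoothing operator used in the estimates. -/
structure Weight (s N A : ℝ) (μ : ℝ → ℝ) : Prop where
  contDiff : ContDiffOn ℝ ∞ μ (Set.Ioi 0)
  pos : ∀ r, 0 < μ r
  le_one : ∀ r, μ r ≤ 1
  anti : AntitoneOn μ (Set.Ioi 0)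
  eq_one : ∀ r ≤ N, μ r = 1
  mono_mul : MonotoneOn (fun r => r * μ r) (Set.Ioi 0)
  deriv_bound : ∀ k ≤ 4, ∀ r > (0 : ℝ), r ^ k * |iteratedDeriv k μ r| ≤ A * μ r
  growth : ∀ r, N ≤ r → N ^ (1 - s) * r ^ s ≤ 2 * (r * μ r)
  one_le : 1 ≤ N

lemma Weight.one {s N A : ℝ} (hs1 : s ≤ 1) (hN : 1 ≤ N) (hA : 1 ≤ A) :
    Weight s N A fun _ => 1 where
  contDiff := contDiffOn_const
  pos _ := one_pos
  le_one _ := le_rfl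
  anti := antitoneOn_const
  eq_one _ _ := rfl
  mono_mul := fun x _ y _ h => by simpa using h
  deriv_bound k hk r hr := by
    rw [iteratedDeriv_const]
    split_ifs with h
    · simpa [h] using hA
    · simp
      linarith
  growth r hr := by
    have hr0 : 0 < r := by linarith
    have h1 : N ^ (1 - s) ≤ r ^ (1 - s) := Real.rpow_le_rpow (by linarith) hr (by linarith)
    calc N ^ (1 - s) * r ^ s ≤ r ^ (1 - s) * r ^ s := by gcongr
      _ = r := by rw [← Real.rpow_add hr0]; simp
      _ ≤ 2 * (r * 1) := by linarith
  one_le := hN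

section Profiles

variable {s N A : ℝ} {μ : ℝ → ℝ}

lemma Weight.continuous (h : Weight s N A μ) : Continuous μ := by
  refine continuous_iff_continuousAt.2 fun r => ?_
  rcases lt_or_ge r N with hr | hr
  · refine (continuousAt_const (y := (1 : ℝ))).congr ?_
    filter_upwards [Iio_mem_nhds hr] with x hx
    rw [h.eq_one x (le_of_lt hx)]
  · exact (h.contDiff.continuousOn).continuousAt (Ioi_mem_nhds (by linarith [h.one_le]))

lemma Weight.one_le_amp (h : Weight s N A μ) {r : ℝ} (hr : 0 ≤ r) : 1 ≤ (1 + r) * μ r := by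
  have hN := h.one_le
  rcases le_total r N with hrN | hrN
  · rw [h.eq_one r hrN]
    linarith
  · have h1 := h.mono_mul (Set.mem_Ioi.2 (by linarith : 0 < N)) (Set.mem_Ioi.2 (by linarith)) hrN
    simp only [h.eq_one N le_rfl] at h1
    nlinarith [h.pos r]

lemma Weight.amp_pos (h : Weight s N A μ) {r : ℝ} (hr : 0 ≤ r) : 0 < (1 + r) * μ r :=
  one_pos.trans_le (h.one_le_amp hr)

/-- The symbol `(1 + |ξ|) μ(|ξ|)`. -/
def Weight.amp (h : Weight s N A μ) : Symb :=
  ⟨fun ξ => (((1 + ‖ξ‖) * μ ‖ξ‖ : ℝ) : ℂ),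
    Complex.continuous_ofReal.comp
      ((continuous_const.add continuous_norm).mul (h.continuous.comp continuous_norm)), 1, 1,
    fun ξ => by
      rw [Complex.norm_real, Real.norm_of_nonneg (h.amp_pos (norm_nonneg ξ)).le, one_mul, pow_one]
      exact mul_le_of_le_one_right (by positivity) (h.le_one _)⟩

/-- The symbol `1 / ((1 + |ξ|) μ(|ξ|))`. -/
def Weight.ampInv (h : Weight s N A μ) : Symb :=
  ⟨fun ξ => ((((1 + ‖ξ‖) * μ ‖ξ‖)⁻¹ : ℝ) : ℂ),
    Complex.continuous_ofReal.comp
      (((continuous_const.add continuous_norm).mul (h.continuous.comp continuous_norm)).inv₀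
        fun ξ => (h.amp_pos (norm_nonneg ξ)).ne'), 1, 0,
    fun ξ => by
      rw [Complex.norm_real, Real.norm_of_nonneg (inv_pos.2 (h.amp_pos (norm_nonneg ξ))).le,
        one_mul, pow_zero]
      exact inv_le_one_of_one_le₀ (h.one_le_amp (norm_nonneg ξ))⟩

lemma Weight.amp_apply (h : Weight s N A μ) (ξ : Plane) :
    h.amp.1 ξ = (((1 + ‖ξ‖) * μ ‖ξ‖ : ℝ) : ℂ) := rfl

lemma Weight.ampInv_apply (h : Weight s N A μ) (ξ : Plane) :
    h.ampInv.1 ξ = ((((1 + ‖ξ‖) * μ ‖ξ‖)⁻¹ : ℝ) : ℂ) := rfl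

lemma Weight.ampInv_mul_amp (h : Weight s N A μ) : h.ampInv * h.amp = 1 :=
  Subtype.ext (funext fun ξ => by
    change h.ampInv.1 ξ * h.amp.1 ξ = 1
    rw [h.amp_apply, h.ampInv_apply, ← Complex.ofReal_mul,
      inv_mul_cancel₀ (h.amp_pos (norm_nonneg ξ)).ne', Complex.ofReal_one])

lemma norm_ampInv_le (h : Weight s N A μ) (ξ : Plane) : ‖h.ampInv.1 ξ‖ ≤ 1 := by
  rw [h.ampInv_apply, Complex.norm_real,
    Real.norm_of_nonneg (inv_pos.2 (h.amp_pos (norm_nonneg ξ))).le]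
  exact inv_le_one_of_one_le₀ (h.one_le_amp (norm_nonneg ξ))

lemma annBd_comp_mul_left {f : ℝ → ℝ} (hf : ContDiffOn ℝ ∞ f (Set.Ioi 0)) {l B : ℝ} (hl : 0 < l)
    (hB : ∀ k ≤ 4, ∀ ρ ∈ Set.Icc (1 / 16 : ℝ) 16, l ^ k * |iteratedDeriv k f (l * ρ)| ≤ B) :
    AnnBd (fun ρ => f (l * ρ)) B := by
  refine ⟨hf.comp (contDiffOn_const.mul contDiffOn_id) fun x hx => mul_pos hl hx,
    fun k hk ρ hρ => ?_⟩
  have hρ0 : ρ ∈ Set.Ioi (0 : ℝ) := lt_of_lt_of_le (by norm_num) hρ.1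
  rw [iteratedFDerivWithin_of_isOpen k isOpen_Ioi hρ0, norm_iteratedFDeriv_eq_norm_iteratedDeriv,
    iteratedDeriv_comp_mul_left, norm_mul, norm_pow, Real.norm_of_nonneg hl.le]
  exact hB k hk ρ hρ

lemma annBd_affine {l : ℝ} (hl : 0 < l) : AnnBd (fun ρ => 1 + l * ρ) (16 * (1 + l)) := by
  refine annBd_comp_mul_left (f := fun r => 1 + r) (contDiffOn_const.add contDiffOn_id) hl
    fun k _ ρ hρ => ?_
  have hρ1 := hρ.1
  rcases k with _ | _ | k
  · rw [iteratedDeriv_zero, pow_zero, one_mul, abs_of_pos (by nlinarith)]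
    nlinarith [hρ.2]
  · simp
    linarith
  · have : iteratedDeriv (k + 1 + 1) (fun r : ℝ => 1 + r) = fun _ => 0 := by
      have h1 : deriv (fun r : ℝ => 1 + r) = fun _ => 1 := by
        funext x
        simp
      funext x
      rw [iteratedDeriv_succ', h1, iteratedDeriv_succ', deriv_const', iteratedDeriv_const,
        ite_self]
    rw [this]
    simp
    linarith

lemma annBd_linear {l : ℝ} (hl : 0 < l) : AnnBd (fun ρ => l * ρ) (16 * l) := by
  refine annBd_comp_mul_left (f := fun r => r) contDiffOn_id hl fun k _ ρ hρ => ?_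
  have hρ1 := hρ.1
  rcases k with _ | _ | k
  · rw [iteratedDeriv_zero, pow_zero, one_mul, abs_of_pos (by nlinarith)]
    nlinarith [hρ.2]
  · simp
    linarith
  · have : iteratedDeriv (k + 1 + 1) (fun r : ℝ => r) = fun _ => 0 := by
      funext x
      rw [iteratedDeriv_succ', iteratedDeriv_succ']
      simp only [deriv_id'', deriv_const']
      rw [iteratedDeriv_const, ite_self]
    rw [this]
    simp
    linarith

lemma Weight.le_mul_of_mem (h : Weight s N A μ) {l ρ : ℝ} (hl : 0 < l)
    (hρ : ρ ∈ Set.Icc (1 / 16 : ℝ) 16) : μ (l * ρ) ≤ 16 * μ l ∧ μ l ≤ 16 * μ (l * ρ) := by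
  have h16 : (0 : ℝ) < l / 16 := by positivity
  have hρ0 : 0 < ρ := lt_of_lt_of_le (by norm_num) hρ.1
  have hlρ : 0 < l * ρ := mul_pos hl hρ0
  constructor
  · have h1 := h.anti (Set.mem_Ioi.2 h16) (Set.mem_Ioi.2 hlρ) (by nlinarith [hρ.1])
    have h2 := h.mono_mul (Set.mem_Ioi.2 h16) (Set.mem_Ioi.2 hl) (by linarith)
    simp only at h2
    have h3 : μ (l / 16) ≤ 16 * μ l := by
      refine le_of_mul_le_mul_left ?_ h16
      linarith
    exact h1.trans h3
  · have h1 := h.anti (Set.mem_Ioi.2 hlρ) (Set.mem_Ioi.2 (by positivity : 0 < 16 * l))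
      (by nlinarith [hρ.2])
    have h2 := h.mono_mul (Set.mem_Ioi.2 hl) (Set.mem_Ioi.2 (by positivity : 0 < 16 * l))
      (by linarith)
    simp only at h2
    have h3 : μ l ≤ 16 * μ (16 * l) := by
      refine le_of_mul_le_mul_left ?_ hl
      linarith
    linarith

lemma Weight.annBd_amp (h : Weight s N A μ) {l : ℝ} (hl : 0 < l) :
    AnnBd (fun ρ => (1 + l * ρ) * μ (l * ρ))
      (16 ^ 7 * A * ((1 + l) * μ l)) := by
  have h1 : AnnBd (fun ρ => μ (l * ρ)) (16 ^ 5 * A * μ l) := by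
    refine annBd_comp_mul_left h.contDiff hl fun k hk ρ hρ => ?_
    have hρ0 : 0 < ρ := lt_of_lt_of_le (by norm_num) hρ.1
    have hd := h.deriv_bound k hk (l * ρ) (mul_pos hl hρ0)
    have hm := (h.le_mul_of_mem hl hρ).1
    have hA0 : 0 ≤ A := by
      have := (by positivity : 0 ≤ (l * ρ) ^ k * |iteratedDeriv k μ (l * ρ)|).trans hd
      exact nonneg_of_mul_nonneg_left this (h.pos _)
    have hρk : 1 ≤ 16 ^ 4 * ρ ^ k := by
      have e1 : (1 : ℝ) ≤ (16 * ρ) ^ k := one_le_pow₀ (by linarith [hρ.1])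
      have e2 : (16 : ℝ) ^ k ≤ 16 ^ 4 := pow_le_pow_right₀ (by norm_num) hk
      rw [mul_pow] at e1
      nlinarith [pow_pos hρ0 k]
    rw [mul_pow] at hd
    have hX : 0 ≤ l ^ k * |iteratedDeriv k μ (l * ρ)| := by positivity
    calc l ^ k * |iteratedDeriv k μ (l * ρ)|
        ≤ (16 ^ 4 * ρ ^ k) * (l ^ k * |iteratedDeriv k μ (l * ρ)|) :=
          le_mul_of_one_le_left hX hρk
      _ = 16 ^ 4 * (l ^ k * ρ ^ k * |iteratedDeriv k μ (l * ρ)|) := by ring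
      _ ≤ 16 ^ 4 * (A * (16 * μ l)) := by
          exact mul_le_mul_of_nonneg_left (hd.trans (mul_le_mul_of_nonneg_left hm hA0))
            (by norm_num)
      _ = _ := by ring
  refine ((annBd_affine hl).mul h1).mono (le_of_eq ?_)
  ring

lemma Weight.annBd_ampInv (h : Weight s N A μ) (hA : 1 ≤ A) {l : ℝ} (hl : 0 < l) :
    AnnBd (fun ρ => ((1 + l * ρ) * μ (l * ρ))⁻¹)
      (16 * 256 * (576 * (16 ^ 10 * A) ^ 4) / ((1 + l) * μ l)) := by
  set w := (1 + l) * μ l with hw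
  have hw0 : 0 < w := h.amp_pos hl.le
  have hg : AnnBd (fun ρ => 256 / w * ((1 + l * ρ) * μ (l * ρ))) (16 ^ 10 * A) := by
    refine ((AnnBd.const (256 / w)).mul (h.annBd_amp hl)).mono (le_of_eq ?_)
    rw [abs_of_pos (by positivity), ← hw]
    field_simp
    norm_num
  have hi := hg.inv (by nlinarith) (fun ρ hρ => ?_) (fun ρ hρ => ?_)
  · have := (AnnBd.const (256 / w)).mul hi
    rw [abs_of_pos (by positivity)] at this
    convert this using 1
    · funext ρ
      rw [mul_inv (256 / w), ← mul_assoc, mul_inv_cancel₀ (by positivity), one_mul]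
    · ring
  · have h2 : 0 < l * ρ := mul_pos hl hρ
    have := h.amp_pos h2.le
    positivity
  · have hρ0 : 0 < ρ := lt_of_lt_of_le (by norm_num) hρ.1
    have h2 := (h.le_mul_of_mem hl hρ).2
    rw [div_mul_eq_mul_div, one_le_div hw0, hw]
    have h3 : 1 + l ≤ 16 * (1 + l * ρ) := by nlinarith [hρ.1]
    calc (1 + l) * μ l ≤ (16 * (1 + l * ρ)) * (16 * μ (l * ρ)) :=
          mul_le_mul h3 h2 (h.pos _).le (by positivity)
      _ = _ := by ring

end Profiles

end Spec

namespace Spec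

section SymbolBounds

/-- The cutoff to frequencies between `l` and `4 * l`. -/
def psi (l : ℝ) : Symb := chi (2 * l) - chi l

/-- A cutoff equal to `1` on the frequencies between `l / 2` and `8 * l`. -/
def fat (l : ℝ) : Symb := chi (8 * l) - chi (l / 4)

lemma psi_apply (l : ℝ) (ξ : Plane) :
    (psi l).1 ξ = ((cutoff (‖ξ‖ / l / 2) - cutoff (‖ξ‖ / l) : ℝ) : ℂ) := by
  rw [Complex.ofReal_sub, div_div, mul_comm l 2]
  rfl

lemma fat_apply (l : ℝ) (ξ : Plane) :
    (fat l).1 ξ = ((cutoff (‖ξ‖ / l / 8) - cutoff (4 * (‖ξ‖ / l)) : ℝ) : ℂ) := by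
  have : 4 * (‖ξ‖ / l) = ‖ξ‖ / (l / 4) := by rw [div_div_eq_mul_div, mul_comm 4, mul_div_right_comm]
  rw [Complex.ofReal_sub, div_div, mul_comm l 8, this]
  rfl

lemma psi_eq_zero {l : ℝ} (hl : 0 < l) {ξ : Plane} (h : ‖ξ‖ ≤ l ∨ 4 * l ≤ ‖ξ‖) :
    (psi l).1 ξ = 0 := by
  change (chi (2 * l)).1 ξ - (chi l).1 ξ = 0
  rcases h with h | h
  · rw [chi_eq_one hl h, chi_eq_one (by positivity) (by linarith), sub_self]
  · rw [chi_eq_zero hl (by linarith), chi_eq_zero (by positivity) (by linarith), sub_self]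

lemma fat_eq_one {l : ℝ} (hl : 0 < l) {ξ : Plane} (h1 : l / 2 ≤ ‖ξ‖) (h2 : ‖ξ‖ ≤ 8 * l) :
    (fat l).1 ξ = 1 := by
  change (chi (8 * l)).1 ξ - (chi (l / 4)).1 ξ = 1
  rw [chi_eq_one (by positivity) h2, chi_eq_zero (by positivity) (by linarith), sub_zero]

lemma mul_eq_right_of {b c : Symb} (h : ∀ ξ, c.1 ξ ≠ 0 → b.1 ξ = 1) : b * c = c :=
  Subtype.ext (funext fun ξ => by
    change b.1 ξ * c.1 ξ = c.1 ξ
    by_cases h0 : c.1 ξ = 0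
    · rw [h0, mul_zero]
    · rw [h ξ h0, one_mul])

lemma chi_mul_chi {l m : ℝ} (hl : 0 < l) (h : 2 * l ≤ m) : chi m * chi l = chi l :=
  mul_eq_right_of fun ξ hξ => chi_eq_one (by linarith) (by
    by_contra! hc
    exact hξ (chi_eq_zero hl (by linarith)))

lemma chi_mul_psi {l : ℝ} (hl : 0 < l) : chi (4 * l) * psi l = psi l :=
  mul_eq_right_of fun ξ hξ => chi_eq_one (by linarith) (by
    by_contra! hc
    exact hξ (psi_eq_zero hl (Or.inr hc.le)))

variable {s N A : ℝ} {μ : ℝ → ℝ}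

lemma exists_annulus_bounds {A : ℝ} (hA : 1 ≤ A) : ∃ C : ℝ, 1 ≤ C ∧
    ∀ (s N : ℝ) (μ : ℝ → ℝ) (h : Weight s N A μ) (l : ℝ), 0 < l →
      MultBd (psi l * h.ampInv) (C / ((1 + l) * μ l)) ∧
      KerBd (fat l * h.amp) (C * ((1 + l) * μ l)) (C * ((1 + l) * μ l) / l) ∧
      ((∀ r, μ r = 1) → MultBd (psi l * (1 - h.ampInv)) (C * (l / (1 + l)))) := by
  obtain ⟨C₁, hC₁0, hC₁⟩ := exists_kerBd_annulus
    (Ψ := fun ρ => cutoff (ρ / 2) - cutoff ρ)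
    ((contDiff_cutoff.comp (contDiff_id.div_const 2)).sub contDiff_cutoff).contDiffOn
    (fun ρ hρ => by
      rcases hρ with hρ | hρ
      · rw [cutoff_eq_one (by linarith), cutoff_eq_one (by linarith), sub_self]
      · rw [cutoff_eq_zero (by linarith), cutoff_eq_zero (by linarith), sub_self])
  obtain ⟨C₂, hC₂0, hC₂⟩ := exists_kerBd_annulus
    (Ψ := fun ρ => cutoff (ρ / 8) - cutoff (4 * ρ))
    ((contDiff_cutoff.comp (contDiff_id.div_const 8)).sub
      (contDiff_cutoff.comp (contDiff_const.mul contDiff_id))).contDiffOn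
    (fun ρ hρ => by
      rcases hρ with hρ | hρ
      · rw [cutoff_eq_one (by linarith), cutoff_eq_one (by linarith), sub_self]
      · rw [cutoff_eq_zero (by linarith), cutoff_eq_zero (by linarith), sub_self])
  set D : ℝ := 16 * 256 * (576 * (16 ^ 10 * A) ^ 4) with hD
  have hD0 : 0 ≤ D := by positivity
  have hA0 : 0 ≤ A := by linarith
  set C : ℝ := 1 + C₁ * D + C₂ * (16 ^ 7 * A) + C₁ * (16 * 16 * D) with hC
  have t1 : 0 ≤ C₁ * D := by positivity
  have t2 : 0 ≤ C₂ * (16 ^ 7 * A) := by positivity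
  have t3 : 0 ≤ C₁ * (16 * 16 * D) := by positivity
  refine ⟨C, by linarith, fun s N μ h l hl => ⟨?_, ?_, fun hμ => ?_⟩⟩
  all_goals
    have hw0 : 0 < (1 + l) * μ l := h.amp_pos hl.le
  · refine (hC₁ _ _ (h.annBd_ampInv hA hl) _ l hl fun ξ => ?_).multBd.mono ?_
    · change (psi l).1 ξ * h.ampInv.1 ξ = _
      rw [psi_apply, h.ampInv_apply, Complex.ofReal_mul, mul_div_cancel₀ _ hl.ne']
    · rw [← mul_div_assoc]
      gcongr
      linarith
  · have := hC₂ _ _ (h.annBd_amp hl) (fat l * h.amp) l hl fun ξ => ?_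
    · obtain ⟨k, a1, a2, a3, a4⟩ := this
      have e : C₂ * (16 ^ 7 * A * ((1 + l) * μ l)) ≤ C * ((1 + l) * μ l) := by
        rw [← mul_assoc]
        gcongr
        linarith
      exact ⟨k, a1, a2, a3.trans e, a4.trans (by gcongr)⟩
    · change (fat l).1 ξ * h.amp.1 ξ = _
      rw [fat_apply, h.amp_apply, mul_div_cancel₀ _ hl.ne', ← Complex.ofReal_mul]
  · refine (hC₁ _ _ ((annBd_linear hl).mul (h.annBd_ampInv hA hl)) _ l hl fun ξ => ?_).multBd.mono
      ?_
    · change (psi l).1 ξ * (1 - h.ampInv.1 ξ) = _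
      rw [psi_apply, h.ampInv_apply, Complex.ofReal_mul, mul_div_cancel₀ _ hl.ne', hμ, mul_one,
        ← Complex.ofReal_one, ← Complex.ofReal_sub]
      congr 2
      have : 0 < 1 + ‖ξ‖ := by positivity
      field_simp
      ring
    · rw [hμ, mul_one]
      have : C₁ * (16 * (16 * l) * (D / (1 + l))) = C₁ * (16 * 16 * D) * (l / (1 + l)) := by ring
      rw [this]
      gcongr
      linarith

lemma sum_psi (R : ℝ) (n : ℕ) :
    ∑ j ∈ Finset.range n, psi ((1 / 2) ^ (j + 1) * R) = chi R - chi ((1 / 2) ^ n * R) := by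
  induction n with
  | zero => simp
  | succ n ih =>
    rw [Finset.sum_range_succ, ih, psi]
    have : 2 * ((1 / 2) ^ (n + 1) * R) = (1 / 2) ^ n * R := by ring
    rw [this]
    abel

lemma tendsto_chi_zero {R : ℝ} (hR : 0 < R) {ξ : Plane} (hξ : ξ ≠ 0) :
    Filter.Tendsto (fun n : ℕ => (chi ((1 / 2) ^ n * R)).1 ξ) Filter.atTop (nhds 0) := by
  have h0 : Filter.Tendsto (fun n : ℕ => 2 * ((1 / 2 : ℝ) ^ n * R)) Filter.atTop (nhds 0) := by
    have := ((tendsto_pow_atTop_nhds_zero_of_lt_one (r := (1 / 2 : ℝ)) (by norm_num)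
      (by norm_num)).mul_const R).const_mul 2
    simpa using this
  refine tendsto_const_nhds.congr' ?_
  filter_upwards [h0.eventually_lt_const (norm_pos_iff.2 hξ)] with n hn
  rw [chi_eq_zero (by positivity) hn.le]

lemma div_one_add_le_rpow {l ε : ℝ} (hl : 0 < l) (hε : 0 < ε) (hε1 : ε ≤ 1) :
    l / (1 + l) ≤ l ^ ε := by
  rw [div_le_iff₀ (by positivity)]
  rcases le_total l 1 with h | h
  · have : l ≤ l ^ ε := by
      simpa using Real.rpow_le_rpow_of_exponent_ge hl h hε1
    nlinarith
  · have := Real.one_le_rpow h hε.le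
    nlinarith

lemma sum_half_le {ε : ℝ} (hε : 0 < ε) (hε1 : ε ≤ 1) {R N : ℝ} (hR : 0 < R) (hRN : R ≤ N) (n : ℕ) :
    ∑ j ∈ Finset.range n, ((1 / 2) ^ (j + 1) * R) / (1 + (1 / 2) ^ (j + 1) * R)
      ≤ (1 - (1 / 2 : ℝ) ^ ε)⁻¹ * N ^ ε := by
  have hq0 : 0 ≤ (1 / 2 : ℝ) ^ ε := by positivity
  have hq1 : (1 / 2 : ℝ) ^ ε < 1 := Real.rpow_lt_one (by norm_num) (by norm_num) hε
  have hN0 : 0 < N := hR.trans_le hRN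
  calc _ ≤ ∑ j ∈ Finset.range n, ((1 / 2 : ℝ) ^ ε) ^ j * N ^ ε := by
        refine Finset.sum_le_sum fun j _ => ?_
        refine (div_one_add_le_rpow (by positivity) hε hε1).trans ?_
        rw [Real.mul_rpow (by positivity) hR.le]
        refine mul_le_mul ?_ (Real.rpow_le_rpow hR.le hRN hε.le) (by positivity) (by positivity)
        rw [← Real.rpow_natCast, ← Real.rpow_natCast, ← Real.rpow_mul (by norm_num),
          ← Real.rpow_mul (by norm_num)]
        refine Real.rpow_le_rpow_of_exponent_ge (by norm_num) (by norm_num) ?_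
        push_cast
        nlinarith
    _ = (∑ j ∈ Finset.range n, ((1 / 2 : ℝ) ^ ε) ^ j) * N ^ ε := by rw [Finset.sum_mul]
    _ ≤ _ := by
        gcongr
        rw [geom_sum_eq hq1.ne, ← neg_sub, ← neg_sub 1 ((1 / 2 : ℝ) ^ ε), neg_div_neg_eq,
          div_eq_mul_inv]
        refine mul_le_of_le_one_left (inv_nonneg.2 (by linarith)) ?_
        have : 0 ≤ ((1 / 2 : ℝ) ^ ε) ^ n := by positivity
        linarith

lemma exists_low_bounds {A ε : ℝ} (hA : 1 ≤ A) (hε : 0 < ε) (hε1 : ε ≤ 1) : ∃ C : ℝ, 1 ≤ C ∧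
    ∀ (s N : ℝ) (μ : ℝ → ℝ) (h : Weight s N A μ), (∀ r, μ r = 1) → ∀ R, 0 < R → R ≤ N →
      MultBd (chi R * h.ampInv) (C * N ^ ε) ∧ MultLip (chi R * h.ampInv) (C * N ^ ε) := by
  obtain ⟨C₁, hC₁1, hC₁⟩ := exists_annulus_bounds hA
  obtain ⟨C₂, hC₂1, hC₂⟩ := exists_chi_bounds
  set K : ℝ := (1 - (1 / 2 : ℝ) ^ ε)⁻¹ with hK
  have hK0 : 0 ≤ K := inv_nonneg.2 (sub_nonneg.2
    (Real.rpow_lt_one (by norm_num) (by norm_num) hε).le)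
  have hCK : 0 ≤ C₂ * C₁ * K := by positivity
  refine ⟨4 * C₂ * C₁ * K + C₂, by linarith, fun s N μ h hμ R hR hRN => ?_⟩
  have hN : 1 ≤ N := h.one_le
  have hNε : 1 ≤ N ^ ε := Real.one_le_rpow hN hε.le
  set lam : ℕ → ℝ := fun j => (1 / 2) ^ (j + 1) * R with hlam
  have hlam0 : ∀ j, 0 < lam j := fun j => by positivity
  have hS := fun n => sum_half_le hε hε1 hR hRN n
  have hS0 : ∀ j, 0 ≤ lam j / (1 + lam j) := fun j => by have := hlam0 j; positivity
  constructor
  · have hb : MultBd (chi R * (1 - h.ampInv)) (C₁ * (K * N ^ ε)) := by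
      refine MultBd.of_tendsto
        (b := fun n => ∑ j ∈ Finset.range n, psi (lam j) * (1 - h.ampInv))
        (fun n => ((MultBd.sum n fun j _ => (hC₁ s N μ h (lam j) (hlam0 j)).2.2 hμ)).mono ?_)
        (2 * 2) (fun n ξ => ?_) (fun ξ => ?_)
      · rw [← Finset.mul_sum]
        exact mul_le_mul_of_nonneg_left (hS n) (by linarith)
      · rw [← Finset.sum_mul, sum_psi]
        change ‖((chi R).1 ξ - (chi ((1 / 2) ^ n * R)).1 ξ) * (1 - h.ampInv.1 ξ)‖ ≤ _
        rw [norm_mul]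
        have e1 := norm_sub_le ((chi R).1 ξ) ((chi ((1 / 2) ^ n * R)).1 ξ)
        have e2 := norm_sub_le (1 : ℂ) (h.ampInv.1 ξ)
        have e3 := norm_chi_le R ξ
        have e4 := norm_chi_le ((1 / 2) ^ n * R) ξ
        have e5 := norm_ampInv_le h ξ
        rw [norm_one] at e2
        exact mul_le_mul (by linarith) (by linarith) (norm_nonneg _) (by norm_num)
      · have e : ∀ n, (∑ j ∈ Finset.range n, psi (lam j) * (1 - h.ampInv)).1 ξ
            = ((chi R).1 ξ - (chi ((1 / 2) ^ n * R)).1 ξ) * (1 - h.ampInv.1 ξ) := fun n => by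
          rw [← Finset.sum_mul, sum_psi]
          rfl
        simp only [e]
        change Filter.Tendsto _ _ (nhds ((chi R).1 ξ * (1 - h.ampInv.1 ξ)))
        by_cases h0 : ξ = 0
        · have : h.ampInv.1 ξ = 1 := by
            rw [h.ampInv_apply, hμ, h0]
            simp
          simp [this]
        · simpa using ((tendsto_chi_zero hR h0).const_sub ((chi R).1 ξ)).mul_const
            (1 - h.ampInv.1 ξ)
    have e : chi R * h.ampInv = chi R - chi R * (1 - h.ampInv) := by ring
    rw [e]
    refine ((hC₂ R hR).1.sub hb).mono ?_
    have : 0 ≤ C₁ * (K * N ^ ε) := by positivity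
    have h1 : C₁ * (K * N ^ ε) ≤ 4 * C₂ * (C₁ * (K * N ^ ε)) := by nlinarith
    nlinarith
  · obtain ⟨n0, hn0⟩ := exists_pow_lt_of_lt_one (show 0 < 1 / R by positivity)
      (show (1 / 2 : ℝ) < 1 by norm_num)
    have hn0' : ∀ n, (1 / 2) ^ (n + n0) * R ≤ 1 := fun n => by
      have : (1 / 2 : ℝ) ^ (n + n0) ≤ (1 / 2) ^ n0 :=
        pow_le_pow_of_le_one (by norm_num) (by norm_num) (by omega)
      rw [← le_div_iff₀ hR]
      exact this.trans hn0.le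
    have hpsi : ∀ j, MultLip (psi (lam j) * h.ampInv)
        (4 * C₂ * C₁ * (lam j / (1 + lam j))) := fun j => by
      have l0 := hlam0 j
      have e1 := (hC₂ (4 * lam j) (by positivity)).2
      have e2 := (hC₁ s N μ h (lam j) l0).1
      rw [hμ, mul_one] at e2
      have e3 := e1.mul e2
      rw [← mul_assoc, chi_mul_psi l0] at e3
      refine e3.mono (le_of_eq ?_)
      ring
    have e : ∀ n ξ, (∑ j ∈ Finset.range (n + n0), psi (lam j) * h.ampInv
          + chi ((1 / 2) ^ (n + n0) * R)).1 ξ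
        = ((chi R).1 ξ - (chi ((1 / 2) ^ (n + n0) * R)).1 ξ) * h.ampInv.1 ξ
          + (chi ((1 / 2) ^ (n + n0) * R)).1 ξ := fun n ξ => by
      rw [← Finset.sum_mul, sum_psi]
      rfl
    refine MultLip.of_tendsto
      (b := fun n => ∑ j ∈ Finset.range (n + n0), psi (lam j) * h.ampInv
        + chi ((1 / 2) ^ (n + n0) * R))
      (fun n => ?_) 3 (fun n ξ => ?_) (fun ξ => ?_)
    · have l1 := MultLip.sum (n + n0) fun j _ => hpsi j
      have l2 := (hC₂ ((1 / 2) ^ (n + n0) * R) (by positivity)).2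
      have l3 : MultLip (-chi ((1 / 2) ^ (n + n0) * R)) (C₂ * ((1 / 2) ^ (n + n0) * R)) := by
        have : MultLip (0 : Symb) 0 := ⟨le_rfl, fun y => by
          rw [mul_zero, zero_mul]
          exact MultBd.zero⟩
        have := this.sub l2
        rwa [zero_sub, zero_add] at this
      have l4 := l1.sub l3
      rw [sub_neg_eq_add, ← Finset.mul_sum] at l4
      refine l4.mono ?_
      have b1 := mul_le_mul_of_nonneg_left (hS (n + n0)) (by positivity : 0 ≤ 4 * C₂ * C₁)
      have b2 := mul_le_mul_of_nonneg_left (hn0' n) (by linarith : 0 ≤ C₂)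
      have b3 : C₂ * 1 ≤ C₂ * N ^ ε := by gcongr
      calc _ ≤ 4 * C₂ * C₁ * (K * N ^ ε) + C₂ * N ^ ε := add_le_add b1 (b2.trans b3)
        _ = _ := by ring
    · rw [e]
      have e1 := norm_sub_le ((chi R).1 ξ) ((chi ((1 / 2) ^ (n + n0) * R)).1 ξ)
      have e3 := norm_chi_le R ξ
      have e4 := norm_chi_le ((1 / 2) ^ (n + n0) * R) ξ
      have e5 := norm_ampInv_le h ξ
      refine (norm_add_le _ _).trans ?_
      rw [norm_mul]
      have := mul_le_mul (e1.trans (add_le_add e3 e4)) e5 (norm_nonneg _) (by norm_num)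
      linarith
    · simp only [e]
      change Filter.Tendsto _ _ (nhds ((chi R).1 ξ * h.ampInv.1 ξ))
      by_cases h0 : ξ = 0
      · have e1 : h.ampInv.1 ξ = 1 := by
          rw [h.ampInv_apply, hμ, h0]
          simp
        simp [e1]
      · have := (Filter.tendsto_add_atTop_iff_nat n0).2 (tendsto_chi_zero hR h0)
        simpa using ((this.const_sub ((chi R).1 ξ)).mul_const (h.ampInv.1 ξ)).add this

end SymbolBounds

end Spec

namespace Spec

section DyadicBounds

variable {s N A : ℝ} {μ : ℝ → ℝ}

/-- The dyadic frequency scales, starting at a fraction of `N`. -/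
def scale (N : ℝ) (k : ℕ) : ℝ := 2 ^ k * (N / 64)

lemma scale_pos (hN : 0 < N) (k : ℕ) : 0 < scale N k := by
  unfold scale
  positivity

lemma scale_succ (N : ℝ) (k : ℕ) : scale N (k + 1) = 2 * scale N k := by
  unfold scale
  ring

lemma scale_add (N : ℝ) (k m : ℕ) : scale N (k + m) = 2 ^ m * scale N k := by
  unfold scale
  ring

lemma scale_mono (hN : 0 < N) : Monotone (scale N) := fun k m h =>
  mul_le_mul_of_nonneg_right (pow_le_pow_right₀ (by norm_num) h) (by positivity)

/-- The size of `(1 + |ξ|) μ(|ξ|)` at the dyadic scales. -/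
def Weight.size (_ : Weight s N A μ) (k : ℕ) : ℝ := (1 + scale N k) * μ (scale N k)

lemma Weight.size_pos (h : Weight s N A μ) (k : ℕ) : 0 < h.size k :=
  h.amp_pos (scale_pos (by linarith [h.one_le]) k).le

/-- The multiplier bounds at the dyadic scales, with a logarithmic-type loss `E` at low
frequencies. -/
structure SymbBds (h : Weight s N A μ) (E C : ℝ) : Prop where
  one_le_C : 1 ≤ C
  one_le_E : 1 ≤ E
  psi_inv : ∀ k, MultBd (psi (scale N k) * h.ampInv) (C / h.size k)
  ker : ∀ k, KerBd (fat (scale N k) * h.amp) (C * h.size k) (C * h.size k / scale N k)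
  chi_inv : ∀ k, MultBd (chi (scale N k) * h.ampInv) (C * E)
  chi_lip : ∀ k, MultLip (chi (scale N k) * h.ampInv) (C * E * scale N k)
  chi_lip_zero : MultLip (chi (scale N 0) * h.ampInv) (C * E)
  psi_lip : ∀ k, MultLip (psi (scale N k) * h.ampInv) (C * (scale N k / h.size k))
  chi_bd : ∀ k, MultBd (chi (scale N k)) C
  sum_le : ∀ n, ∑ k ∈ Finset.range n, (h.size k)⁻¹ ≤ C / N
  amp_le : ∀ k r, 0 ≤ r → r ≤ 2 ^ 8 * scale N k → (1 + r) * μ r ≤ C * h.size k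

lemma Weight.sum_inv_size_le (h : Weight s N A μ) (hs0 : 0 < s) (hs1 : s < 1) (n : ℕ) :
    ∑ k ∈ Finset.range n, (h.size k)⁻¹ ≤ 128 * (1 - (1 / 2 : ℝ) ^ s)⁻¹ / N := by
  have hN := h.one_le
  have hq1 : (1 / 2 : ℝ) ^ s < 1 := Real.rpow_lt_one (by norm_num) (by norm_num) hs0
  have key : ∀ k, (h.size k)⁻¹ ≤ 128 / N * ((1 / 2 : ℝ) ^ s) ^ k := fun k => by
    have hr0 := scale_pos (by linarith : 0 < N) k
    have hpow : ((2 : ℝ) ^ s) ^ k ≤ 2 ^ k :=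
      pow_le_pow_left₀ (by positivity)
        (by simpa using Real.rpow_le_rpow_of_exponent_le (x := 2) (by norm_num) hs1.le) k
    have h2s : 1 ≤ (2 : ℝ) ^ s := Real.one_le_rpow (by norm_num) hs0.le
    have hlow : N * ((2 : ℝ) ^ s) ^ k / 128 ≤ h.size k := by
      rcases le_total (scale N k) N with hle | hle
      · have e1 : h.size k = 1 + scale N k := by
          unfold size
          rw [h.eq_one _ hle, mul_one]
        rw [e1, scale]
        have := mul_le_mul_of_nonneg_left hpow (by linarith : 0 ≤ N)
        have : 0 < 2 ^ k * N := by positivity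
        linarith
      · have hg := h.growth _ hle
        have hk : (N : ℝ) ^ (1 - s) * scale N k ^ s
            = N * ((2 : ℝ) ^ s) ^ k * ((1 / 64 : ℝ) ^ s) := by
          have e0 : scale N k = 2 ^ k * N * (1 / 64) := by unfold scale; ring
          rw [e0, Real.mul_rpow (by positivity) (by norm_num), Real.mul_rpow (by positivity)
            (by linarith), ← Real.rpow_natCast_mul (by norm_num), mul_comm (k : ℝ) s,
            Real.rpow_mul_natCast (by norm_num)]
          have e1 : N ^ (1 - s) * N ^ s = N := by
            rw [← Real.rpow_add (by linarith)]
            simp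
          calc _ = (N ^ (1 - s) * N ^ s) * ((2 : ℝ) ^ s) ^ k * (1 / 64 : ℝ) ^ s := by ring
            _ = _ := by rw [e1]
        have h64 : (1 / 64 : ℝ) ≤ (1 / 64 : ℝ) ^ s := by
          simpa using Real.rpow_le_rpow_of_exponent_ge (x := 1 / 64) (by norm_num) (by norm_num)
            hs1.le
        rw [hk] at hg
        have e3 : scale N k * μ (scale N k) ≤ h.size k := by
          unfold size
          nlinarith [h.pos (scale N k)]
        have e4 : N * ((2 : ℝ) ^ s) ^ k * (1 / 64) ≤ N * ((2 : ℝ) ^ s) ^ k * (1 / 64 : ℝ) ^ s := by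
          gcongr
        linarith
    calc (h.size k)⁻¹ ≤ (N * ((2 : ℝ) ^ s) ^ k / 128)⁻¹ := inv_anti₀ (by positivity) hlow
      _ = _ := by
        rw [one_div, Real.inv_rpow (by norm_num), inv_pow]
        field_simp
  calc _ ≤ ∑ k ∈ Finset.range n, 128 / N * ((1 / 2 : ℝ) ^ s) ^ k :=
        Finset.sum_le_sum fun k _ => key k
    _ = 128 / N * ∑ k ∈ Finset.range n, ((1 / 2 : ℝ) ^ s) ^ k := by rw [Finset.mul_sum]
    _ ≤ 128 / N * (1 - (1 / 2 : ℝ) ^ s)⁻¹ := by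
        gcongr
        rw [geom_sum_eq hq1.ne, ← neg_sub, ← neg_sub 1 ((1 / 2 : ℝ) ^ s), neg_div_neg_eq,
          div_eq_mul_inv]
        refine mul_le_of_le_one_left (inv_nonneg.2 (by linarith)) ?_
        have : 0 ≤ ((1 / 2 : ℝ) ^ s) ^ n := by positivity
        linarith
    _ = _ := by ring

lemma Weight.amp_le_size (h : Weight s N A μ) (k : ℕ) {r : ℝ} (hr0 : 0 ≤ r)
    (hr : r ≤ 2 ^ 8 * scale N k) : (1 + r) * μ r ≤ 2 ^ 8 * h.size k := by
  have hs := scale_pos (by linarith [h.one_le] : 0 < N) k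
  have hw : 1 ≤ h.size k := h.one_le_amp hs.le
  rcases le_total r (scale N k) with hle | hle
  · rcases hr0.eq_or_lt with rfl | hr1
    · have := h.le_one 0
      linarith
    · have e1 := h.mono_mul (Set.mem_Ioi.2 hr1) (Set.mem_Ioi.2 hs) hle
      have e2 : scale N k * μ (scale N k) ≤ h.size k := by
        unfold size
        nlinarith [h.pos (scale N k)]
      have e3 := h.le_one r
      simp only at e1
      linarith
  · have e1 := h.anti (Set.mem_Ioi.2 hs) (Set.mem_Ioi.2 (hs.trans_le hle)) hle
    calc (1 + r) * μ r ≤ (2 ^ 8 * (1 + scale N k)) * μ (scale N k) :=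
          mul_le_mul (by linarith) e1 (h.pos _).le (by positivity)
      _ = _ := by rw [size, mul_assoc]

lemma exists_symbBds {s A ε : ℝ} (hs0 : 0 < s) (hs1 : s < 1) (hA : 1 ≤ A) (hε : 0 < ε)
    (hε1 : ε ≤ 1) : ∃ C : ℝ, ∀ (N : ℝ) (μ : ℝ → ℝ) (h : Weight s N A μ),
      SymbBds h (N ^ ε) C := by
  obtain ⟨C₁, hC₁1, hC₁⟩ := exists_annulus_bounds hA
  obtain ⟨C₂, hC₂1, hC₂⟩ := exists_chi_bounds
  obtain ⟨C₃, hC₃1, hC₃⟩ := exists_low_bounds hA hε hε1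
  set K : ℝ := 128 * (1 - (1 / 2 : ℝ) ^ s)⁻¹ with hK
  have hq1 : (1 / 2 : ℝ) ^ s < 1 := Real.rpow_lt_one (by norm_num) (by norm_num) hs0
  have hK0 : 0 ≤ K := mul_nonneg (by norm_num) (inv_nonneg.2 (by linarith))
  set D : ℝ := C₃ + C₁ * K with hD
  have hD1 : 1 ≤ D := by nlinarith
  set C : ℝ := 2 ^ 8 + C₁ * 1 + 4 * C₂ * C₁ + 2 * C₂ * D + K + C₂ + C₃ + D with hC
  have p1 : 0 < C₂ * C₁ := by positivity
  have p2 : 0 < C₂ * D := by positivity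
  refine ⟨C, fun N μ h => ?_⟩
  have hN := h.one_le
  have hN0 : 0 < N := by linarith
  have hE : 1 ≤ N ^ ε := Real.one_le_rpow hN hε.le
  have hr := scale_pos hN0
  have hw := h.size_pos
  have hpsi : ∀ k, MultBd (psi (scale N k) * h.ampInv) (C₁ / h.size k) := fun k =>
    (hC₁ s N μ h _ (hr k)).1
  have h1 : Weight s N A fun _ => 1 := Weight.one hs1.le hN hA
  have hlow := hC₃ s N _ h1 (fun _ => rfl) (scale N 0) (hr 0) (by
    unfold scale
    linarith)
  have hcong : chi (scale N 0) * h1.ampInv = chi (scale N 0) * h.ampInv :=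
    Subtype.ext (funext fun ξ => by
      change (chi (scale N 0)).1 ξ * h1.ampInv.1 ξ = (chi (scale N 0)).1 ξ * h.ampInv.1 ξ
      by_cases hξ : ‖ξ‖ ≤ N
      · rw [h1.ampInv_apply, h.ampInv_apply, h.eq_one _ hξ]
      · rw [chi_eq_zero (hr 0) (by unfold scale; linarith), zero_mul, zero_mul])
  rw [hcong] at hlow
  have hchi : ∀ k, MultBd (chi (scale N k) * h.ampInv) (D * N ^ ε) := fun k => by
    have e : chi (scale N k) = chi (scale N 0) + ∑ i ∈ Finset.range k, psi (scale N i) := by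
      induction k with
      | zero => simp
      | succ k ih =>
        rw [Finset.sum_range_succ, ← add_assoc, ← ih, psi, scale_succ]
        abel
    rw [e, add_mul, Finset.sum_mul]
    refine (hlow.1.add (MultBd.sum k fun i _ => hpsi i)).mono ?_
    have e1 : ∑ i ∈ Finset.range k, C₁ / h.size i ≤ C₁ * (K * N ^ ε) := by
      simp only [div_eq_mul_inv]
      rw [← Finset.mul_sum]
      refine mul_le_mul_of_nonneg_left ((h.sum_inv_size_le hs0 hs1 k).trans ?_) (by linarith)
      rw [← hK]
      exact (div_le_self hK0 hN).trans (le_mul_of_one_le_right hK0 hE)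
    rw [hD]
    linarith
  refine ⟨by linarith, hE, fun k => (hpsi k).mono ?_, fun k => ?_, fun k => (hchi k).mono ?_,
    fun k => ?_, hlow.2.mono ?_, fun k => ?_, fun k => (hC₂ _ (hr k)).1.mono (by linarith),
    fun n => (h.sum_inv_size_le hs0 hs1 n).trans ?_, fun k r hr0 hrk =>
    (h.amp_le_size k hr0 hrk).trans ?_⟩
  · have := hw k
    gcongr
    linarith
  · obtain ⟨κ, a1, a2, a3, a4⟩ := (hC₁ s N μ h _ (hr k)).2.1
    have := hw k
    have := hr k
    have e : C₁ * h.size k ≤ C * h.size k := by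
      gcongr
      linarith
    exact ⟨κ, a1, a2, a3.trans e, a4.trans (div_le_div_of_nonneg_right e (hr k).le)⟩
  · gcongr
    linarith
  · have e1 := (hC₂ _ (hr (k + 1))).2.mul (hchi k)
    rw [← mul_assoc, chi_mul_chi (hr k) (scale_succ N k).ge] at e1
    refine e1.mono ?_
    rw [scale_succ]
    have := hr k
    calc C₂ * (2 * scale N k) * (D * N ^ ε) = 2 * C₂ * D * N ^ ε * scale N k := by ring
      _ ≤ _ := by
        gcongr
        linarith
  · gcongr
    linarith
  · have e1 := (hC₂ (4 * scale N k) (by have := hr k; positivity)).2.mul (hpsi k)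
    rw [← mul_assoc, chi_mul_psi (hr k)] at e1
    refine e1.mono ?_
    have := hr k
    have := hw k
    calc C₂ * (4 * scale N k) * (C₁ / h.size k) = 4 * C₂ * C₁ * (scale N k / h.size k) := by ring
      _ ≤ _ := by
        gcongr
        linarith
  · rw [← hK]
    gcongr
    linarith
  · have := hw k
    gcongr
    linarith

end DyadicBounds

end Spec

namespace Spec

section Blocks

/-- The frequency support of `F` lies in the ball of radius `R`. -/
def SuppLe (F : Spec) (R : ℝ) : Prop := ∀ ξ, F.1 ξ ≠ 0 → ‖ξ‖ ≤ R

lemma SuppLe.mono {F : Spec} {R R' : ℝ} (h : SuppLe F R) (hR : R ≤ R') : SuppLe F R' :=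
  fun ξ hξ => (h ξ hξ).trans hR

lemma SuppLe.add {F G : Spec} {R : ℝ} (hF : SuppLe F R) (hG : SuppLe G R) : SuppLe (F + G) R :=
  fun ξ hξ => by
    by_contra hc
    have h1 : F.1 ξ = 0 := by_contra fun h => hc (hF ξ h)
    have h2 : G.1 ξ = 0 := by_contra fun h => hc (hG ξ h)
    exact hξ (by change F.1 ξ + G.1 ξ = 0; rw [h1, h2, add_zero])

lemma SuppLe.sub {F G : Spec} {R : ℝ} (hF : SuppLe F R) (hG : SuppLe G R) : SuppLe (F - G) R :=
  fun ξ hξ => by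
    by_contra hc
    have h1 : F.1 ξ = 0 := by_contra fun h => hc (hF ξ h)
    have h2 : G.1 ξ = 0 := by_contra fun h => hc (hG ξ h)
    exact hξ (by change F.1 ξ - G.1 ξ = 0; rw [h1, h2, sub_zero])

lemma SuppLe.mul {F G : Spec} {R S : ℝ} (hF : SuppLe F R) (hG : SuppLe G S) :
    SuppLe (F * G) (R + S) := fun ξ hξ => by
  obtain ⟨η, h1, h2⟩ := exists_of_mul_apply_ne_zero hξ
  have := norm_add_le η (ξ - η)
  rw [add_sub_cancel] at this
  exact this.trans (add_le_add (hF _ h1) (hG _ h2))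

lemma mult_congr {b c : Symb} {F : Spec} (h : ∀ ξ, F.1 ξ ≠ 0 → b.1 ξ = c.1 ξ) :
    mult b F = mult c F :=
  Subtype.ext (funext fun ξ => by
    rw [mult_apply, mult_apply]
    by_cases h0 : F.1 ξ = 0
    · rw [h0, mul_zero, mul_zero]
    · rw [h ξ h0])

/-- The projection to frequencies below the `k`-th dyadic scale. -/
def low (N : ℝ) (k : ℕ) (F : Spec) : Spec := mult (chi (scale N k)) F

/-- The projection to frequencies comparable to the `k`-th dyadic scale. -/
def blk (N : ℝ) (k : ℕ) (F : Spec) : Spec := mult (psi (scale N k)) F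

lemma blk_eq (N : ℝ) (k : ℕ) (F : Spec) : blk N k F = low N (k + 1) F - low N k F := by
  rw [blk, psi, sub_mult, low, low, scale_succ]

lemma mult_low (b : Symb) (N : ℝ) (k : ℕ) (F : Spec) : mult b (low N k F) = low N k (mult b F) := by
  rw [low, low, mult_mult, mult_mult, mul_comm]

variable {s N A : ℝ} {μ : ℝ → ℝ}

lemma suppLe_low (hN : 0 < N) (k : ℕ) (F : Spec) : SuppLe (low N k F) (2 * scale N k) :=
  fun ξ hξ => by
    by_contra! hc
    refine hξ ?_
    rw [low, mult_apply, chi_eq_zero (scale_pos hN k) hc.le, zero_mul]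

lemma suppLe_blk (hN : 0 < N) (k : ℕ) (F : Spec) : SuppLe (blk N k F) (4 * scale N k) :=
  fun ξ hξ => by
    by_contra! hc
    refine hξ ?_
    rw [blk, mult_apply, psi_eq_zero (scale_pos hN k) (Or.inr hc.le), zero_mul]

lemma scale_le_of_blk_ne_zero (hN : 0 < N) {k : ℕ} {F : Spec} {ξ : Plane}
    (hξ : (blk N k F).1 ξ ≠ 0) : scale N k ≤ ‖ξ‖ := by
  by_contra! hc
  refine hξ ?_
  rw [blk, mult_apply, psi_eq_zero (scale_pos hN k) (Or.inl hc.le), zero_mul]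

lemma Weight.mult_ampInv_mult_amp (h : Weight s N A μ) (F : Spec) :
    mult h.ampInv (mult h.amp F) = F := by
  rw [mult_mult, h.ampInv_mul_amp, one_mult]

lemma low_eq (h : Weight s N A μ) (k : ℕ) (F : Spec) :
    low N k F = mult (chi (scale N k) * h.ampInv) (mult h.amp F) := by
  rw [← mult_mult, h.mult_ampInv_mult_amp, low]

lemma blk_eq_mult (h : Weight s N A μ) (k : ℕ) (F : Spec) :
    blk N k F = mult (psi (scale N k) * h.ampInv) (mult h.amp F) := by
  rw [← mult_mult, h.mult_ampInv_mult_amp, blk]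

variable {h : Weight s N A μ} {E C V : ℝ} {F G : Spec}

lemma SymbBds.nrm_low_le (hb : SymbBds h E C) (k : ℕ) (hF : nrm 6 (mult h.amp F) ≤ V) :
    nrm 6 (low N k F) ≤ C * E * V := by
  rw [low_eq h]
  exact ((hb.chi_inv k).2 _).trans (mul_le_mul_of_nonneg_left hF (hb.chi_inv k).1)

lemma SymbBds.lip_low (hb : SymbBds h E C) (k : ℕ) (hF : nrm 6 (mult h.amp F) ≤ V) :
    Lip 6 (low N k F) (C * E * scale N k * V) := by
  rw [low_eq h]
  exact ((hb.chi_lip k).lip _).mono (mul_le_mul_of_nonneg_left hF (hb.chi_lip k).1)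

lemma SymbBds.lip_low_zero (hb : SymbBds h E C) (hF : nrm 6 (mult h.amp F) ≤ V) :
    Lip 6 (low N 0 F) (C * E * V) := by
  rw [low_eq h]
  exact (hb.chi_lip_zero.lip _).mono (mul_le_mul_of_nonneg_left hF hb.chi_lip_zero.1)

lemma SymbBds.nrm_blk_le (hb : SymbBds h E C) (k : ℕ) (hF : nrm 6 (mult h.amp F) ≤ V) :
    nrm 6 (blk N k F) ≤ C / h.size k * V := by
  rw [blk_eq_mult h]
  exact ((hb.psi_inv k).2 _).trans (mul_le_mul_of_nonneg_left hF (hb.psi_inv k).1)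

lemma SymbBds.lip_blk (hb : SymbBds h E C) (k : ℕ) (hF : nrm 6 (mult h.amp F) ≤ V) :
    Lip 6 (blk N k F) (C * (scale N k / h.size k) * V) := by
  rw [blk_eq_mult h]
  exact ((hb.psi_lip k).lip _).mono (mul_le_mul_of_nonneg_left hF (hb.psi_lip k).1)

lemma SymbBds.nrm_mult_amp_le (hb : SymbBds h E C) {k : ℕ} {X : Spec}
    (hX : SuppLe X (2 ^ 8 * scale N k)) : nrm 2 (mult h.amp X) ≤ C * h.size k * nrm 2 X := by
  have hw := h.size_pos k
  have hC := hb.one_le_C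
  refine nrm_two_mult_le (by positivity) fun ξ hξ => ?_
  rw [h.amp_apply, Complex.norm_real, Real.norm_of_nonneg (h.amp_pos (norm_nonneg ξ)).le]
  exact hb.amp_le k _ (norm_nonneg ξ) (hX ξ hξ)

lemma nrm_two_mul_mul_le (F G H : Spec) :
    nrm 2 (F * G * H) ≤ nrm 6 F * nrm 6 G * nrm 6 H :=
  (nrm_mul_le 3 6 2 _ _).trans (mul_le_mul_of_nonneg_right (nrm_mul_le 6 6 3 _ _) (nrm_nonneg _ _))

/-- The commutator of the multiplier `b` with multiplication by `G`. -/
def comm (b : Symb) (G H : Spec) : Spec := mult b (G * H) - G * mult b H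

lemma comm_add (b : Symb) (G H K : Spec) : comm b G (H + K) = comm b G H + comm b G K := by
  refine ext_phys fun x => ?_
  have : G * (H + K) = G * H + G * K := ext_phys fun x => by
    simp only [phys_mul, phys_add]
    ring
  simp only [comm, this, mult_add, phys_add, phys_sub, phys_mul]
  ring

lemma SymbBds.nrm_comm_blk_le (hb : SymbBds h E C) {i k : ℕ} (hik : i ≤ k) {L : ℝ} (hL0 : 0 ≤ L)
    (hG : SuppLe G (scale N i / 2)) (hL : Lip 3 G L) (hF : nrm 6 (mult h.amp F) ≤ V) :
    nrm 2 (comm h.amp G (blk N k F)) ≤ C ^ 2 * L * V / scale N k := by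
  have hN : 0 < N := by linarith [h.one_le]
  have hr := scale_pos hN k
  have hw := h.size_pos k
  have hC := hb.one_le_C
  have hle := scale_mono hN hik
  have e1 : mult h.amp (G * blk N k F) = mult (fat (scale N k) * h.amp) (G * blk N k F) :=
    mult_congr fun ξ hξ => by
      change _ = (fat (scale N k)).1 ξ * h.amp.1 ξ
      obtain ⟨η, h1, h2⟩ := exists_of_mul_apply_ne_zero hξ
      have a1 := hG _ h1
      have a2 := suppLe_blk hN k F _ h2
      have a3 := scale_le_of_blk_ne_zero hN h2
      have a4 := norm_add_le η (ξ - η)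
      have a5 := norm_sub_le ξ η
      rw [add_sub_cancel] at a4
      rw [fat_eq_one hr (by linarith) (by linarith), one_mul]
  have e2 : mult h.amp (blk N k F) = mult (fat (scale N k) * h.amp) (blk N k F) :=
    mult_congr fun ξ hξ => by
      change _ = (fat (scale N k)).1 ξ * h.amp.1 ξ
      have a2 := suppLe_blk hN k F _ hξ
      have a3 := scale_le_of_blk_ne_zero hN hξ
      rw [fat_eq_one hr (by linarith) (by linarith), one_mul]
  rw [comm, e1, e2]
  refine ((hb.ker k).nrm_commutator_le hL0 hL _).trans ?_
  calc C * h.size k / scale N k * (L * nrm 6 (blk N k F))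
      ≤ C * h.size k / scale N k * (L * (C / h.size k * V)) := by
        gcongr
        exact hb.nrm_blk_le k hF
    _ = _ := by
        field_simp

lemma SymbBds.nrm_comm_le (hb : SymbBds h E C) (i n : ℕ) {L : ℝ} (hL0 : 0 ≤ L)
    (hG : SuppLe G (scale N i / 2)) (hL : Lip 3 G L) (hF : nrm 6 (mult h.amp F) ≤ V) :
    nrm 2 (comm h.amp G (low N (i + n) F - low N i F)) ≤ 2 * C ^ 2 * L * V / scale N i := by
  have hN : 0 < N := by linarith [h.one_le]
  have hr := scale_pos hN i
  have hC := hb.one_le_C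
  have hV : 0 ≤ V := (nrm_nonneg _ _).trans hF
  have key : nrm 2 (comm h.amp G (low N (i + n) F - low N i F))
      ≤ C ^ 2 * L * V / scale N i * (2 - 2 * (1 / 2) ^ n) := by
    induction n with
    | zero =>
      have : comm h.amp G (low N (i + 0) F - low N i F) = 0 := by
        rw [add_zero, sub_self]
        refine ext_phys fun x => ?_
        have e1 : ∀ b : Symb, mult b 0 = 0 := fun b => Subtype.ext (funext fun ξ => mul_zero _)
        have e2 : phys 0 x = 0 := by simp [phys_eq]
        have e3 : G * 0 = 0 := ext_phys fun x => by
          have e2 : phys 0 x = 0 := by simp [phys_eq]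
          rw [phys_mul, e2, mul_zero]
        rw [comm, e1, e3, e1, sub_zero]
      rw [this, nrm_zero]
      simp
    | succ n ih =>
      have e : low N (i + (n + 1)) F - low N i F
          = (low N (i + n) F - low N i F) + blk N (i + n) F := by
        rw [blk_eq, ← add_assoc]
        abel
      rw [e, comm_add]
      refine (nrm_add_le _ _ _).trans ((add_le_add ih
        (hb.nrm_comm_blk_le (Nat.le_add_right i n) hL0 hG hL hF)).trans (le_of_eq ?_))
      rw [scale_add, one_div_pow, one_div_pow]
      field_simp
      ring
  refine key.trans ?_
  have : (0 : ℝ) ≤ (1 / 2) ^ n := by positivity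
  calc _ ≤ C ^ 2 * L * V / scale N i * 2 := by
        gcongr
        linarith
    _ = _ := by ring

end Blocks

end Spec

namespace Spec

section Step

variable {s N A : ℝ} {μ : ℝ → ℝ} {h : Weight s N A μ} {E C V : ℝ}

lemma SymbBds.size_le (hb : SymbBds h E C) {i j : ℕ} (hij : i ≤ j) : h.size i ≤ C * h.size j := by
  have hN : 0 < N := by linarith [h.one_le]
  have := scale_pos hN j
  exact hb.amp_le j _ (scale_pos hN i).le ((scale_mono hN hij).trans (by linarith))

lemma SymbBds.nrm_blk_le_of_le (hb : SymbBds h E C) {F : Spec} {i j : ℕ} (hij : i ≤ j)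
    (hF : nrm 6 (mult h.amp F) ≤ V) : nrm 6 (blk N j F) ≤ C ^ 2 * V / h.size i := by
  have hC := hb.one_le_C
  have hV : 0 ≤ V := (nrm_nonneg _ _).trans hF
  have h1 := h.size_pos i
  have h2 := h.size_pos j
  refine (hb.nrm_blk_le j hF).trans ?_
  rw [div_mul_eq_mul_div, div_le_div_iff₀ h2 h1]
  calc C * V * h.size i ≤ C * V * (C * h.size j) := by
        gcongr
        exact hb.size_le hij
    _ = _ := by ring

lemma SymbBds.nrm_high_mul_le (hb : SymbBds h E C) (i n : ℕ) {F G : Spec} {g : ℝ}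
    (hG : SuppLe G (8 * scale N i)) (hG3 : nrm 3 G ≤ g / h.size i)
    (hGL : Lip 3 G (scale N i * g / h.size i)) (hF : nrm 6 (mult h.amp F) ≤ V)
    (hFn : low N (i + 4 + n) F = F) :
    nrm 2 (mult h.amp ((F - low N (i + 1) F) * G)) ≤ 6 * C ^ 3 * g * V / h.size i := by
  have hN : 0 < N := by linarith [h.one_le]
  have hr := scale_pos hN i
  have hC := hb.one_le_C
  have hV : 0 ≤ V := (nrm_nonneg _ _).trans hF
  have hw := h.size_pos i
  have hg : 0 ≤ g := by
    have := (nrm_nonneg _ _).trans hG3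
    rwa [le_div_iff₀ hw, zero_mul] at this
  set H := low N (i + 4 + n) F - low N (i + 4) F with hH
  set D := blk N (i + 1) F + blk N (i + 2) F + blk N (i + 3) F with hD
  have e0 : F - low N (i + 1) F = H + D := by
    rw [hH, hD, hFn, blk_eq, blk_eq, blk_eq]
    abel
  have e1 : mult h.amp ((F - low N (i + 1) F) * G)
      = comm h.amp G H + G * mult h.amp H + mult h.amp (G * D) := by
    have e2 : (H + D) * G = G * H + G * D := ext_phys fun x => by
      simp only [phys_mul, phys_add]
      ring
    rw [e0, e2, mult_add, comm]
    abel
  have b1 : nrm 2 (comm h.amp G H) ≤ C ^ 3 * g * V / h.size i := by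
    have h16 : scale N (i + 4) = 16 * scale N i := by
      rw [scale_add]
      norm_num
    refine (hb.nrm_comm_le (i + 4) n (by positivity) (by rw [h16]; exact hG.mono (by linarith)) hGL
      hF).trans ?_
    rw [h16]
    calc _ = C ^ 2 * g * V / h.size i * (1 / 8) := by
          field_simp
          ring
      _ ≤ C ^ 2 * g * V / h.size i * C := by
          gcongr
          linarith
      _ = _ := by ring
  have b2 : nrm 2 (G * mult h.amp H) ≤ 2 * C ^ 3 * g * V / h.size i := by
    have e3 : mult h.amp H = low N (i + 4 + n) (mult h.amp F) - low N (i + 4) (mult h.amp F) := by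
      rw [hH, mult_sub, mult_low, mult_low]
    have b3 : nrm 6 (mult h.amp H) ≤ 2 * C * V := by
      rw [e3]
      have a1 := ((hb.chi_bd (i + 4 + n)).2 (mult h.amp F)).trans
        (mul_le_mul_of_nonneg_left hF (by linarith))
      have a2 := ((hb.chi_bd (i + 4)).2 (mult h.amp F)).trans
        (mul_le_mul_of_nonneg_left hF (by linarith))
      refine (nrm_sub_le _ _ _).trans ?_
      rw [low, low]
      linarith
    calc _ ≤ nrm 3 G * nrm 6 (mult h.amp H) := nrm_mul_le 3 6 2 _ _
      _ ≤ g / h.size i * (2 * C * V) := mul_le_mul hG3 b3 (nrm_nonneg _ _) (by positivity)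
      _ = 2 * C * g * V / h.size i := by ring
      _ ≤ _ := by
          gcongr
          exact le_self_pow₀ hC (by norm_num)
  have b4 : nrm 2 (mult h.amp (G * D)) ≤ 3 * C ^ 3 * g * V / h.size i := by
    have s1 : SuppLe D (32 * scale N i) := by
      refine SuppLe.add (SuppLe.add ?_ ?_) ?_
      · refine (suppLe_blk hN _ F).mono ?_
        rw [scale_add]
        linarith
      · refine (suppLe_blk hN _ F).mono ?_
        rw [scale_add]
        linarith
      · refine (suppLe_blk hN _ F).mono ?_
        rw [scale_add]
        linarith
    have b5 : nrm 6 D ≤ 3 * (C ^ 2 * V / h.size i) := by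
      have a1 := hb.nrm_blk_le_of_le (by omega : i ≤ i + 1) hF
      have a2 := hb.nrm_blk_le_of_le (by omega : i ≤ i + 2) hF
      have a3 := hb.nrm_blk_le_of_le (by omega : i ≤ i + 3) hF
      have a4 := nrm_add_le 6 (blk N (i + 1) F + blk N (i + 2) F) (blk N (i + 3) F)
      have a5 := nrm_add_le 6 (blk N (i + 1) F) (blk N (i + 2) F)
      linarith
    refine (hb.nrm_mult_amp_le (k := i) ((hG.mul s1).mono (by linarith))).trans ?_
    calc _ ≤ C * h.size i * (nrm 3 G * nrm 6 D) := by
          gcongr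
          exact nrm_mul_le 3 6 2 _ _
      _ ≤ C * h.size i * (g / h.size i * (3 * (C ^ 2 * V / h.size i))) := by
          exact mul_le_mul_of_nonneg_left (mul_le_mul hG3 b5 (nrm_nonneg _ _) (by positivity))
            (by positivity)
      _ = _ := by
          field_simp
  rw [e1]
  refine (nrm_add_le _ _ _).trans ((add_le_add ((nrm_add_le _ _ _).trans (add_le_add b1 b2))
    b4).trans (le_of_eq ?_))
  ring

/-- The product of a dyadic block and a low-frequency projection, as a multiplier of high
frequencies. -/
lemma SymbBds.nrm_high_mul_blk_low_le (hb : SymbBds h E C) (i n : ℕ)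
    {j : ℕ} (hj : j = i ∨ j = i + 1)
    {F G H : Spec} (hF : nrm 6 (mult h.amp F) ≤ V) (hG : nrm 6 (mult h.amp G) ≤ V)
    (hH : nrm 6 (mult h.amp H) ≤ V) (hFn : low N (i + 4 + n) F = F) :
    nrm 2 (mult h.amp ((F - low N (i + 1) F) * (blk N i G * low N j H)))
      ≤ 18 * C ^ 5 * E * V ^ 3 / h.size i := by
  have hN : 0 < N := by linarith [h.one_le]
  have hr := scale_pos hN i
  have hC := hb.one_le_C
  have hE := hb.one_le_E
  have hV : 0 ≤ V := (nrm_nonneg _ _).trans hF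
  have hw := h.size_pos i
  have hj2 : scale N j ≤ 2 * scale N i := by
    rcases hj with rfl | rfl
    · linarith
    · rw [scale_succ]
  have hB := hb.nrm_blk_le i hG
  have hL := hb.nrm_low_le j hH
  have n3 : nrm 3 (blk N i G * low N j H) ≤ 3 * C ^ 2 * E * V ^ 2 / h.size i := by
    calc _ ≤ nrm 6 (blk N i G) * nrm 6 (low N j H) := nrm_mul_le 6 6 3 _ _
      _ ≤ C / h.size i * V * (C * E * V) := mul_le_mul hB hL (nrm_nonneg _ _) (by positivity)
      _ = C ^ 2 * E * V ^ 2 / h.size i * 1 := by ring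
      _ ≤ C ^ 2 * E * V ^ 2 / h.size i * 3 := by
          gcongr
          norm_num
      _ = _ := by ring
  have l3 : Lip 3 (blk N i G * low N j H) (scale N i * (3 * C ^ 2 * E * V ^ 2) / h.size i) := by
    refine ((hb.lip_blk i hG).mul (hb.lip_low j hH) (by positivity) hB hL).mono ?_
    calc _ = C ^ 2 * E * V ^ 2 / h.size i * (scale N i + scale N j) := by
          field_simp
      _ ≤ C ^ 2 * E * V ^ 2 / h.size i * (3 * scale N i) := by
          gcongr
          linarith
      _ = _ := by ring
  have sp : SuppLe (blk N i G * low N j H) (8 * scale N i) :=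
    ((suppLe_blk hN i G).mul (suppLe_low hN j H)).mono (by linarith)
  refine (hb.nrm_high_mul_le i n sp n3 l3 hF hFn).trans (le_of_eq ?_)
  ring

lemma SymbBds.nrm_blk_blk_mul_le (hb : SymbBds h E C) (i : ℕ) {F G H X : Spec}
    (hF : nrm 6 (mult h.amp F) ≤ V) (hG : nrm 6 (mult h.amp G) ≤ V)
    (hH : nrm 6 H ≤ C * E * V) (hHs : SuppLe H (4 * scale N i))
    (hX : X = blk N i F * blk N i G * H) :
    nrm 2 (mult h.amp X) ≤ C ^ 5 * E * V ^ 3 / h.size i := by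
  have hN : 0 < N := by linarith [h.one_le]
  have hr := scale_pos hN i
  have hC := hb.one_le_C
  have hE := hb.one_le_E
  have hV : 0 ≤ V := (nrm_nonneg _ _).trans hF
  have hw := h.size_pos i
  rw [hX]
  refine (hb.nrm_mult_amp_le (k := i) ((((suppLe_blk hN i F).mul (suppLe_blk hN i G)).mul
    hHs).mono (by linarith))).trans ?_
  calc _ ≤ C * h.size i * (nrm 6 (blk N i F) * nrm 6 (blk N i G) * nrm 6 H) := by
        gcongr
        exact nrm_two_mul_mul_le _ _ _
    _ ≤ C * h.size i * (C / h.size i * V * (C / h.size i * V) * (C * E * V)) := by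
        gcongr ?_ * ?_
        refine mul_le_mul (mul_le_mul (hb.nrm_blk_le i hF) (hb.nrm_blk_le i hG) (nrm_nonneg _ _)
          (by positivity)) hH (nrm_nonneg _ _) (by positivity)
    _ = C ^ 4 * E * V ^ 3 / h.size i := by
        field_simp
    _ ≤ _ := by
        gcongr
        norm_num

/-- The part of the product of three spectra in which the two lowest frequencies lie below the
`i`-th dyadic scale. -/
def lowPart (N : ℝ) (i : ℕ) (F G H : Spec) : Spec :=
  F * low N i G * low N i H + low N i F * G * low N i H + low N i F * low N i G * H
    - low N i F * low N i G * low N i H - low N i F * low N i G * low N i H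

lemma lowPart_eq_of_low_eq {N : ℝ} {i : ℕ} {F G H : Spec} (hF : low N i F = F) (hG : low N i G = G)
    (hH : low N i H = H) : lowPart N i F G H = F * G * H := by
  rw [lowPart, hF, hG, hH]
  abel

lemma lowPart_succ_sub (N : ℝ) (i : ℕ) (F G H : Spec) :
    lowPart N (i + 1) F G H - lowPart N i F G H =
      (F - low N (i + 1) F) * (blk N i G * low N (i + 1) H)
      + (F - low N (i + 1) F) * (blk N i H * low N i G)
      + (G - low N (i + 1) G) * (blk N i F * low N (i + 1) H)
      + (G - low N (i + 1) G) * (blk N i H * low N i F)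
      + (H - low N (i + 1) H) * (blk N i F * low N (i + 1) G)
      + (H - low N (i + 1) H) * (blk N i G * low N i F)
      + blk N i F * blk N i G * low N (i + 1) H
      + blk N i F * low N i G * blk N i H
      + low N i F * blk N i G * blk N i H := by
  refine ext_phys fun x => ?_
  simp only [lowPart, blk_eq, phys_add, phys_sub, phys_mul]
  ring

lemma SymbBds.nrm_lowPart_succ_sub_le (hb : SymbBds h E C) (i n : ℕ) {F G H : Spec}
    (hF : nrm 6 (mult h.amp F) ≤ V) (hG : nrm 6 (mult h.amp G) ≤ V)
    (hH : nrm 6 (mult h.amp H) ≤ V) (hFn : low N (i + 4 + n) F = F)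
    (hGn : low N (i + 4 + n) G = G) (hHn : low N (i + 4 + n) H = H) :
    nrm 2 (mult h.amp (lowPart N (i + 1) F G H - lowPart N i F G H))
      ≤ 111 * C ^ 5 * E * V ^ 3 / h.size i := by
  have hN : 0 < N := by linarith [h.one_le]
  have hr := scale_pos hN i
  have s0 : ∀ X, SuppLe (low N i X) (4 * scale N i) := fun X =>
    (suppLe_low hN i X).mono (by linarith)
  have s1 : ∀ X, SuppLe (low N (i + 1) X) (4 * scale N i) := fun X =>
    (suppLe_low hN (i + 1) X).mono (by rw [scale_succ]; linarith)
  have c1 := hb.nrm_high_mul_blk_low_le i n (Or.inr rfl) hF hG hH hFn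
  have c2 := hb.nrm_high_mul_blk_low_le i n (Or.inl rfl) hF hH hG hFn
  have c3 := hb.nrm_high_mul_blk_low_le i n (Or.inr rfl) hG hF hH hGn
  have c4 := hb.nrm_high_mul_blk_low_le i n (Or.inl rfl) hG hH hF hGn
  have c5 := hb.nrm_high_mul_blk_low_le i n (Or.inr rfl) hH hF hG hHn
  have c6 := hb.nrm_high_mul_blk_low_le i n (Or.inl rfl) hH hG hF hHn
  have c7 := hb.nrm_blk_blk_mul_le i hF hG (hb.nrm_low_le (i + 1) hH) (s1 H) rfl
  have c8 := hb.nrm_blk_blk_mul_le i (X := blk N i F * low N i G * blk N i H) hF hH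
    (hb.nrm_low_le i hG) (s0 G) (ext_phys fun x => by simp only [phys_mul]; ring)
  have c9 := hb.nrm_blk_blk_mul_le i (X := low N i F * blk N i G * blk N i H) hG hH
    (hb.nrm_low_le i hF) (s0 F) (ext_phys fun x => by simp only [phys_mul]; ring)
  rw [lowPart_succ_sub]
  simp only [mult_add]
  have t : ∀ {X Y : Spec} {a b : ℝ}, nrm 2 X ≤ a → nrm 2 Y ≤ b → nrm 2 (X + Y) ≤ a + b :=
    fun hX hY => (nrm_add_le _ _ _).trans (add_le_add hX hY)
  refine (t (t (t (t (t (t (t (t c1 c2) c3) c4) c5) c6) c7) c8) c9).trans (le_of_eq ?_)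
  ring

/-- High-high interactions: the product of three spectra agrees with its low part up to an
error of size `1 / N`. -/
lemma SymbBds.nrm_mul_sub_lowPart_le (hb : SymbBds h E C) (K : ℕ) {F G H : Spec}
    (hF : nrm 6 (mult h.amp F) ≤ V) (hG : nrm 6 (mult h.amp G) ≤ V)
    (hH : nrm 6 (mult h.amp H) ≤ V) (hFK : ∀ k, K ≤ k → low N k F = F)
    (hGK : ∀ k, K ≤ k → low N k G = G) (hHK : ∀ k, K ≤ k → low N k H = H) :
    nrm 2 (mult h.amp (F * G * H - lowPart N 0 F G H)) ≤ 111 * C ^ 6 * E * V ^ 3 / N := by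
  have hC := hb.one_le_C
  have hE := hb.one_le_E
  have hV : 0 ≤ V := (nrm_nonneg _ _).trans hF
  have key : ∀ k, nrm 2 (mult h.amp (lowPart N k F G H - lowPart N 0 F G H))
      ≤ ∑ i ∈ Finset.range k, 111 * C ^ 5 * E * V ^ 3 * (h.size i)⁻¹ := fun k => by
    induction k with
    | zero =>
      have : mult h.amp (0 : Spec) = 0 := Subtype.ext (funext fun ξ => mul_zero _)
      rw [sub_self, this, nrm_zero]
      simp
    | succ k ih =>
      have e : lowPart N (k + 1) F G H - lowPart N 0 F G H
          = (lowPart N k F G H - lowPart N 0 F G H)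
            + (lowPart N (k + 1) F G H - lowPart N k F G H) := by abel
      rw [e, mult_add, Finset.sum_range_succ]
      exact (nrm_add_le _ _ _).trans (add_le_add ih (hb.nrm_lowPart_succ_sub_le k K hF hG hH
        (hFK _ (by omega)) (hGK _ (by omega)) (hHK _ (by omega))))
  have hK := key K
  rw [lowPart_eq_of_low_eq (hFK K le_rfl) (hGK K le_rfl) (hHK K le_rfl), ← Finset.mul_sum] at hK
  refine hK.trans ?_
  calc _ ≤ 111 * C ^ 5 * E * V ^ 3 * (C / N) := by
        gcongr
        exact hb.sum_le K
    _ = _ := by ring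

end Step

end Spec

namespace Spec

section Comparison

variable {s N A : ℝ} {μ : ℝ → ℝ}

/-- The symbol `μ(|ξ|)`. -/
def Weight.symb (h : Weight s N A μ) : Symb :=
  ⟨fun ξ => (μ ‖ξ‖ : ℂ), Complex.continuous_ofReal.comp (h.continuous.comp continuous_norm), 1, 0,
    fun ξ => by
      rw [pow_zero, mul_one, Complex.norm_real, Real.norm_of_nonneg (h.pos _).le]
      exact h.le_one _⟩

lemma Weight.symb_apply (h : Weight s N A μ) (ξ : Plane) : h.symb.1 ξ = (μ ‖ξ‖ : ℂ) := rfl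

variable {h₁ : Weight s N A μ} {h₂ : Weight s N A fun _ => 1} {E C V : ℝ}

lemma Weight.mult_amp_mult_symb (h₁ : Weight s N A μ) (h₂ : Weight s N A fun _ => 1) (F : Spec) :
    mult h₂.amp (mult h₁.symb F) = mult h₁.amp F :=
  Subtype.ext (funext fun ξ => by
    rw [mult_apply, mult_apply, mult_apply, h₁.amp_apply, h₂.amp_apply, h₁.symb_apply]
    push_cast
    ring)

lemma Weight.mult_symb_eq_self (h : Weight s N A μ) {F : Spec} (hF : SuppLe F N) :
    mult h.symb F = F := by
  conv_rhs => rw [← one_mult F]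
  refine mult_congr fun ξ hξ => ?_
  rw [h.symb_apply, h.eq_one _ (hF ξ hξ)]
  rfl

lemma Weight.mult_amp_eq (h₁ : Weight s N A μ) (h₂ : Weight s N A fun _ => 1) {F : Spec}
    (hF : SuppLe F N) : mult h₁.amp F = mult h₂.amp F := by
  rw [← h₁.mult_amp_mult_symb h₂, h₁.mult_symb_eq_self hF]

lemma Weight.low_mult_symb (h : Weight s N A μ) {k : ℕ} (hk : k ≤ 5) (F : Spec) :
    low N k (mult h.symb F) = low N k F := by
  have hN : 0 < N := by linarith [h.one_le]
  rw [← mult_low]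
  refine h.mult_symb_eq_self ((suppLe_low hN k F).mono ?_)
  have := scale_mono hN hk
  simp only [scale] at this ⊢
  linarith

lemma nrm_low_high_diff_le (hb₁ : SymbBds h₁ E C) (hb₂ : SymbBds h₂ E C) {K : ℕ}
    {F G H : Spec} (hF : nrm 6 (mult h₁.amp F) ≤ V) (hG : nrm 6 (mult h₁.amp G) ≤ V)
    (hH : nrm 6 (mult h₁.amp H) ≤ V) (hFK : ∀ k, K ≤ k → low N k F = F) :
    nrm 2 (mult h₁.amp (low N 0 G * low N 0 H * (F - low N 4 F))
      - mult h₂.amp (low N 0 G * low N 0 H * (mult h₁.symb F - low N 4 (mult h₁.symb F))))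
      ≤ 32 * C ^ 4 * E ^ 2 * V ^ 3 / N := by
  have hN : 0 < N := by linarith [h₁.one_le]
  have hr := scale_pos hN 0
  have hC := hb₁.one_le_C
  have hE := hb₁.one_le_E
  have hV : 0 ≤ V := (nrm_nonneg _ _).trans hF
  set X := low N 0 G * low N 0 H with hX
  set F' := mult h₁.symb F with hF'
  have e1 : mult h₂.amp (F' - low N 4 F') = mult h₁.amp (F - low N 4 F) := by
    rw [hF', ← mult_low, ← mult_sub, h₁.mult_amp_mult_symb h₂]
  have e2 : mult h₁.amp (X * (F - low N 4 F)) - mult h₂.amp (X * (F' - low N 4 F'))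
      = comm h₁.amp X (low N (4 + K) F - low N 4 F)
        - comm h₂.amp X (low N (4 + K) F' - low N 4 F') := by
    have e3 : low N (4 + K) F = F := hFK _ (by omega)
    have e4 : low N (4 + K) F' = F' := by rw [hF', ← mult_low, e3]
    rw [e3, e4, comm, comm, e1]
    abel
  have l3 : Lip 3 X (2 * C ^ 2 * E ^ 2 * V ^ 2) := by
    refine ((hb₁.lip_low_zero hG).mul (hb₁.lip_low_zero hH) (by positivity)
      (hb₁.nrm_low_le 0 hG) (hb₁.nrm_low_le 0 hH)).mono (le_of_eq ?_)
    ring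
  have h16 : scale N 4 = N / 4 := by
    simp only [scale]
    ring
  have sp : SuppLe X (scale N 4 / 2) := by
    refine ((suppLe_low hN 0 G).mul (suppLe_low hN 0 H)).mono ?_
    simp only [scale]
    linarith
  have hF2 : nrm 6 (mult h₂.amp F') ≤ V := by rwa [hF', h₁.mult_amp_mult_symb h₂]
  have b1 := hb₁.nrm_comm_le 4 K (by positivity) sp l3 hF
  have b2 := hb₂.nrm_comm_le 4 K (by positivity) sp l3 hF2
  rw [e2]
  refine (nrm_sub_le _ _ _).trans ((add_le_add b1 b2).trans (le_of_eq ?_))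
  rw [h16]
  field_simp
  ring

/-- The products in which every frequency is below a fraction of `N`. -/
def lowLowPart (N : ℝ) (F G H : Spec) : Spec :=
  low N 4 F * low N 0 G * low N 0 H + low N 0 F * low N 4 G * low N 0 H
    + low N 0 F * low N 0 G * low N 4 H
    - low N 0 F * low N 0 G * low N 0 H - low N 0 F * low N 0 G * low N 0 H

lemma lowPart_zero_eq (N : ℝ) (F G H : Spec) :
    lowPart N 0 F G H = low N 0 G * low N 0 H * (F - low N 4 F)
      + low N 0 F * low N 0 H * (G - low N 4 G) + low N 0 F * low N 0 G * (H - low N 4 H)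
      + lowLowPart N F G H := by
  refine ext_phys fun x => ?_
  simp only [lowPart, lowLowPart, phys_add, phys_sub, phys_mul]
  ring

lemma suppLe_lowLowPart (hN : 0 < N) (F G H : Spec) : SuppLe (lowLowPart N F G H) N := by
  have s0 : ∀ X, SuppLe (low N 0 X) (N / 32) := fun X =>
    (suppLe_low hN 0 X).mono (by simp only [scale]; linarith)
  have s4 : ∀ X, SuppLe (low N 4 X) (N / 2) := fun X =>
    (suppLe_low hN 4 X).mono (by simp only [scale]; linarith)
  have t : ∀ {X Y Z : Spec} {a b c : ℝ}, SuppLe X a → SuppLe Y b → SuppLe Z c → a + b + c ≤ N →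
      SuppLe (X * Y * Z) N := fun hX hY hZ hle => ((hX.mul hY).mul hZ).mono hle
  refine SuppLe.sub (SuppLe.sub (SuppLe.add (SuppLe.add ?_ ?_) ?_) ?_) ?_
  · exact t (s4 F) (s0 G) (s0 H) (by linarith)
  · exact t (s0 F) (s4 G) (s0 H) (by linarith)
  · exact t (s0 F) (s0 G) (s4 H) (by linarith)
  · exact t (s0 F) (s0 G) (s0 H) (by linarith)
  · exact t (s0 F) (s0 G) (s0 H) (by linarith)

lemma nrm_lowPart_diff_le (hb₁ : SymbBds h₁ E C) (hb₂ : SymbBds h₂ E C) {K : ℕ}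
    {F G H : Spec} (hF : nrm 6 (mult h₁.amp F) ≤ V) (hG : nrm 6 (mult h₁.amp G) ≤ V)
    (hH : nrm 6 (mult h₁.amp H) ≤ V) (hFK : ∀ k, K ≤ k → low N k F = F)
    (hGK : ∀ k, K ≤ k → low N k G = G) (hHK : ∀ k, K ≤ k → low N k H = H) :
    nrm 2 (mult h₁.amp (lowPart N 0 F G H) - mult h₂.amp
      (lowPart N 0 (mult h₁.symb F) (mult h₁.symb G) (mult h₁.symb H)))
      ≤ 96 * C ^ 4 * E ^ 2 * V ^ 3 / N := by
  have hN : 0 < N := by linarith [h₁.one_le]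
  have c1 := nrm_low_high_diff_le hb₁ hb₂ hF hG hH hFK
  have c2 := nrm_low_high_diff_le hb₁ hb₂ hG hF hH hGK
  have c3 := nrm_low_high_diff_le hb₁ hb₂ hH hF hG hHK
  have z : lowLowPart N (mult h₁.symb F) (mult h₁.symb G) (mult h₁.symb H)
      = lowLowPart N F G H := by
    simp only [lowLowPart, h₁.low_mult_symb (k := 0) (by norm_num),
      h₁.low_mult_symb (k := 4) (by norm_num)]
  have z2 := h₁.mult_amp_eq h₂ (suppLe_lowLowPart hN F G H)
  have e : ∀ {a b c d a' b' c' d' : Spec}, d = d' → (a + b + c + d) - (a' + b' + c' + d')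
      = (a - a') + (b - b') + (c - c') := fun h => by
    rw [h]
    abel
  rw [lowPart_zero_eq, lowPart_zero_eq, z]
  simp only [mult_add]
  rw [e z2]
  simp only [h₁.low_mult_symb (k := 0) (by norm_num)]
  have t : ∀ {X Y : Spec} {a b : ℝ}, nrm 2 X ≤ a → nrm 2 Y ≤ b → nrm 2 (X + Y) ≤ a + b :=
    fun hX hY => (nrm_add_le _ _ _).trans (add_le_add hX hY)
  refine (t (t c1 c2) c3).trans (le_of_eq ?_)
  ring

/-- The commutator of the smoothing multiplier with a triple product, for spectra supported in a
ball. -/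
lemma nrm_triple_diff_le_of_low_eq (hb₁ : SymbBds h₁ E C) (hb₂ : SymbBds h₂ E C) {K : ℕ}
    {F G H : Spec} (hF : nrm 6 (mult h₁.amp F) ≤ V) (hG : nrm 6 (mult h₁.amp G) ≤ V)
    (hH : nrm 6 (mult h₁.amp H) ≤ V) (hFK : ∀ k, K ≤ k → low N k F = F)
    (hGK : ∀ k, K ≤ k → low N k G = G) (hHK : ∀ k, K ≤ k → low N k H = H) :
    nrm 2 (mult h₂.amp (mult h₁.symb (F * G * H)
      - mult h₁.symb F * mult h₁.symb G * mult h₁.symb H)) ≤ 318 * C ^ 6 * E ^ 2 * V ^ 3 / N := by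
  have hN : 0 < N := by linarith [h₁.one_le]
  have hC := hb₁.one_le_C
  have hE := hb₁.one_le_E
  have hV : 0 ≤ V := (nrm_nonneg _ _).trans hF
  have t : ∀ {X : Spec}, (∀ k, K ≤ k → low N k X = X) →
      ∀ k, K ≤ k → low N k (mult h₁.symb X) = mult h₁.symb X := fun hX k hk => by
    rw [← mult_low, hX k hk]
  have c1 := nrm_lowPart_diff_le hb₁ hb₂ hF hG hH hFK hGK hHK
  have c2 := hb₁.nrm_mul_sub_lowPart_le K hF hG hH hFK hGK hHK
  rw [← h₁.mult_amp_mult_symb h₂] at hF hG hH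
  have c3 := hb₂.nrm_mul_sub_lowPart_le K hF hG hH (t hFK) (t hGK) (t hHK)
  rw [mult_sub, h₁.mult_amp_mult_symb h₂]
  have e : ∀ X Y X₀ Y₀ : Spec, mult h₁.amp X - mult h₂.amp Y = mult h₁.amp (X - X₀)
      - mult h₂.amp (Y - Y₀) + (mult h₁.amp X₀ - mult h₂.amp Y₀) := fun X Y X₀ Y₀ => by
    rw [mult_sub, mult_sub]
    abel
  rw [e _ _ (lowPart N 0 F G H)
    (lowPart N 0 (mult h₁.symb F) (mult h₁.symb G) (mult h₁.symb H))]
  refine (nrm_add_le _ _ _).trans ((add_le_add ((nrm_sub_le _ _ _).trans (add_le_add c2 c3))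
    c1).trans ?_)
  have p1 : C ^ 4 * E ^ 2 * V ^ 3 / N ≤ C ^ 6 * E ^ 2 * V ^ 3 / N := by
    gcongr
    norm_num
  have p2 : C ^ 6 * E * V ^ 3 / N ≤ C ^ 6 * E ^ 2 * V ^ 3 / N := by
    gcongr
    exact le_self_pow₀ hE (by norm_num)
  calc _ = 222 * (C ^ 6 * E * V ^ 3 / N) + 96 * (C ^ 4 * E ^ 2 * V ^ 3 / N) := by ring
    _ ≤ 222 * (C ^ 6 * E ^ 2 * V ^ 3 / N) + 96 * (C ^ 6 * E ^ 2 * V ^ 3 / N) := by linarith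
    _ = _ := by ring

end Comparison

end Spec

namespace Spec

section Limit

open Filter

/-- Dominated convergence for convolutions. -/
lemma tendsto_mul_apply {F G : ℕ → Spec} {F₀ G₀ B : Spec} {a : ℝ}
    (hF : ∀ ξ, Tendsto (fun n => (F n).1 ξ) atTop (nhds (F₀.1 ξ)))
    (hG : ∀ ξ, Tendsto (fun n => (G n).1 ξ) atTop (nhds (G₀.1 ξ)))
    (ha : ∀ n ξ, ‖(F n).1 ξ‖ ≤ a) (hb : ∀ n ξ, ‖(G n).1 ξ‖ ≤ ‖B.1 ξ‖) (ξ : Plane) :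
    Tendsto (fun n => (F n * G n).1 ξ) atTop (nhds ((F₀ * G₀).1 ξ)) := by
  simp only [mul_apply]
  refine tendsto_integral_of_dominated_convergence (fun η => a * ‖B.1 (ξ - η)‖)
    (fun n => ?_) ((B.integrable.comp_sub_left ξ).norm.const_mul a) (fun n => ?_) ?_
  · exact ((F n).continuous.mul
      ((G n).continuous.comp (continuous_const.sub continuous_id))).aestronglyMeasurable
  · refine Eventually.of_forall fun η => ?_
    rw [norm_mul]
    exact mul_le_mul (ha n η) (hb n _) (norm_nonneg _) ((norm_nonneg _).trans (ha n η))
  · exact Eventually.of_forall fun η => (hF η).mul (hG _)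

lemma norm_mul_apply_le {F G B : Spec} {a : ℝ} (ha : ∀ ξ, ‖F.1 ξ‖ ≤ a)
    (hb : ∀ ξ, ‖G.1 ξ‖ ≤ ‖B.1 ξ‖) (ξ : Plane) : ‖(F * G).1 ξ‖ ≤ a * ∫ η, ‖B.1 η‖ := by
  rw [mul_apply, ← integral_sub_left_eq_self (fun η => ‖B.1 η‖) volume ξ, ← integral_const_mul]
  refine norm_integral_le_of_norm_le ((B.integrable.comp_sub_left ξ).norm.const_mul a)
    (Eventually.of_forall fun η => ?_)
  rw [norm_mul]
  exact mul_le_mul (ha η) (hb _) (norm_nonneg _) ((norm_nonneg _).trans (ha η))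

lemma tendsto_triple_mul_apply {F G H : ℕ → Spec} {F₀ G₀ H₀ A B C : Spec}
    (hF : ∀ ξ, Tendsto (fun n => (F n).1 ξ) atTop (nhds (F₀.1 ξ)))
    (hG : ∀ ξ, Tendsto (fun n => (G n).1 ξ) atTop (nhds (G₀.1 ξ)))
    (hH : ∀ ξ, Tendsto (fun n => (H n).1 ξ) atTop (nhds (H₀.1 ξ)))
    (ha : ∀ n ξ, ‖(F n).1 ξ‖ ≤ ‖A.1 ξ‖) (hb : ∀ n ξ, ‖(G n).1 ξ‖ ≤ ‖B.1 ξ‖)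
    (hc : ∀ n ξ, ‖(H n).1 ξ‖ ≤ ‖C.1 ξ‖) (ξ : Plane) :
    Tendsto (fun n => (F n * G n * H n).1 ξ) atTop (nhds ((F₀ * G₀ * H₀).1 ξ)) := by
  obtain ⟨a, -, haa⟩ := A.bounded
  exact tendsto_mul_apply (tendsto_mul_apply hF hG (fun n ξ => (ha n ξ).trans (haa ξ)) hb) hH
    (fun n ξ => norm_mul_apply_le (fun ξ => (ha n ξ).trans (haa ξ)) (hb n) ξ) hc ξ

lemma low_apply_of_le {N : ℝ} (hN : 0 < N) {k : ℕ} {F : Spec} {ξ : Plane} (hξ : ‖ξ‖ ≤ scale N k) :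
    (low N k F).1 ξ = F.1 ξ := by
  rw [low, mult_apply, chi_eq_one (scale_pos hN k) hξ, one_mul]

lemma tendsto_scale {N : ℝ} (hN : 0 < N) : Tendsto (scale N) atTop atTop :=
  (tendsto_pow_atTop_atTop_of_one_lt (by norm_num)).atTop_mul_const (by positivity)

lemma tendsto_low_apply {N : ℝ} (hN : 0 < N) (F : Spec) (ξ : Plane) :
    Tendsto (fun k => (low N k F).1 ξ) atTop (nhds (F.1 ξ)) :=
  tendsto_const_nhds.congr' (((tendsto_scale hN).eventually_ge_atTop ‖ξ‖).mono fun _ hk =>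
    (low_apply_of_le hN hk).symm)

lemma norm_low_apply_le (N : ℝ) (k : ℕ) (F : Spec) (ξ : Plane) :
    ‖(low N k F).1 ξ‖ ≤ ‖F.1 ξ‖ := by
  rw [low, mult_apply, norm_mul]
  exact mul_le_of_le_one_left (norm_nonneg _) (norm_chi_le _ _)

lemma low_low {N : ℝ} (hN : 0 < N) {j k : ℕ} (hjk : j < k) (F : Spec) :
    low N k (low N j F) = low N j F := by
  have := scale_mono hN hjk
  rw [scale_succ] at this
  rw [low, low, mult_mult, chi_mul_chi (scale_pos hN j) this]

variable {s N A : ℝ} {μ : ℝ → ℝ} {h₁ : Weight s N A μ} {h₂ : Weight s N A fun _ => 1} {E C V : ℝ}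

/-- The commutator of the smoothing multiplier with a triple product. -/
def tripleComm (b : Symb) (F G H : Spec) : Spec :=
  mult b (F * G * H) - mult b F * mult b G * mult b H

lemma tendsto_tripleComm_low (hN : 0 < N) (a b : Symb) (F G H : Spec) (ξ : Plane) :
    Tendsto (fun k => (mult a (tripleComm b (low N k F) (low N k G) (low N k H))).1 ξ) atTop
      (nhds ((mult a (tripleComm b F G H)).1 ξ)) := by
  have e : ∀ X : Spec, ∀ ξ, Tendsto (fun k => (mult b (low N k X)).1 ξ) atTop
      (nhds ((mult b X).1 ξ)) := fun X ξ => by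
    simp only [mult_low]
    exact tendsto_low_apply hN _ ξ
  have e' : ∀ (X : Spec) k ξ, ‖(mult b (low N k X)).1 ξ‖ ≤ ‖(mult b X).1 ξ‖ := fun X k ξ => by
    rw [mult_low]
    exact norm_low_apply_le _ _ _ _
  have t1 := tendsto_triple_mul_apply (tendsto_low_apply hN F) (tendsto_low_apply hN G)
    (tendsto_low_apply hN H) (fun n => norm_low_apply_le N n F) (fun n => norm_low_apply_le N n G)
    (fun n => norm_low_apply_le N n H) ξ
  have t2 := tendsto_triple_mul_apply (e F) (e G) (e H) (e' F) (e' G) (e' H) ξ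
  exact ((t1.const_mul (b.1 ξ)).sub t2).const_mul (a.1 ξ)

lemma nrm_tripleComm_le (hb₁ : SymbBds h₁ E C) (hb₂ : SymbBds h₂ E C)
    {F G H : Spec} (hF : nrm 6 (mult h₁.amp F) ≤ V) (hG : nrm 6 (mult h₁.amp G) ≤ V)
    (hH : nrm 6 (mult h₁.amp H) ≤ V) :
    nrm 2 (mult h₂.amp (tripleComm h₁.symb F G H)) ≤ 318 * C ^ 9 * E ^ 2 * V ^ 3 / N := by
  have hN : 0 < N := by linarith [h₁.one_le]
  have hC := hb₁.one_le_C
  have hE := hb₁.one_le_E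
  have hV : 0 ≤ V := (nrm_nonneg _ _).trans hF
  have hB : 0 ≤ 318 * C ^ 9 * E ^ 2 * V ^ 3 / N := by positivity
  have t : ∀ {X : Spec} (k : ℕ), nrm 6 (mult h₁.amp X) ≤ V →
      nrm 6 (mult h₁.amp (low N k X)) ≤ C * V := fun k hX => by
    rw [mult_low]
    exact ((hb₁.chi_bd k).2 _).trans (mul_le_mul_of_nonneg_left hX (by linarith))
  have key : ∀ k, nrm 2 (mult h₂.amp (tripleComm h₁.symb (low N k F) (low N k G) (low N k H)))
      ≤ 318 * C ^ 9 * E ^ 2 * V ^ 3 / N := fun k => by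
    refine (nrm_triple_diff_le_of_low_eq hb₁ hb₂ (K := k + 1) (t k hF) (t k hG) (t k hH)
      (fun j hj => low_low hN hj F) (fun j hj => low_low hN hj G)
      (fun j hj => low_low hN hj H)).trans (le_of_eq ?_)
    ring
  rw [nrm_le_iff hB, eLpNorm_phys_two]
  refine (Lp.eLpNorm_lim_le_liminf_eLpNorm (fun k => (Spec.continuous _).aestronglyMeasurable) _
    (Eventually.of_forall (tendsto_tripleComm_low hN h₂.amp h₁.symb F G H))).trans ?_
  refine liminf_le_of_frequently_le' (Frequently.of_forall fun k => ?_)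
  rw [← eLpNorm_phys_two, ← nrm_le_iff hB]
  exact key k

theorem exists_tripleComm_bound {ε : ℝ} (hs0 : 0 < s) (hs1 : s < 1) (hA : 1 ≤ A) (hε : 0 < ε)
    (hε1 : ε ≤ 1) : ∃ C : ℝ, 1 ≤ C ∧ ∀ (N : ℝ) (μ : ℝ → ℝ) (h₁ : Weight s N A μ)
      (h₂ : Weight s N A fun _ => 1) (F G H : Spec) (V : ℝ), nrm 6 (mult h₁.amp F) ≤ V →
      nrm 6 (mult h₁.amp G) ≤ V → nrm 6 (mult h₁.amp H) ≤ V →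
      nrm 2 (mult h₂.amp (tripleComm h₁.symb F G H)) ≤ C * (N ^ ε) ^ 2 * V ^ 3 / N := by
  obtain ⟨C, hC⟩ := exists_symbBds hs0 hs1 hA hε hε1
  have hC1 : 1 ≤ C := (hC 1 _ (Weight.one hs1.le le_rfl hA)).one_le_C
  refine ⟨318 * C ^ 9, ?_, fun N μ h₁ h₂ F G H V hF hG hH =>
    nrm_tripleComm_le (hC N μ h₁) (hC N _ h₂) hF hG hH⟩
  linarith [one_le_pow₀ hC1 (n := 9)]

end Limit

end Spec

namespace Spec

section Derivative

/-- The symbol of the derivative in the direction `v`. -/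
def dirSymb (v : Plane) : Symb :=
  ⟨fun ξ => 2 * π * I * (inner ℝ ξ v : ℝ), by fun_prop, 2 * π * ‖v‖, 1, fun ξ => by
    have h1 : ‖(2 * π * I : ℂ)‖ = 2 * π := by simp [abs_of_pos Real.pi_pos]
    rw [norm_mul, h1, Complex.norm_real, pow_one]
    calc 2 * π * ‖(inner ℝ ξ v : ℝ)‖ ≤ 2 * π * (‖ξ‖ * ‖v‖) := by
          gcongr
          exact norm_inner_le_norm ξ v
      _ ≤ 2 * π * ((1 + ‖ξ‖) * ‖v‖) := by
          gcongr
          linarith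
      _ = _ := by ring⟩

lemma dirSymb_apply (v ξ : Plane) : (dirSymb v).1 ξ = 2 * π * I * (inner ℝ ξ v : ℝ) := rfl

lemma norm_dirSymb_le (v ξ : Plane) : ‖(dirSymb v).1 ξ‖ ≤ 2 * π * (‖ξ‖ * ‖v‖) := by
  have h1 : ‖(2 * π * I : ℂ)‖ = 2 * π := by simp [abs_of_pos Real.pi_pos]
  rw [dirSymb_apply, norm_mul, h1, Complex.norm_real]
  gcongr
  exact norm_inner_le_norm ξ v

lemma integrable_norm_mul_norm (F : Spec) : Integrable fun ξ => ‖ξ‖ * ‖F.1 ξ‖ := by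
  set b : Symb := ⟨fun ξ => (‖ξ‖ : ℂ), by fun_prop, 1, 1, fun ξ => by
    rw [Complex.norm_real, norm_norm, pow_one, one_mul]
    linarith⟩ with hb
  refine (mult b F).integrable.norm.congr (Filter.Eventually.of_forall fun ξ => ?_)
  change ‖(‖ξ‖ : ℂ) * F.1 ξ‖ = _
  rw [norm_mul, Complex.norm_real, norm_norm]

lemma fderiv_phys (F : Spec) (x v : Plane) :
    fderiv ℝ (phys F) x v = phys (mult (dirSymb v) F) x := by
  have h1 := Real.hasFDerivAt_fourier F.integrable (integrable_norm_mul_norm F) (-x)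
  have h2 := h1.comp x (hasFDerivAt_id x).neg
  have h3 : phys F = 𝓕 F.1 ∘ fun y => -y := funext fun y => phys_eq_fourier_neg F y
  have h4 :
      Integrable (VectorFourier.fourierSMulRight (innerSL ℝ) F.1 : Plane → Plane →L[ℝ] ℂ) := by
    refine ((integrable_norm_mul_norm F).const_mul (2 * π * ‖innerSL ℝ (E := Plane)‖)).mono'
      (F.continuous.aestronglyMeasurable.fourierSMulRight) (Filter.Eventually.of_forall fun ξ => ?_)
    exact (VectorFourier.norm_fourierSMulRight_le (innerSL ℝ) F.1 ξ).trans (le_of_eq (by ring))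
  rw [h3, (show fderiv ℝ (𝓕 F.1 ∘ fun y => -y) x = _ from h2.fderiv)]
  rw [ContinuousLinearMap.comp_apply, Real.fourier_continuousLinearMap_apply h4,
    phys_eq_fourier_neg]
  refine congrArg _ (funext fun ξ => ?_)
  simp [VectorFourier.fourierSMulRight_apply, dirSymb_apply]
  erw [innerSL_apply_apply]
  ring

end Derivative

section Schwartz

/-- The frequency representation of a Schwartz function. -/
def ofSchwartz (g : SchwartzMap Plane ℂ) : Spec :=
  ⟨𝓕 (g : Plane → ℂ), (𝓕 g : SchwartzMap Plane ℂ).continuous, fun k =>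
    ⟨_, fun ξ => by
      have := SchwartzMap.one_add_le_sup_seminorm_apply (𝕜 := ℝ) (m := (k, 0)) le_rfl le_rfl
        (𝓕 g : SchwartzMap Plane ℂ) ξ
      rwa [norm_iteratedFDeriv_zero] at this⟩⟩

lemma phys_ofSchwartz (g : SchwartzMap Plane ℂ) : phys (ofSchwartz g) = g :=
  g.continuous.fourierInv_fourier_eq g.integrable (𝓕 g : SchwartzMap Plane ℂ).integrable

lemma phys_cubic (g : SchwartzMap Plane ℂ) (x : Plane) :
    phys (ofSchwartz g * ofSchwartz g * conj (ofSchwartz g)) x = ((‖g x‖ ^ 2 : ℝ) : ℂ) * g x := by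
  rw [phys_mul, phys_mul, phys_conj, phys_ofSchwartz, mul_assoc, Complex.mul_conj,
    Complex.normSq_eq_norm_sq, mul_comm]

lemma fourier_cubic (g : SchwartzMap Plane ℂ) : 𝓕 (fun x => ((‖g x‖ ^ 2 : ℝ) : ℂ) * g x)
    = (ofSchwartz g * ofSchwartz g * conj (ofSchwartz g)).1 := by
  have e : phys (ofSchwartz g * ofSchwartz g * conj (ofSchwartz g))
      = fun x => ((‖g x‖ ^ 2 : ℝ) : ℂ) * g x := funext (phys_cubic g)
  rw [← e]
  refine fourier_phys _ ?_
  rw [e]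
  obtain ⟨C, -, hC⟩ := g.decay 0 0
  refine g.integrable.bdd_mul (c := C ^ 2) (by fun_prop) (Filter.Eventually.of_forall fun x => ?_)
  have := hC x
  rw [pow_zero, one_mul, norm_iteratedFDeriv_zero] at this
  rw [Complex.norm_real, norm_pow, norm_norm]
  gcongr

variable {s N A : ℝ} {μ : ℝ → ℝ}

lemma Weight.conj_mult_symb (h : Weight s N A μ) (F : Spec) :
    conj (mult h.symb F) = mult h.symb (conj F) :=
  Subtype.ext (funext fun ξ => by
    change starRingEnd ℂ (h.symb.1 (-ξ) * F.1 (-ξ)) = h.symb.1 ξ * starRingEnd ℂ (F.1 (-ξ))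
    rw [map_mul, h.symb_apply, h.symb_apply, Complex.conj_ofReal, norm_neg])

lemma Weight.conj_mult_amp (h : Weight s N A μ) (F : Spec) :
    conj (mult h.amp F) = mult h.amp (conj F) :=
  Subtype.ext (funext fun ξ => by
    change starRingEnd ℂ (h.amp.1 (-ξ) * F.1 (-ξ)) = h.amp.1 ξ * starRingEnd ℂ (F.1 (-ξ))
    rw [map_mul, h.amp_apply, h.amp_apply, Complex.conj_ofReal, norm_neg])

lemma Weight.phys_tripleComm (h : Weight s N A μ) (F : Spec) (x : Plane) :
    phys (tripleComm h.symb F F (conj F)) x = phys (mult h.symb (F * F * conj F)) x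
      - ((‖phys (mult h.symb F) x‖ ^ 2 : ℝ) : ℂ) * phys (mult h.symb F) x := by
  rw [tripleComm, phys_sub, phys_mul, phys_mul, ← h.conj_mult_symb, phys_conj, mul_assoc,
    Complex.mul_conj, Complex.normSq_eq_norm_sq, mul_comm (phys (mult h.symb F) x)]

/-- The `L²` norms of a function and of its derivatives are controlled by the inhomogeneous
weight. -/
lemma nrm_two_le_amp_one (h : Weight s N A fun _ => 1) (F : Spec) :
    nrm 2 F ≤ nrm 2 (mult h.amp F) := by
  refine nrm_two_mono fun ξ => ?_
  rw [mult_apply, norm_mul]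
  refine le_mul_of_one_le_left (norm_nonneg _) ?_
  rw [h.amp_apply, Complex.norm_real]
  exact (h.one_le_amp (norm_nonneg ξ)).trans (le_abs_self _)

lemma nrm_two_dirSymb_le (h : Weight s N A fun _ => 1) (F : Spec) {v : Plane} (hv : ‖v‖ ≤ 1) :
    nrm 2 (mult (dirSymb v) F) ≤ 2 * π * nrm 2 (mult h.amp F) := by
  have e : mult (dirSymb v) F = mult (dirSymb v * h.ampInv) (mult h.amp F) := by
    rw [← mult_mult, h.mult_ampInv_mult_amp]
  rw [e]
  refine nrm_two_mult_le (by positivity) fun ξ _ => ?_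
  change ‖(dirSymb v).1 ξ * h.ampInv.1 ξ‖ ≤ _
  have h0 : 0 < 1 + ‖ξ‖ := by positivity
  rw [norm_mul, h.ampInv_apply, mul_one, Complex.norm_real, Real.norm_of_nonneg (by positivity),
    ← div_eq_mul_inv, div_le_iff₀ h0]
  refine (norm_dirSymb_le v ξ).trans ?_
  gcongr
  nlinarith [norm_nonneg ξ]

end Schwartz

end Spec

namespace IMultiplier

variable {s N : ℝ} {Ck : ℕ → ℝ} {φ : ℝ → ℝ}

/-- The radial profile, extended by `1` to the nonpositive half-line. -/
def extend (φ : ℝ → ℝ) (r : ℝ) : ℝ := if r ≤ 0 then 1 else φ r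

lemma extend_of_pos {r : ℝ} (hr : 0 < r) : extend φ r = φ r := if_neg hr.not_ge

lemma extend_of_nonpos {r : ℝ} (hr : r ≤ 0) : extend φ r = 1 := if_pos hr

lemma growth (h : IMultiplier s N Ck φ) (hs0 : 0 < s) (hs1 : s < 1) (hN : 1 ≤ N) {r : ℝ}
    (hr : N ≤ r) : N ^ (1 - s) * r ^ s ≤ 2 * (r * φ r) := by
  have hN0 : 0 < N := by linarith
  have hr0 : 0 < r := by linarith
  rcases le_total r (2 * N) with hr2 | hr2
  · have h1 : N * φ N ≤ r * φ r := h.mono_mul (Set.mem_Ioi.2 hN0) (Set.mem_Ioi.2 hr0) hr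
    rw [h.eq_one N hN0 le_rfl, mul_one] at h1
    have h2 : N ^ (1 - s) * r ^ s ≤ (2 * N) ^ (1 - s) * (2 * N) ^ s := by
      gcongr ?_ * ?_
      · exact Real.rpow_le_rpow hN0.le (by linarith) (by linarith)
      · exact Real.rpow_le_rpow hr0.le hr2 hs0.le
    rw [← Real.rpow_add (by positivity), sub_add_cancel, Real.rpow_one] at h2
    linarith
  · have h1 : r * φ r = N ^ (1 - s) * r ^ s := by
      rw [h.eq_pow r hr2, Real.div_rpow hr0.le hN0.le, div_eq_mul_inv,
        ← Real.rpow_neg hN0.le, neg_sub, ← mul_assoc, mul_comm]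
      congr 1
      nth_rewrite 1 [← Real.rpow_one r]
      rw [← Real.rpow_add hr0]
      ring_nf
    rw [h1]
    have : 0 ≤ N ^ (1 - s) * r ^ s := by positivity
    linarith

lemma weight (h : IMultiplier s N Ck φ) (hs0 : 0 < s) (hs1 : s < 1) (hN : 1 ≤ N) :
    Spec.Weight s N (1 + ∑ k ∈ Finset.range 5, |Ck k|) (extend φ) where
  contDiff := h.contDiff.congr fun r hr => extend_of_pos hr
  pos r := by
    rcases le_or_gt r 0 with hr | hr
    · simp [extend_of_nonpos hr]
    · simpa [extend_of_pos hr] using h.pos r hr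
  le_one r := by
    rcases le_or_gt r 0 with hr | hr
    · simp [extend_of_nonpos hr]
    · simpa [extend_of_pos hr] using h.le_one r hr
  anti := h.anti.congr fun r hr => (extend_of_pos hr).symm
  eq_one r hr := by
    rcases le_or_gt r 0 with hr0 | hr0
    · exact extend_of_nonpos hr0
    · rw [extend_of_pos hr0, h.eq_one r hr0 hr]
  mono_mul := h.mono_mul.congr fun r hr => by simp only [extend_of_pos (Set.mem_Ioi.1 hr)]
  deriv_bound k hk r hr := by
    have hφ := h.pos r hr
    have e : extend φ =ᶠ[nhds r] φ := by
      filter_upwards [Ioi_mem_nhds hr] with y hy using extend_of_pos hy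
    rw [e.iteratedDeriv_eq, extend_of_pos hr]
    have hsum : |Ck k| ≤ ∑ k ∈ Finset.range 5, |Ck k| :=
      Finset.single_le_sum (f := fun k => |Ck k|) (fun _ _ => abs_nonneg _)
        (Finset.mem_range.2 (by omega))
    rcases Nat.eq_zero_or_pos k with rfl | hk0
    · rw [pow_zero, one_mul, iteratedDeriv_zero, abs_of_pos hφ]
      refine le_mul_of_one_le_left hφ.le ?_
      linarith [abs_nonneg (Ck 0)]
    · calc r ^ k * |iteratedDeriv k φ r| ≤ r ^ k * (Ck k * φ r * r ^ (-(k : ℝ))) := by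
            gcongr
            exact h.deriv_bound k hk0 r hr
        _ = Ck k * φ r := by
            rw [Real.rpow_neg hr.le, Real.rpow_natCast]
            field_simp
        _ ≤ _ := by
            gcongr
            linarith [le_abs_self (Ck k)]
  growth r hr := by
    rw [extend_of_pos (by linarith)]
    exact h.growth hs0 hs1 hN hr
  one_le := hN

end IMultiplier

lemma fourierMult_eq_phys {m : Plane → ℝ} {f : Plane → ℂ} {b : Symb} {F : Spec}
    (hm : ∀ ξ ≠ 0, (m ξ : ℂ) = b.1 ξ) (hf : 𝓕 f = F.1) :
    fourierMult m f = Spec.phys (Spec.mult b F) := by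
  funext x
  rw [Spec.phys_eq, fourierMult, Real.fourierInv_eq]
  refine integral_congr_ae ?_
  filter_upwards [compl_mem_ae_iff.2 (measure_singleton (0 : Plane))] with ξ hξ
  rw [hf, hm ξ hξ, Spec.mult_apply]

namespace Spec

variable {s N A T : ℝ} {φ : ℝ → ℝ} {u : ℝ → Plane → ℂ} {t : ℝ}

lemma DIop_eq_phys (h : Weight s N A (IMultiplier.extend φ)) (g : SchwartzMap Plane ℂ) :
    DIop φ g = phys (mult h.amp (ofSchwartz g)) :=
  fourierMult_eq_phys (fun ξ hξ => by
    rw [h.amp_apply, IMultiplier.extend_of_pos (norm_pos_iff.2 hξ)]) rfl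

lemma Wcomm_eq_phys (h : Weight s N A (IMultiplier.extend φ)) {g : SchwartzMap Plane ℂ}
    (hg : ⇑g = u t) : Wcomm φ u t
      = phys (tripleComm h.symb (ofSchwartz g) (ofSchwartz g) (conj (ofSchwartz g))) := by
  have hm : ∀ ξ : Plane, ξ ≠ 0 → ((φ ‖ξ‖ : ℝ) : ℂ) = h.symb.1 ξ := fun ξ hξ => by
    rw [h.symb_apply, IMultiplier.extend_of_pos (norm_pos_iff.2 hξ)]
  have h1 : Iop φ (u t) = phys (mult h.symb (ofSchwartz g)) :=
    fourierMult_eq_phys hm (congrArg _ hg.symm)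
  have h2 : Iop φ (cubicN u t)
      = phys (mult h.symb (ofSchwartz g * ofSchwartz g * conj (ofSchwartz g))) := by
    refine fourierMult_eq_phys hm ?_
    rw [← fourier_cubic]
    exact congrArg _ (funext fun x => by rw [cubicN, hg])
  funext x
  rw [h.phys_tripleComm, Wcomm, h1, h2]

lemma eLpNorm_sqrt_sum_pd_le (h : Weight s N A fun _ => 1) (F : Spec) :
    eLpNorm (fun x => Real.sqrt (∑ j, ‖pd j (phys F) x‖ ^ 2)) 2
      ≤ ENNReal.ofReal (4 * π * nrm 2 (mult h.amp F)) := by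
  obtain ⟨G, hG⟩ : ∃ G : Fin 2 → Spec, ∀ j, G j = mult (dirSymb (EuclideanSpace.single j 1)) F :=
    ⟨_, fun _ => rfl⟩
  have hpd : ∀ j x, pd j (phys F) x = phys (G j) x := fun j x => by
    rw [hG]
    exact fderiv_phys F x _
  have hle : ∀ x, ‖Real.sqrt (∑ j, ‖pd j (phys F) x‖ ^ 2)‖
      ≤ ‖‖phys (G 0) x‖ + ‖phys (G 1) x‖‖ := fun x => by
    rw [Real.norm_of_nonneg (Real.sqrt_nonneg _), Real.norm_of_nonneg (by positivity),
      Fin.sum_univ_two, hpd, hpd]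
    refine Real.sqrt_le_iff.2 ⟨by positivity, ?_⟩
    nlinarith [norm_nonneg (phys (G 0) x), norm_nonneg (phys (G 1) x)]
  have hj : ∀ j, nrm 2 (G j) ≤ 2 * π * nrm 2 (mult h.amp F) := fun j => by
    rw [hG]
    exact nrm_two_dirSymb_le h F (by simp)
  have hsum : eLpNorm (fun x => ‖phys (G 0) x‖ + ‖phys (G 1) x‖) 2 volume
      ≤ eLpNorm (phys (G 0)) 2 volume + eLpNorm (phys (G 1)) 2 volume := by
    rw [← eLpNorm_norm (phys (G 0)), ← eLpNorm_norm (phys (G 1))]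
    exact eLpNorm_add_le (continuous_phys _).norm.aestronglyMeasurable
      (continuous_phys _).norm.aestronglyMeasurable one_le_two
  rw [← ofReal_nrm, ← ofReal_nrm, ← ENNReal.ofReal_add (nrm_nonneg _ _) (nrm_nonneg _ _)] at hsum
  exact ((eLpNorm_mono hle).trans hsum).trans
    (ENNReal.ofReal_le_ofReal (by linarith [hj 0, hj 1]))

end Spec

lemma admissible_three_six : Admissible 3 6 := by
  refine ⟨?_, by norm_num⟩
  rw [← ENNReal.toReal_eq_toReal_iff' (by finiteness) (by finiteness),
    ENNReal.toReal_add (by finiteness) (by finiteness)]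
  simp
  norm_num

/-- A pointwise-in-time cubic estimate integrates to an `L¹_t` bound by the cube of an `L³_t`
norm. -/
lemma mixNorm_one_le_mul_mixNorm_three_pow {α E E' : Type*} [MeasureSpace α]
    [NormedAddCommGroup E] [NormedAddCommGroup E'] {T B : ℝ} {p q : ℝ≥0∞} {f : ℝ → α → E}
    {g : ℝ → α → E'} (hB : 0 ≤ B)
    (h : ∀ t ∈ Set.Ioc 0 T, (eLpNorm (f t) p).toReal ≤ B * (eLpNorm (g t) q).toReal ^ 3) :
    mixNorm T 1 p f ≤ ENNReal.ofReal B * mixNorm T 3 q g ^ 3 := by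
  have h3 : mixNorm T 3 q g ^ 3
      = ∫⁻ t in Set.Ioc 0 T, ‖(eLpNorm (g t) q).toReal‖ₑ ^ 3 := by
    rw [mixNorm, eLpNorm_eq_lintegral_rpow_enorm_toReal (by norm_num) (by norm_num),
      ← ENNReal.rpow_natCast, ← ENNReal.rpow_mul]
    norm_num
  rw [h3, mixNorm, eLpNorm_one_eq_lintegral_enorm,
    ← lintegral_const_mul' _ _ ENNReal.ofReal_ne_top]
  refine setLIntegral_mono' measurableSet_Ioc fun t ht => ?_
  rw [← ofReal_norm, ← ofReal_norm, Real.norm_of_nonneg ENNReal.toReal_nonneg,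
    Real.norm_of_nonneg ENNReal.toReal_nonneg, ← ENNReal.ofReal_pow ENNReal.toReal_nonneg,
    ← ENNReal.ofReal_mul hB]
  exact ENNReal.ofReal_le_ofReal (h t ht)

/-- The commutator estimate: `W = I_N(|u|²u) - |I_N u|² I_N u` and its
gradient are `O(N^{-1+ε}) Z_I³` in `L¹_t L²_x`, uniformly in `N ≥ 1` and `T`. -/
theorem commutator_estimate (s : ℝ) (hs0 : 0 < s) (hs1 : s < 1) (ε : ℝ) (hε : 0 < ε)
    (Ck : ℕ → ℝ) :
    ∃ C > (0:ℝ), ∀ N : ℝ, 1 ≤ N → ∀ φ : ℝ → ℝ, IMultiplier s N Ck φ →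
      ∀ T > (0:ℝ), ∀ u : ℝ → EuclideanSpace ℝ (Fin 2) → ℂ,
        ContDiff ℝ ∞ (Function.uncurry u) →
        (∀ t ∈ Set.Icc (0:ℝ) T, IsSchwartz (u t)) →
        mixNorm T 1 2 (fun t => Wcomm φ u t)
          + mixNorm T 1 2 (fun t x => Real.sqrt (∑ j, ‖pd j (Wcomm φ u t) x‖ ^ 2))
          ≤ ENNReal.ofReal (C * N ^ (-1 + ε)) * (ZInorm T φ u) ^ 3 := by
  have hA : 1 ≤ 1 + ∑ k ∈ Finset.range 5, |Ck k| :=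
    le_add_of_nonneg_right (Finset.sum_nonneg fun _ _ => abs_nonneg _)
  have hε' : 0 < min ε 1 / 2 := by positivity
  obtain ⟨C, hC1, hC⟩ := Spec.exists_tripleComm_bound hs0 hs1 hA hε'
    (by linarith [min_le_right ε 1])
  refine ⟨C * (1 + 4 * π), by positivity, fun N hN φ hφ T _ u _ hu => ?_⟩
  have hN0 : 0 < N := by linarith
  have h₁ := hφ.weight hs0 hs1 hN
  have h₂ := Spec.Weight.one (s := s) hs1.le hN hA
  set B := C * (N ^ (min ε 1 / 2)) ^ 2 / N with hB
  have hB0 : 0 ≤ B := by positivity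
  have hBN : B ≤ C * N ^ (-1 + ε) := by
    rw [hB, mul_div_assoc, ← Real.rpow_natCast, ← Real.rpow_mul hN0.le]
    gcongr
    rw [div_eq_mul_inv, ← Real.rpow_neg_one, ← Real.rpow_add hN0]
    refine Real.rpow_le_rpow_of_exponent_le hN ?_
    push_cast
    linarith [min_le_left ε 1]
  have hW : ∀ t ∈ Set.Ioc 0 T, ∃ G : Spec, Wcomm φ u t = Spec.phys G ∧
      Spec.nrm 2 (Spec.mult h₂.amp G) ≤ B * (eLpNorm (DIop φ (u t)) 6).toReal ^ 3 := by
    intro t ht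
    obtain ⟨g, hg⟩ := hu t ⟨ht.1.le, ht.2⟩
    refine ⟨_, Spec.Wcomm_eq_phys h₁ hg, ?_⟩
    have hV : (eLpNorm (DIop φ (u t)) 6).toReal
        = Spec.nrm 6 (Spec.mult h₁.amp (Spec.ofSchwartz g)) := by
      rw [← hg, Spec.DIop_eq_phys h₁]
      rfl
    rw [hV]
    refine (hC N _ h₁ h₂ _ _ _ _ le_rfl le_rfl ?_).trans_eq (by rw [hB]; ring)
    rw [← h₁.conj_mult_amp, Spec.nrm_conj]
  have hZ : mixNorm T 3 6 (fun t => DIop φ (u t)) ≤ ZInorm T φ u :=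
    le_iSup_of_le 3 (le_iSup_of_le 6 (le_iSup_of_le admissible_three_six le_rfl))
  have b₁ : mixNorm T 1 2 (fun t => Wcomm φ u t)
      ≤ ENNReal.ofReal B * mixNorm T 3 6 (fun t => DIop φ (u t)) ^ 3 := by
    refine mixNorm_one_le_mul_mixNorm_three_pow hB0 fun t ht => ?_
    obtain ⟨G, hG, hle⟩ := hW t ht
    rw [hG]
    exact (Spec.nrm_two_le_amp_one h₂ G).trans hle
  have b₂ : mixNorm T 1 2 (fun t x => Real.sqrt (∑ j, ‖pd j (Wcomm φ u t) x‖ ^ 2))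
      ≤ ENNReal.ofReal (4 * π * B) * mixNorm T 3 6 (fun t => DIop φ (u t)) ^ 3 := by
    refine mixNorm_one_le_mul_mixNorm_three_pow (by positivity) fun t ht => ?_
    obtain ⟨G, hG, hle⟩ := hW t ht
    rw [hG]
    refine (ENNReal.toReal_le_of_le_ofReal (mul_nonneg (by positivity) (Spec.nrm_nonneg _ _))
      (Spec.eLpNorm_sqrt_sum_pd_le h₂ G)).trans ?_
    rw [mul_assoc (4 * π)]
    gcongr
  calc _ ≤ (ENNReal.ofReal B + ENNReal.ofReal (4 * π * B))
        * mixNorm T 3 6 (fun t => DIop φ (u t)) ^ 3 := by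
        rw [add_mul]
        exact add_le_add b₁ b₂
    _ ≤ _ := by
        rw [← ENNReal.ofReal_add hB0 (by positivity)]
        gcongr
        calc B + 4 * π * B = (1 + 4 * π) * B := by ring
          _ ≤ (1 + 4 * π) * (C * N ^ (-1 + ε)) := by gcongr
          _ = _ := by ring

end
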